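/- arXiv:1509.02034 — 4 statements merged into one kernel-verified Lean document; each statement's English description precedes it below -/
import Mathlib

section
/- For every integer d ≥ 2 there exists a constant C > 0 depending only on d such that for all D > 0 the following holds: if nq ≥ C(1+D)^4 log^4(n) and q·log^6(n) ≤ 1/(C(1+D)^6), then with probability at least 1 − n^{−D} the binom(n−1,d−1) largest eigenvalues of the adjacency operator A of X(d,n,p) all lie in the interval np + [−7d, 7d]. -/
open MeasureTheory ProbabilityTheory Filter Polynomial

noncomputable section

/-- The cells of size `c` of the complete complex on vertex set `{0, …, n-1}`. -/
abbrev LMCell (n c : ℕ) : Type := {σ : Finset ℕ // σ ∈ Finset.powersetCard c (Finset.range n)}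

/-- Number of elements of `τ` smaller than some element of `s`; for `s = {u} ⊆ τ` this is the
position of `u` in the increasing enumeration of `τ`. -/
def LMidx (τ s : Finset ℕ) : ℕ := (τ.filter (fun x => ∃ y ∈ s, x < y)).card

open Classical in
/-- The adjacency matrix (in the basis of increasingly-oriented `(d-1)`-cells) of the
`d`-complex on `n` vertices with complete `(d-1)`-skeleton whose set of `d`-cells is `X`. -/
noncomputable def LMadj (n d : ℕ) (X : Set (Finset ℕ)) :
    Matrix (LMCell n d) (LMCell n d) ℝ := fun σ σ' =>
  if (σ.1 ∪ σ'.1).card = d + 1 ∧ (σ.1 ∪ σ'.1) ∈ X then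
    (-1 : ℝ) ^ (LMidx (σ.1 ∪ σ'.1) (σ'.1 \ σ.1) + LMidx (σ.1 ∪ σ'.1) (σ.1 \ σ'.1) + 1)
  else 0

/-- The `i`-th smallest eigenvalue (0-indexed) of a matrix: the `i`-th entry of the
non-decreasing enumeration of the roots (with multiplicity) of its characteristic polynomial. -/
noncomputable def LMeig {ι : Type} [Fintype ι] [DecidableEq ι] (M : Matrix ι ι ℝ) (i : ℕ) : ℝ :=
  ((M.charpoly.roots).sort (· ≤ ·)).getD i 0

set_option linter.unusedSectionVars false

section MatrixMoments

open Matrix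
open scoped Matrix.Norms.L2Operator

variable {κ : Type} [Fintype κ] [DecidableEq κ]

theorem exists_orthogonal_diagonalization {A : Matrix κ κ ℝ} (hA : A.IsSymm) :
    ∃ (U : Matrix κ κ ℝ) (a : κ → ℝ), Uᵀ * U = 1 ∧ U * Uᵀ = 1 ∧ A = U * diagonal a * Uᵀ ∧
      ‖A‖ = ‖a‖ := by
  have hA' : A.IsHermitian := by
    rw [Matrix.IsHermitian, Matrix.conjTranspose_eq_transpose_of_trivial]; exact hA
  have hs := hA'.spectral_theorem
  rw [Unitary.conjStarAlgAut_apply] at hs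
  refine ⟨hA'.eigenvectorUnitary, hA'.eigenvalues, ?_, ?_, ?_, ?_⟩
  · have := Unitary.coe_star_mul_self hA'.eigenvectorUnitary
    rwa [Matrix.star_eq_conjTranspose, Matrix.conjTranspose_eq_transpose_of_trivial] at this
  · have := Unitary.coe_mul_star_self hA'.eigenvectorUnitary
    rwa [Unitary.coe_star, Matrix.star_eq_conjTranspose,
      Matrix.conjTranspose_eq_transpose_of_trivial] at this
  · rw [Matrix.star_eq_conjTranspose, Matrix.conjTranspose_eq_transpose_of_trivial] at hs
    exact hs
  · have h2 : ‖A‖ = ‖diagonal (RCLike.ofReal ∘ hA'.eigenvalues : κ → ℝ)‖ := by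
      conv_lhs => rw [hs]
      rw [← Unitary.coe_star, CStarRing.norm_mul_coe_unitary, CStarRing.norm_coe_unitary_mul]
    rw [h2, Matrix.l2_opNorm_diagonal]
    rfl

theorem diagonalization_pow {A U : Matrix κ κ ℝ} {a : κ → ℝ} (h1 : Uᵀ * U = 1)
    (h2 : U * Uᵀ = 1) (h : A = U * diagonal a * Uᵀ) (m : ℕ) :
    A ^ m = U * diagonal (fun x => a x ^ m) * Uᵀ := by
  induction m with
  | zero => simp [h2]
  | succ m ih =>
    rw [pow_succ, ih, h]
    calc U * diagonal (fun x => a x ^ m) * Uᵀ * (U * diagonal a * Uᵀ)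
        = U * diagonal (fun x => a x ^ m) * (Uᵀ * U) * diagonal a * Uᵀ := by
          simp only [Matrix.mul_assoc]
      _ = _ := by
          rw [h1, Matrix.mul_one, Matrix.mul_assoc U, Matrix.diagonal_mul_diagonal]
          simp only [pow_succ]

theorem norm_pow_le_trace {A : Matrix κ κ ℝ} (hA : A.IsSymm) (k : ℕ) (hk : 1 ≤ k) :
    ‖A‖ ^ (2 * k) ≤ (A ^ (2 * k)).trace := by
  obtain ⟨U, a, h1, h2, h, hn⟩ := exists_orthogonal_diagonalization hA
  rw [diagonalization_pow h1 h2 h, Matrix.trace_mul_cycle, h1, Matrix.one_mul,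
    Matrix.trace_diagonal, hn]
  have h0 : 0 ≤ ∑ x, a x ^ (2 * k) :=
    Finset.sum_nonneg fun x _ => by rw [pow_mul]; positivity
  rcases isEmpty_or_nonempty κ with he | he
  · have : ‖a‖ = 0 := by
      rw [norm_eq_zero]; exact Subsingleton.elim _ _
    rw [this, zero_pow (by omega)]; exact h0
  · obtain ⟨x, hx⟩ := Finite.exists_max (fun x => ‖a x‖)
    have : ‖a‖ ≤ ‖a x‖ := (pi_norm_le_iff_of_nonneg (norm_nonneg _)).2 hx
    calc ‖a‖ ^ (2 * k) ≤ ‖a x‖ ^ (2 * k) := by gcongr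
      _ = a x ^ (2 * k) := by
        rw [Real.norm_eq_abs, pow_mul, sq_abs, ← pow_mul]
      _ ≤ _ := Finset.single_le_sum (f := fun x => a x ^ (2 * k))
          (fun x _ => by rw [pow_mul]; positivity) (Finset.mem_univ x)

theorem abs_dotProduct_mulVec_le (A : Matrix κ κ ℝ) (f : κ → ℝ) :
    |f ⬝ᵥ A *ᵥ f| ≤ ‖A‖ * (f ⬝ᵥ f) := by
  have h1 := Matrix.l2_opNorm_mulVec A (WithLp.toLp 2 f)
  have h2 := abs_real_inner_le_norm (WithLp.toLp 2 (A *ᵥ f)) (WithLp.toLp 2 f)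
  have h3 : inner ℝ (WithLp.toLp 2 (A *ᵥ f)) (WithLp.toLp 2 f) = f ⬝ᵥ A *ᵥ f := by
    simp [PiLp.inner_apply, dotProduct]
  have h4 : ‖WithLp.toLp 2 f‖ * ‖WithLp.toLp 2 f‖ = f ⬝ᵥ f := by
    rw [← sq, EuclideanSpace.norm_sq_eq]
    simp [dotProduct, sq]
  rw [h3] at h2
  rw [← h4, ← mul_assoc]
  exact h2.trans (mul_le_mul_of_nonneg_right h1 (norm_nonneg _))

theorem pow_mul_pow_add_le (a b : ℝ) {i j r : ℕ} (h : i + j = 2 * r) :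
    a ^ i * b ^ j + a ^ j * b ^ i ≤ a ^ (2 * r) + b ^ (2 * r) := by
  have e : ∀ x : ℝ, x ^ (2 * r) = |x| ^ i * |x| ^ j := fun x => by
    rw [← pow_add, h, pow_mul, pow_mul, sq_abs]
  have h1 : a ^ i * b ^ j ≤ |a| ^ i * |b| ^ j := by
    rw [← abs_pow, ← abs_pow, ← abs_mul]; exact le_abs_self _
  have h2 : a ^ j * b ^ i ≤ |a| ^ j * |b| ^ i := by
    rw [← abs_pow, ← abs_pow, ← abs_mul]; exact le_abs_self _
  rw [e a, e b]
  have h3 : 0 ≤ (|a| ^ i - |b| ^ i) * (|a| ^ j - |b| ^ j) := by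
    rcases le_total |a| |b| with hab | hab
    · exact mul_nonneg_of_nonpos_of_nonpos
        (sub_nonpos.2 (pow_le_pow_left₀ (abs_nonneg _) hab _))
        (sub_nonpos.2 (pow_le_pow_left₀ (abs_nonneg _) hab _))
    · exact mul_nonneg
        (sub_nonneg.2 (pow_le_pow_left₀ (abs_nonneg _) hab _))
        (sub_nonneg.2 (pow_le_pow_left₀ (abs_nonneg _) hab _))
  nlinarith

theorem trace_diagonal_mul_mul (a b : κ → ℝ) (M : Matrix κ κ ℝ) :
    (diagonal a * M * diagonal b * Mᵀ).trace = ∑ x, ∑ y, a x * b y * M x y ^ 2 := by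
  simp only [Matrix.trace, Matrix.diag_apply]
  refine Finset.sum_congr rfl fun x _ => ?_
  rw [Matrix.mul_apply]
  refine Finset.sum_congr rfl fun y _ => ?_
  rw [Matrix.mul_diagonal, Matrix.diagonal_mul, Matrix.transpose_apply]
  ring

theorem trace_mul_pow_mul_pow_le {H W Y : Matrix κ κ ℝ} (hH : H.IsSymm) (hW : W.IsSymm)
    (hY : Y.IsSymm) {i j r : ℕ} (h : i + j = 2 * r) :
    (H * W ^ i * H * Y ^ j).trace + (H * W ^ j * H * Y ^ i).trace ≤
      (H * H * W ^ (2 * r)).trace + (H * H * Y ^ (2 * r)).trace := by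
  obtain ⟨U, a, u1, u2, hU, -⟩ := exists_orthogonal_diagonalization hW
  obtain ⟨V, b, v1, v2, hV, -⟩ := exists_orthogonal_diagonalization hY
  have key : ∀ s t : ℕ, (H * W ^ s * H * Y ^ t).trace =
      ∑ x, ∑ y, a x ^ s * b y ^ t * (Uᵀ * H * V) x y ^ 2 := by
    intro s t
    rw [← trace_diagonal_mul_mul, diagonalization_pow u1 u2 hU, diagonalization_pow v1 v2 hV]
    have : (Uᵀ * H * V)ᵀ = Vᵀ * H * U := by
      simp only [Matrix.transpose_mul, Matrix.transpose_transpose, hH.eq, Matrix.mul_assoc]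
    rw [this]
    have : H * (U * diagonal (fun x => a x ^ s) * Uᵀ) * H * (V * diagonal (fun x => b x ^ t) * Vᵀ)
      = (H * U) *
        (diagonal (fun x => a x ^ s) * (Uᵀ * H * V) * diagonal (fun x => b x ^ t) * Vᵀ) := by
      simp only [Matrix.mul_assoc]
    rw [this, Matrix.trace_mul_comm]
    simp only [Matrix.mul_assoc]
  have k1 : (H * H * W ^ (2 * r)).trace = (H * W ^ (2 * r) * H * Y ^ 0).trace := by
    rw [pow_zero, Matrix.mul_one, Matrix.mul_assoc, Matrix.trace_mul_comm]
  have k2 : (H * H * Y ^ (2 * r)).trace = (H * W ^ 0 * H * Y ^ (2 * r)).trace := by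
    rw [pow_zero, Matrix.mul_one]
  rw [k1, k2, key, key, key, key, ← Finset.sum_add_distrib, ← Finset.sum_add_distrib]
  refine Finset.sum_le_sum fun x _ => ?_
  rw [← Finset.sum_add_distrib, ← Finset.sum_add_distrib]
  refine Finset.sum_le_sum fun y _ => ?_
  have := mul_le_mul_of_nonneg_right (pow_mul_pow_add_le (a x) (b y) h)
    (sq_nonneg ((Uᵀ * H * V) x y))
  simp only [pow_zero]
  linarith

theorem pow_sub_pow_eq_sum {R : Type} [Ring R] (W Y : R) (m : ℕ) :
    W ^ (m + 1) - Y ^ (m + 1) =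
      ∑ j ∈ Finset.range (m + 1), W ^ j * (W - Y) * Y ^ (m - j) := by
  induction m with
  | zero => simp
  | succ m ih =>
    rw [Finset.sum_range_succ]
    have : ∀ j ∈ Finset.range (m + 1), W ^ j * (W - Y) * Y ^ (m + 1 - j) =
        W ^ j * (W - Y) * Y ^ (m - j) * Y := by
      intro j hj
      have : m + 1 - j = (m - j) + 1 := by
        have := Finset.mem_range.1 hj; omega
      rw [this, pow_succ]; simp only [mul_assoc]
    rw [Finset.sum_congr rfl this, ← Finset.sum_mul, ← ih]
    rw [Nat.sub_self, pow_zero, mul_one, pow_succ W (m + 1), pow_succ Y (m + 1)]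
    noncomm_ring

/-- The real sign attached to a Boolean. -/
def boolSign (b : Bool) : ℝ := if b then 1 else -1

theorem boolSign_mul_self (b : Bool) : boolSign b * boolSign b = 1 := by
  cases b <;> simp [boolSign]

theorem boolSign_not (b : Bool) : boolSign (!b) = -boolSign b := by
  cases b <;> simp [boolSign]

variable {ι : Type} [Fintype ι] [DecidableEq ι]

/-- Flipping one coordinate of a Boolean vector. -/
def flipAt (i : ι) : Equiv.Perm (ι → Bool) :=
  Function.Involutive.toPerm (fun ε => Function.update ε i (!ε i)) (by
    intro ε
    simp)

theorem flipAt_apply (i : ι) (ε : ι → Bool) : flipAt i ε = Function.update ε i (!ε i) := rfl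

/-- The matrix Rademacher sum with signs `ε`. -/
def rademacherSum (B : ι → Matrix κ κ ℝ) (ε : ι → Bool) : Matrix κ κ ℝ :=
  ∑ i, boolSign (ε i) • B i

theorem rademacherSum_isSymm {B : ι → Matrix κ κ ℝ} (hB : ∀ i, (B i).IsSymm) (ε : ι → Bool) :
    (rademacherSum B ε).IsSymm := by
  unfold rademacherSum Matrix.IsSymm
  rw [Matrix.transpose_sum]
  exact Finset.sum_congr rfl fun i _ => by rw [Matrix.transpose_smul, (hB i).eq]

theorem rademacherSum_sub_flipAt (B : ι → Matrix κ κ ℝ) (ε : ι → Bool) (i : ι) :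
    rademacherSum B ε - rademacherSum B (flipAt i ε) = (2 * boolSign (ε i)) • B i := by
  unfold rademacherSum
  rw [← Finset.sum_sub_distrib, Finset.sum_eq_single i]
  · rw [flipAt_apply, Function.update_self, boolSign_not, ← sub_smul]
    congr 1; ring
  · intro j _ hj
    rw [flipAt_apply, Function.update_of_ne hj, sub_self]
  · simp

theorem sum_trace_rademacherSum_coord_le {B : ι → Matrix κ κ ℝ} (hB : ∀ i, (B i).IsSymm)
    (k : ℕ) (i : ι) :
    ∑ ε, boolSign (ε i) * (B i * rademacherSum B ε ^ (2 * k + 1)).trace ≤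
      (2 * k + 1) * ∑ ε, (B i * B i * rademacherSum B ε ^ (2 * k)).trace := by
  set X := rademacherSum B with hX
  have hXs : ∀ ε, (X ε).IsSymm := rademacherSum_isSymm hB
  have hflip : ∑ ε, boolSign (ε i) * (B i * X ε ^ (2 * k + 1)).trace =
      ∑ ε, -(boolSign (ε i) * (B i * X (flipAt i ε) ^ (2 * k + 1)).trace) := by
    rw [← Equiv.sum_comp (flipAt i)]
    refine Finset.sum_congr rfl fun ε _ => ?_
    rw [flipAt_apply, Function.update_self, boolSign_not, neg_mul]
  have hsq : ∑ ε, (B i * B i * X (flipAt i ε) ^ (2 * k)).trace =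
      ∑ ε, (B i * B i * X ε ^ (2 * k)).trace :=
    Equiv.sum_comp (flipAt i) (fun ε => (B i * B i * X ε ^ (2 * k)).trace)
  have hone : ∀ ε, boolSign (ε i) * (B i * X ε ^ (2 * k + 1)).trace +
      -(boolSign (ε i) * (B i * X (flipAt i ε) ^ (2 * k + 1)).trace) =
      2 * ∑ j ∈ Finset.range (2 * k + 1),
        (B i * X ε ^ j * B i * X (flipAt i ε) ^ (2 * k - j)).trace := by
    intro ε
    rw [← sub_eq_add_neg, ← mul_sub, ← Matrix.trace_sub, ← Matrix.mul_sub, pow_sub_pow_eq_sum,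
      Matrix.mul_sum, Matrix.trace_sum, Finset.mul_sum, Finset.mul_sum]
    refine Finset.sum_congr rfl fun j _ => ?_
    rw [hX, rademacherSum_sub_flipAt]
    simp only [Matrix.mul_smul, Matrix.smul_mul, Matrix.trace_smul, smul_eq_mul, Matrix.mul_assoc]
    have := boolSign_mul_self (ε i)
    linear_combination (2 * (B i * (rademacherSum B ε ^ j *
      (B i * rademacherSum B (flipAt i ε) ^ (2 * k - j)))).trace) * this
  have hbd : ∀ ε, 2 * ∑ j ∈ Finset.range (2 * k + 1),
        (B i * X ε ^ j * B i * X (flipAt i ε) ^ (2 * k - j)).trace ≤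
      (2 * k + 1) * ((B i * B i * X ε ^ (2 * k)).trace +
        (B i * B i * X (flipAt i ε) ^ (2 * k)).trace) := by
    intro ε
    have hr := Finset.sum_range_reflect
      (fun j => (B i * X ε ^ j * B i * X (flipAt i ε) ^ (2 * k - j)).trace) (2 * k + 1)
    rw [two_mul]
    conv_lhs => rw [← hr]
    conv_lhs => arg 2; rw [hr]
    rw [← Finset.sum_add_distrib]
    calc _ ≤ ∑ j ∈ Finset.range (2 * k + 1), ((B i * B i * X ε ^ (2 * k)).trace +
        (B i * B i * X (flipAt i ε) ^ (2 * k)).trace) := by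
          refine Finset.sum_le_sum fun j hj => ?_
          have hj' := Finset.mem_range.1 hj
          have e1 : 2 * k + 1 - 1 - j = 2 * k - j := by omega
          have e2 : 2 * k - (2 * k - j) = j := by omega
          rw [e1, e2]
          exact trace_mul_pow_mul_pow_le (hB i) (hXs _) (hXs _) (by omega)
      _ = _ := by
          rw [Finset.sum_const, Finset.card_range, nsmul_eq_mul]; push_cast; ring
  have : 2 * ∑ ε, boolSign (ε i) * (B i * X ε ^ (2 * k + 1)).trace ≤
      (2 * k + 1) * (2 * ∑ ε, (B i * B i * X ε ^ (2 * k)).trace) := by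
    calc _ = ∑ ε, (boolSign (ε i) * (B i * X ε ^ (2 * k + 1)).trace +
      -(boolSign (ε i) * (B i * X (flipAt i ε) ^ (2 * k + 1)).trace)) := by
          rw [Finset.sum_add_distrib, ← hflip]; ring
      _ ≤ ∑ ε, (2 * k + 1) * ((B i * B i * X ε ^ (2 * k)).trace +
        (B i * B i * X (flipAt i ε) ^ (2 * k)).trace) :=
          Finset.sum_le_sum fun ε _ => (hone ε).trans_le (hbd ε)
      _ = _ := by
          rw [← Finset.mul_sum, Finset.sum_add_distrib, hsq]; ring
  linarith

theorem trace_mul_pow_le_of_quadratic_form_le {V X : Matrix κ κ ℝ} (hV : V.IsSymm) (hX : X.IsSymm)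
    {c : ℝ} (h : ∀ f : κ → ℝ, f ⬝ᵥ V *ᵥ f ≤ c * (f ⬝ᵥ f)) (k : ℕ) :
    (V * X ^ (2 * k)).trace ≤ c * (X ^ (2 * k)).trace := by
  have hp : (c • (1 : Matrix κ κ ℝ) - V).PosSemidef := by
    refine Matrix.PosSemidef.of_dotProduct_mulVec_nonneg ?_ ?_
    · rw [Matrix.IsHermitian, Matrix.conjTranspose_eq_transpose_of_trivial]
      simp [Matrix.transpose_sub, hV.eq]
    · intro f
      rw [star_trivial, Matrix.sub_mulVec, dotProduct_sub, Matrix.smul_mulVec, Matrix.one_mulVec,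
        dotProduct_smul, smul_eq_mul]
      linarith [h f]
  have h2 := (hp.mul_mul_conjTranspose_same (X ^ k)).trace_nonneg
  rw [Matrix.conjTranspose_eq_transpose_of_trivial, Matrix.transpose_pow, hX.eq,
    Matrix.mul_assoc, Matrix.trace_mul_comm, Matrix.mul_assoc, ← pow_add, Matrix.sub_mul,
    Matrix.smul_mul, Matrix.one_mul, Matrix.trace_sub, Matrix.trace_smul, smul_eq_mul] at h2
  rw [two_mul]
  linarith

theorem sum_trace_rademacherSum_pow_succ_le {B : ι → Matrix κ κ ℝ} (hB : ∀ i, (B i).IsSymm)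
    {c : ℝ} (h : ∀ f : κ → ℝ, f ⬝ᵥ (∑ i, B i * B i) *ᵥ f ≤ c * (f ⬝ᵥ f)) (k : ℕ) :
    ∑ ε, (rademacherSum B ε ^ (2 * (k + 1))).trace ≤
      (2 * k + 1) * c * ∑ ε, (rademacherSum B ε ^ (2 * k)).trace := by
  have hVs : (∑ i, B i * B i).IsSymm := by
    unfold Matrix.IsSymm
    rw [Matrix.transpose_sum]
    exact Finset.sum_congr rfl fun i _ => by rw [Matrix.transpose_mul, (hB i).eq]
  calc ∑ ε, (rademacherSum B ε ^ (2 * (k + 1))).trace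
      = ∑ ε, ∑ i, boolSign (ε i) * (B i * rademacherSum B ε ^ (2 * k + 1)).trace := by
        refine Finset.sum_congr rfl fun ε _ => ?_
        have : 2 * (k + 1) = (2 * k + 1) + 1 := by ring
        rw [this, pow_succ']
        conv_lhs => arg 1; arg 1; unfold rademacherSum
        rw [Matrix.sum_mul, Matrix.trace_sum]
        exact Finset.sum_congr rfl fun i _ => by
          rw [Matrix.smul_mul, Matrix.trace_smul, smul_eq_mul]
    _ = ∑ i, ∑ ε, boolSign (ε i) * (B i * rademacherSum B ε ^ (2 * k + 1)).trace :=
        Finset.sum_comm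
    _ ≤ ∑ i, (2 * k + 1) * ∑ ε, (B i * B i * rademacherSum B ε ^ (2 * k)).trace :=
        Finset.sum_le_sum fun i _ => sum_trace_rademacherSum_coord_le hB k i
    _ = (2 * k + 1) * ∑ ε, ((∑ i, B i * B i) * rademacherSum B ε ^ (2 * k)).trace := by
        rw [← Finset.mul_sum, Finset.sum_comm]
        congr 1
        exact Finset.sum_congr rfl fun ε _ => by rw [Matrix.sum_mul, Matrix.trace_sum]
    _ ≤ (2 * k + 1) * ∑ ε, c * (rademacherSum B ε ^ (2 * k)).trace := by
        gcongr with ε _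
        exact trace_mul_pow_le_of_quadratic_form_le hVs (rademacherSum_isSymm hB ε) h k
    _ = _ := by rw [← Finset.mul_sum, mul_assoc]

/-- The noncommutative Khintchine inequality for even moments. -/
theorem sum_norm_rademacherSum_pow_le {B : ι → Matrix κ κ ℝ} (hB : ∀ i, (B i).IsSymm)
    {c : ℝ} (hc : 0 ≤ c) (h : ∀ f : κ → ℝ, f ⬝ᵥ (∑ i, B i * B i) *ᵥ f ≤ c * (f ⬝ᵥ f))
    (k : ℕ) (hk : 1 ≤ k) :
    ∑ ε, ‖rademacherSum B ε‖ ^ (2 * k) ≤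
      Fintype.card (ι → Bool) * (Fintype.card κ * (2 * k * c) ^ k) := by
  have main : ∀ m ≤ k, ∑ ε, (rademacherSum B ε ^ (2 * m)).trace ≤
      Fintype.card (ι → Bool) * (Fintype.card κ * (2 * k * c) ^ m) := by
    intro m
    induction m with
    | zero => intro _; simp
    | succ m ih =>
      intro hm
      refine (sum_trace_rademacherSum_pow_succ_le hB h m).trans ?_
      have hmk : (2 * m + 1 : ℝ) * c ≤ 2 * k * c := by
        have : (m : ℝ) + 1 ≤ k := by exact_mod_cast hm
        gcongr; linarith
      calc _ ≤ (2 * m + 1) * c *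
            (Fintype.card (ι → Bool) * (Fintype.card κ * (2 * k * c) ^ m)) := by
            gcongr; exact ih (by omega)
        _ ≤ (2 * k * c) * (Fintype.card (ι → Bool) * (Fintype.card κ * (2 * k * c) ^ m)) := by
            gcongr
        _ = _ := by ring
  exact (Finset.sum_le_sum fun ε _ =>
    norm_pow_le_trace (rademacherSum_isSymm hB ε) k hk).trans (main k le_rfl)

end MatrixMoments

section BernoulliExpectation

variable {T : Type} [Fintype T] [DecidableEq T]

/-- The weight of a configuration under the product Bernoulli measure. -/
def bernWeight (p : ℝ) (z : T → Bool) : ℝ := ∏ τ, if z τ then p else 1 - p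

/-- Expectation under the product Bernoulli measure on `T → Bool`. -/
def bernE (p : ℝ) (F : (T → Bool) → ℝ) : ℝ := ∑ z, bernWeight p z * F z

/-- Probability under the product Bernoulli measure on `T → Bool`. -/
def bernP (p : ℝ) (A : Set (T → Bool)) : ℝ := bernE p (A.indicator fun _ => 1)

/-- The centred Bernoulli variable. -/
def bernCentered (p : ℝ) (b : Bool) : ℝ := (if b then 1 else 0) - p

variable {p : ℝ}

theorem bernWeight_nonneg (h0 : 0 ≤ p) (h1 : p ≤ 1) (z : T → Bool) : 0 ≤ bernWeight p z :=
  Finset.prod_nonneg fun τ _ => by split_ifs <;> linarith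

theorem bernE_prod (p : ℝ) (f : T → Bool → ℝ) :
    bernE p (fun z => ∏ τ, f τ (z τ)) = ∏ τ, (p * f τ true + (1 - p) * f τ false) := by
  have h := Finset.prod_univ_sum (fun _ : T => (Finset.univ : Finset Bool))
    (fun τ b => (if b then p else 1 - p) * f τ b)
  rw [Fintype.piFinset_univ] at h
  unfold bernE bernWeight
  simp only [Fintype.sum_bool, if_true, Bool.false_eq_true, if_false] at h
  rw [h]
  exact Finset.sum_congr rfl fun z _ => by rw [Finset.prod_mul_distrib]

theorem bernE_const (p c : ℝ) : bernE p (fun _ : T → Bool => c) = c := by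
  have h := bernE_prod p (fun (_ : T) _ => 1)
  unfold bernE at h ⊢
  rw [← Finset.sum_mul]
  simp only [Finset.prod_const_one, mul_one, add_sub_cancel] at h
  rw [h, one_mul]

theorem sum_bernWeight (p : ℝ) : ∑ z : T → Bool, bernWeight p z = 1 := by
  have := bernE_const (T := T) p 1
  simpa [bernE] using this

theorem bernE_add (F G : (T → Bool) → ℝ) :
    bernE p (fun z => F z + G z) = bernE p F + bernE p G := by
  simp [bernE, mul_add, Finset.sum_add_distrib]

theorem bernE_const_mul (c : ℝ) (F : (T → Bool) → ℝ) :
    bernE p (fun z => c * F z) = c * bernE p F := by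
  simp only [bernE, Finset.mul_sum]
  exact Finset.sum_congr rfl fun z _ => by ring

theorem bernE_sum {α : Type} (s : Finset α) (F : α → (T → Bool) → ℝ) :
    bernE p (fun z => ∑ a ∈ s, F a z) = ∑ a ∈ s, bernE p (F a) := by
  simp only [bernE, Finset.mul_sum]
  exact Finset.sum_comm

theorem bernE_mono (h0 : 0 ≤ p) (h1 : p ≤ 1) {F G : (T → Bool) → ℝ} (h : ∀ z, F z ≤ G z) :
    bernE p F ≤ bernE p G :=
  Finset.sum_le_sum fun z _ => mul_le_mul_of_nonneg_left (h z) (bernWeight_nonneg h0 h1 z)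

theorem bernE_pow_le (h0 : 0 ≤ p) (h1 : p ≤ 1) {F : (T → Bool) → ℝ} (h : ∀ z, 0 ≤ F z) (n : ℕ) :
    bernE p F ^ n ≤ bernE p (fun z => F z ^ n) :=
  Real.pow_arith_mean_le_arith_mean_pow _ _ _ (fun z _ => bernWeight_nonneg h0 h1 z)
    (sum_bernWeight p) (fun z _ => h z) n

theorem bernP_mono (h0 : 0 ≤ p) (h1 : p ≤ 1) {A B : Set (T → Bool)} (h : A ⊆ B) :
    bernP p A ≤ bernP p B :=
  bernE_mono h0 h1 fun z => Set.indicator_le_indicator_of_subset h (fun _ => zero_le_one) z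

theorem bernP_union_le (h0 : 0 ≤ p) (h1 : p ≤ 1) (A B : Set (T → Bool)) :
    bernP p (A ∪ B) ≤ bernP p A + bernP p B := by
  unfold bernP
  rw [← bernE_add]
  refine bernE_mono h0 h1 fun z => ?_
  by_cases ha : z ∈ A <;> by_cases hb : z ∈ B <;> simp [ha, hb]

theorem bernP_iUnion_le {α : Type} [Fintype α] (h0 : 0 ≤ p) (h1 : p ≤ 1)
    (A : α → Set (T → Bool)) : bernP p (⋃ a, A a) ≤ ∑ a, bernP p (A a) := by
  unfold bernP
  rw [← bernE_sum]
  refine bernE_mono h0 h1 fun z => ?_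
  by_cases h : z ∈ ⋃ a, A a
  · obtain ⟨a, ha⟩ := Set.mem_iUnion.1 h
    rw [Set.indicator_of_mem h]
    have := Finset.single_le_sum (f := fun a => (A a).indicator (fun _ => (1 : ℝ)) z)
      (fun a _ => Set.indicator_nonneg (fun _ _ => zero_le_one) z) (Finset.mem_univ a)
    simpa only [Set.indicator_of_mem ha] using this
  · rw [Set.indicator_of_notMem h]
    exact Finset.sum_nonneg fun a _ => Set.indicator_nonneg (fun _ _ => zero_le_one) z

theorem bernP_compl (p : ℝ) (A : Set (T → Bool)) : bernP p A = 1 - bernP p Aᶜ := by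
  have : bernP p A + bernP p Aᶜ = 1 := by
    unfold bernP
    rw [← bernE_add]
    refine Eq.trans (congrArg _ (funext fun z => ?_)) (bernE_const (T := T) p 1)
    by_cases h : z ∈ A <;> simp [h]
  linarith

theorem bernP_gt_le (h0 : 0 ≤ p) (h1 : p ≤ 1) {F : (T → Bool) → ℝ} (hF : ∀ z, 0 ≤ F z) {a M : ℝ}
    (ha : 0 < a) (h : bernE p F ≤ M * a) : bernP p {z | a < F z} ≤ M := by
  have : a * bernP p {z | a < F z} ≤ M * a := by
    refine le_trans ?_ h
    unfold bernP
    rw [← bernE_const_mul]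
    refine bernE_mono h0 h1 fun z => ?_
    by_cases hz : a < F z
    · simp [hz, hz.le]
    · simp [hz, hF z]
  nlinarith

theorem bernE_coord (p : ℝ) (τ : T) (f : Bool → ℝ) :
    bernE p (fun z => f (z τ)) = p * f true + (1 - p) * f false := by
  have h := bernE_prod p (fun τ' b => if τ' = τ then f b else 1)
  rw [Finset.prod_eq_single τ] at h
  · simp only [if_true] at h
    rw [← h]
    congr 1
    funext z
    rw [Finset.prod_eq_single τ] <;> simp +contextual
  · intro τ' _ h; simp [h]
  · simp

theorem bernE_coord_mul (p : ℝ) {τ σ : T} (hne : τ ≠ σ) (f g : Bool → ℝ) :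
    bernE p (fun z => f (z τ) * g (z σ)) =
      (p * f true + (1 - p) * f false) * (p * g true + (1 - p) * g false) := by
  have h := bernE_prod p (fun τ' b => (if τ' = τ then f b else 1) * (if τ' = σ then g b else 1))
  have e : ∀ z : T → Bool, ∏ τ', ((if τ' = τ then f (z τ') else 1) *
      (if τ' = σ then g (z τ') else 1)) = f (z τ) * g (z σ) := by
    intro z
    rw [Finset.prod_mul_distrib, Fintype.prod_ite_eq', Fintype.prod_ite_eq']
  simp only [e] at h
  rw [h]
  have e2 : ∀ τ', p * ((if τ' = τ then f true else 1) * (if τ' = σ then g true else 1)) +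
      (1 - p) * ((if τ' = τ then f false else 1) * (if τ' = σ then g false else 1)) =
      (if τ' = τ then p * f true + (1 - p) * f false else 1) *
      (if τ' = σ then p * g true + (1 - p) * g false else 1) := by
    intro τ'
    by_cases h1 : τ' = τ
    · have : ¬ τ' = σ := fun h2 => hne (h1.symm.trans h2)
      simp [h1, hne]
    · by_cases h2 : τ' = σ <;> simp [h1, h2, Ne.symm hne]
  simp only [e2]
  rw [Finset.prod_mul_distrib, Fintype.prod_ite_eq', Fintype.prod_ite_eq']

theorem bernE_sum_centered_sq (p : ℝ) (s : Finset T) :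
    bernE p (fun z => (∑ τ ∈ s, bernCentered p (z τ)) ^ 2) = p * (1 - p) * s.card := by
  have e : ∀ z : T → Bool, (∑ τ ∈ s, bernCentered p (z τ)) ^ 2 =
      ∑ τ ∈ s, ∑ σ ∈ s, bernCentered p (z τ) * bernCentered p (z σ) := by
    intro z; rw [sq, Finset.sum_mul_sum]
  simp only [e, bernE_sum]
  have e2 : ∀ τ ∈ s, ∑ σ ∈ s, bernE p (fun z => bernCentered p (z τ) * bernCentered p (z σ)) =
      p * (1 - p) := by
    intro τ hτ
    rw [Finset.sum_eq_single τ]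
    · rw [bernE_coord p τ (fun b => bernCentered p b * bernCentered p b)]
      simp [bernCentered]; ring
    · intro σ _ h
      rw [bernE_coord_mul p (Ne.symm h)]
      simp [bernCentered]; ring
    · intro h; exact absurd hτ h
  rw [Finset.sum_congr rfl e2]
  simp [mul_comm]

variable {ι : Type}

/-- The configuration equal to `z` on the blocks selected by `ε` and to `z'` elsewhere. -/
def blockMix (b : T → ι) (ε : ι → Bool) (z z' : T → Bool) : T → Bool :=
  fun τ => if ε (b τ) then z τ else z' τ

theorem bernE_bernE_blockMix (p : ℝ) (b : T → ι) (ε : ι → Bool)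
    (F : (T → Bool) → (T → Bool) → ℝ) :
    bernE p (fun z => bernE p (fun z' => F (blockMix b ε z z') (blockMix b ε z' z))) =
      bernE p (fun z => bernE p (fun z' => F z z')) := by
  have inv : Function.Involutive (fun w : (T → Bool) × (T → Bool) =>
      (blockMix b ε w.1 w.2, blockMix b ε w.2 w.1)) := by
    rintro ⟨z, z'⟩
    ext τ <;> simp only [blockMix] <;> split_ifs <;> rfl
  have hw : ∀ z z' : T → Bool, bernWeight p (blockMix b ε z z') * bernWeight p (blockMix b ε z' z) =
      bernWeight p z * bernWeight p z' := by
    intro z z'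
    unfold bernWeight
    rw [← Finset.prod_mul_distrib, ← Finset.prod_mul_distrib]
    refine Finset.prod_congr rfl fun τ _ => ?_
    simp only [blockMix]
    by_cases h : ε (b τ)
    · simp only [h, if_true]
    · simp only [h, Bool.false_eq_true, if_false]; rw [mul_comm]
  simp only [bernE, Finset.mul_sum, ← Fintype.sum_prod_type', ← mul_assoc]
  rw [← Equiv.sum_comp inv.toPerm]
  refine Finset.sum_congr rfl fun w _ => ?_
  have h2 := inv w
  simp only [Prod.ext_iff] at h2
  simp only [Function.Involutive.coe_toPerm, hw, h2.1, h2.2]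

end BernoulliExpectation

section MatrixConcentration

open Matrix
open scoped Matrix.Norms.L2Operator

variable {T ι κ : Type} [Fintype T] [DecidableEq T] [Fintype ι] [DecidableEq ι] [Fintype κ]
  [DecidableEq κ]

theorem dotProduct_self_nonneg_real (f : κ → ℝ) : 0 ≤ f ⬝ᵥ f :=
  Finset.sum_nonneg fun i _ => mul_self_nonneg (f i)

theorem dotProduct_vecMulVec_sum_mulVec (c : ι → ℝ) (u : ι → κ → ℝ) (f : κ → ℝ) :
    f ⬝ᵥ (∑ i, c i • vecMulVec (u i) (u i)) *ᵥ f = ∑ i, c i * (u i ⬝ᵥ f) ^ 2 := by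
  rw [Matrix.sum_mulVec, dotProduct_sum]
  refine Finset.sum_congr rfl fun i _ => ?_
  rw [Matrix.smul_mulVec, dotProduct_smul, smul_eq_mul, Matrix.vecMulVec_mulVec]
  simp only [op_smul_eq_smul, dotProduct_smul, smul_eq_mul]
  rw [dotProduct_comm f]; ring

theorem add_add_pow_le {a b c : ℝ} (ha : 0 ≤ a) (hb : 0 ≤ b) (hc : 0 ≤ c) (k : ℕ) :
    (a + b + c) ^ k ≤ 3 ^ k * (a ^ k + b ^ k + c ^ k) := by
  set M := max a (max b c)
  have hM : 0 ≤ M := ha.trans (le_max_left _ _)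
  have h1 : a + b + c ≤ 3 * M := by
    have h1 : a ≤ M := le_max_left _ _
    have h2 : b ≤ M := (le_max_left b c).trans (le_max_right _ _)
    have h3 : c ≤ M := (le_max_right b c).trans (le_max_right _ _)
    linarith
  calc (a + b + c) ^ k ≤ (3 * M) ^ k := by gcongr
    _ = 3 ^ k * M ^ k := mul_pow _ _ _
    _ ≤ _ := by
      have h1 : 0 ≤ a ^ k := by positivity
      have h2 : 0 ≤ b ^ k := by positivity
      have h3 : 0 ≤ c ^ k := by positivity
      gcongr
      rcases max_choice a (max b c) with h | h
      · simp only [M, h]; linarith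
      · rcases max_choice b c with h' | h' <;> simp only [M, h, h'] <;> linarith

theorem le_of_self_bounding {φ G B s : ℝ} (hsφ : s ^ 2 ≤ φ)
    (h : φ ≤ G * (B + 2 * s)) : φ ≤ 8 * G ^ 2 + 2 * (G * B) := by
  nlinarith [sq_nonneg (s - 2 * G)]

/-- Even moment bound for the centred sum of independent (block-wise measurable), nonnegative,
bounded multiples of rank-one matrices. -/
theorem bernE_norm_centered_sum_pow_le {p : ℝ} (h0 : 0 ≤ p) (h1 : p ≤ 1) (b : T → ι)
    (Y : ι → (T → Bool) → ℝ)
    (hb : ∀ i z z', (∀ τ, b τ = i → z τ = z' τ) → Y i z = Y i z')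
    {t ρ m : ℝ} (hY0 : ∀ i z, 0 ≤ Y i z) (hYt : ∀ i z, Y i z ≤ t) (ht : 0 ≤ t) (u : ι → κ → ℝ)
    (hρ : ∀ i, u i ⬝ᵥ u i ≤ ρ) (hρ0 : 0 ≤ ρ) (hm0 : 0 ≤ m)
    (hm : ∀ f, ∑ i, bernE p (Y i) * (u i ⬝ᵥ f) ^ 2 ≤ m * (f ⬝ᵥ f)) (k : ℕ) (hk : 1 ≤ k) :
    bernE p (fun z => ‖∑ i, (Y i z - bernE p (Y i)) • vecMulVec (u i) (u i)‖ ^ (2 * k)) ≤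
      8 * (Fintype.card κ * (6 * k * (t * ρ)) ^ k) ^ 2 +
        2 * (Fintype.card κ * (6 * k * (t * ρ)) ^ k * (2 * m) ^ k) := by
  set C : (T → Bool) → Matrix κ κ ℝ :=
    fun z => ∑ i, (Y i z - bernE p (Y i)) • vecMulVec (u i) (u i) with hC
  set D : (T → Bool) → (T → Bool) → Matrix κ κ ℝ :=
    fun z z' => ∑ i, (Y i z - Y i z') • vecMulVec (u i) (u i) with hD
  have hCD : ∀ z, C z = ∑ z', bernWeight p z' • D z z' := by
    intro z
    simp only [hC, hD, Finset.smul_sum, smul_smul]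
    rw [Finset.sum_comm]
    refine Finset.sum_congr rfl fun i _ => ?_
    rw [← Finset.sum_smul]
    congr 1
    simp only [mul_sub, Finset.sum_sub_distrib, ← Finset.sum_mul, sum_bernWeight, one_mul, bernE]
  have step1 : ∀ z, ‖C z‖ ^ (2 * k) ≤ bernE p (fun z' => ‖D z z'‖ ^ (2 * k)) := by
    intro z
    refine le_trans ?_ (bernE_pow_le h0 h1 (fun z' => norm_nonneg (D z z')) (2 * k))
    refine pow_le_pow_left₀ (norm_nonneg _) ?_ _
    rw [hCD]
    refine (norm_sum_le _ _).trans (Finset.sum_le_sum fun z' _ => ?_)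
    rw [norm_smul, Real.norm_of_nonneg (bernWeight_nonneg h0 h1 z')]
  have hswap : ∀ (ε : ι → Bool) z z', D (blockMix b ε z z') (blockMix b ε z' z) =
      rademacherSum (fun i => (Y i z - Y i z') • vecMulVec (u i) (u i)) ε := by
    intro ε z z'
    simp only [hD, rademacherSum, smul_smul]
    refine Finset.sum_congr rfl fun i _ => ?_
    congr 1
    cases hε : ε i
    · rw [hb i (blockMix b ε z z') z' (fun τ hτ => by simp [blockMix, hτ, hε]),
        hb i (blockMix b ε z' z) z (fun τ hτ => by simp [blockMix, hτ, hε])]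
      simp [boolSign]
    · rw [hb i (blockMix b ε z z') z (fun τ hτ => by simp [blockMix, hτ, hε]),
        hb i (blockMix b ε z' z) z' (fun τ hτ => by simp [blockMix, hτ, hε])]
      simp [boolSign]
  have hcond : ∀ z z', ∑ ε, ‖rademacherSum
        (fun i => (Y i z - Y i z') • vecMulVec (u i) (u i)) ε‖ ^ (2 * k) ≤
      Fintype.card (ι → Bool) *
        (Fintype.card κ * (2 * k * (t * ρ * (2 * m + ‖C z‖ + ‖C z'‖))) ^ k) := by
    intro z z'
    refine sum_norm_rademacherSum_pow_le ?_ (by positivity) ?_ k hk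
    · intro i
      ext x y
      simp [Matrix.vecMulVec_apply, mul_comm]
    · intro f
      have e1 : ∀ i, ((Y i z - Y i z') • vecMulVec (u i) (u i)) *
          ((Y i z - Y i z') • vecMulVec (u i) (u i)) =
          ((Y i z - Y i z') ^ 2 * (u i ⬝ᵥ u i)) • vecMulVec (u i) (u i) := by
        intro i
        rw [Matrix.smul_mul, Matrix.mul_smul, Matrix.vecMulVec_mul_vecMulVec, smul_smul]
        ext x y
        simp [Matrix.vecMulVec_apply]; ring
      rw [Finset.sum_congr rfl (fun i _ => e1 i), dotProduct_vecMulVec_sum_mulVec]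
      have e2 : ∀ w, ∑ i, Y i w * (u i ⬝ᵥ f) ^ 2 ≤ (m + ‖C w‖) * (f ⬝ᵥ f) := by
        intro w
        have h1 := (le_abs_self _).trans (abs_dotProduct_mulVec_le (C w) f)
        rw [hC, dotProduct_vecMulVec_sum_mulVec] at h1
        have h2 := hm f
        simp only [sub_mul, Finset.sum_sub_distrib] at h1
        rw [add_mul]
        linarith
      calc _ ≤ ∑ i, t * ρ * (Y i z * (u i ⬝ᵥ f) ^ 2 + Y i z' * (u i ⬝ᵥ f) ^ 2) := by
            refine Finset.sum_le_sum fun i _ => ?_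
            rw [← add_mul, ← mul_assoc]
            refine mul_le_mul_of_nonneg_right ?_ (sq_nonneg _)
            have a1 := hY0 i z
            have a2 := hY0 i z'
            have a3 := hYt i z
            have a4 := hYt i z'
            have a5 : (Y i z - Y i z') ^ 2 ≤ t * (Y i z + Y i z') := by nlinarith
            have a6 : 0 ≤ u i ⬝ᵥ u i := dotProduct_self_nonneg_real (u i)
            calc _ ≤ t * (Y i z + Y i z') * ρ :=
                  mul_le_mul a5 (hρ i) a6 (by positivity)
              _ = _ := by ring
        _ = t * ρ * (∑ i, Y i z * (u i ⬝ᵥ f) ^ 2 + ∑ i, Y i z' * (u i ⬝ᵥ f) ^ 2) := by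
            rw [← Finset.mul_sum, Finset.sum_add_distrib]
        _ ≤ t * ρ * ((m + ‖C z‖) * (f ⬝ᵥ f) + (m + ‖C z'‖) * (f ⬝ᵥ f)) := by
            gcongr
            · exact e2 z
            · exact e2 z'
        _ = _ := by ring
  set G : ℝ := Fintype.card κ * (6 * k * (t * ρ)) ^ k with hG
  have hG0 : 0 ≤ G := by positivity
  have hDD : bernE p (fun z => bernE p (fun z' => ‖D z z'‖ ^ (2 * k))) ≤
      bernE p (fun z => bernE p (fun z' => G * ((2 * m) ^ k + ‖C z‖ ^ k + ‖C z'‖ ^ k))) := by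
    have hcard : (0 : ℝ) < Fintype.card (ι → Bool) := by exact_mod_cast Fintype.card_pos
    refine le_of_mul_le_mul_left ?_ hcard
    calc (Fintype.card (ι → Bool) : ℝ) * bernE p (fun z => bernE p (fun z' => ‖D z z'‖ ^ (2 * k)))
        = ∑ ε : ι → Bool, bernE p (fun z => bernE p (fun z' => ‖D z z'‖ ^ (2 * k))) := by simp
      _ = ∑ ε : ι → Bool, bernE p (fun z => bernE p (fun z' => ‖rademacherSum
          (fun i => (Y i z - Y i z') • vecMulVec (u i) (u i)) ε‖ ^ (2 * k))) := by
          refine Finset.sum_congr rfl fun ε _ => ?_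
          rw [← bernE_bernE_blockMix p b ε]
          simp only [hswap]
      _ = bernE p (fun z => bernE p (fun z' => ∑ ε : ι → Bool, ‖rademacherSum
          (fun i => (Y i z - Y i z') • vecMulVec (u i) (u i)) ε‖ ^ (2 * k))) := by
          rw [← bernE_sum]
          congr 1; funext z
          rw [bernE_sum]
      _ ≤ bernE p (fun z => bernE p (fun z' => Fintype.card (ι → Bool) *
            (G * ((2 * m) ^ k + ‖C z‖ ^ k + ‖C z'‖ ^ k)))) := by
          refine bernE_mono h0 h1 fun z => bernE_mono h0 h1 fun z' => (hcond z z').trans ?_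
          refine mul_le_mul_of_nonneg_left ?_ hcard.le
          rw [hG, mul_assoc (Fintype.card κ : ℝ)]
          refine mul_le_mul_of_nonneg_left ?_ (Nat.cast_nonneg (Fintype.card κ))
          have h3 := add_add_pow_le (mul_nonneg zero_le_two hm0) (norm_nonneg (C z))
            (norm_nonneg (C z')) k
          calc (2 * (k : ℝ) * (t * ρ * (2 * m + ‖C z‖ + ‖C z'‖))) ^ k
              = (2 * k * (t * ρ)) ^ k * (2 * m + ‖C z‖ + ‖C z'‖) ^ k := by
                rw [← mul_pow]; ring
            _ ≤ (2 * k * (t * ρ)) ^ k * (3 ^ k * ((2 * m) ^ k + ‖C z‖ ^ k + ‖C z'‖ ^ k)) :=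
                mul_le_mul_of_nonneg_left h3 (by positivity)
            _ = (6 * k * (t * ρ)) ^ k * ((2 * m) ^ k + ‖C z‖ ^ k + ‖C z'‖ ^ k) := by
                rw [← mul_assoc, ← mul_pow]; congr 2; ring
      _ = _ := by simp only [bernE_const_mul]
  have hs : bernE p (fun z => bernE p (fun z' => G * ((2 * m) ^ k + ‖C z‖ ^ k + ‖C z'‖ ^ k))) =
      G * ((2 * m) ^ k + 2 * bernE p (fun z => ‖C z‖ ^ k)) := by
    simp only [bernE_const_mul, bernE_add, bernE_const]
    ring
  have hsq := bernE_pow_le h0 h1 (fun z => pow_nonneg (norm_nonneg (C z)) k) 2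
  simp only [← pow_mul, mul_comm k 2] at hsq
  exact le_of_self_bounding hsq (((bernE_mono h0 h1 step1).trans hDD).trans hs.le)

theorem bernP_quadratic_form_deviation_le {p : ℝ} (h0 : 0 ≤ p) (h1 : p ≤ 1) (b : T → ι)
    (Y : ι → (T → Bool) → ℝ)
    (hb : ∀ i z z', (∀ τ, b τ = i → z τ = z' τ) → Y i z = Y i z')
    {t ρ m a : ℝ} (hY0 : ∀ i z, 0 ≤ Y i z) (hYt : ∀ i z, Y i z ≤ t) (ht : 0 ≤ t) (u : ι → κ → ℝ)
    (hρ : ∀ i, u i ⬝ᵥ u i ≤ ρ) (hρ0 : 0 ≤ ρ) (hm0 : 0 ≤ m)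
    (hm : ∀ f, ∑ i, bernE p (Y i) * (u i ⬝ᵥ f) ^ 2 ≤ m * (f ⬝ᵥ f)) (k : ℕ) (hk : 1 ≤ k)
    (ha : 0 < a) (ha1 : 11 * k * (t * ρ) ≤ a) (ha2 : 36 * k * (t * ρ) * m ≤ a ^ 2) :
    bernP p {z | ∃ f, a * (f ⬝ᵥ f) < |∑ i, (Y i z - bernE p (Y i)) * (u i ⬝ᵥ f) ^ 2|} ≤
      10 * (Fintype.card κ : ℝ) ^ 2 * Real.exp (-k) := by
  have hmom := bernE_norm_centered_sum_pow_le h0 h1 b Y hb hY0 hYt ht u hρ hρ0 hm0 hm k hk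
  refine (bernP_mono h0 h1 (B := {z | a ^ (2 * k) <
    ‖∑ i, (Y i z - bernE p (Y i)) • vecMulVec (u i) (u i)‖ ^ (2 * k)}) ?_).trans ?_
  · rintro z ⟨f, hf⟩
    refine pow_lt_pow_left₀ ?_ ha.le (by omega)
    rw [← dotProduct_vecMulVec_sum_mulVec] at hf
    have h3 := hf.trans_le (abs_dotProduct_mulVec_le _ f)
    exact lt_of_mul_lt_mul_right h3 (dotProduct_self_nonneg_real f)
  · refine bernP_gt_le h0 h1 (fun z => by positivity) (by positivity) (hmom.trans ?_)
    have hexp : ∀ x : ℝ, 0 ≤ x → 3 * x ≤ a ^ 2 → x ^ k ≤ Real.exp (-k) * a ^ (2 * k) := by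
      intro x hx h
      have e : Real.exp (-(k : ℝ)) = (Real.exp (-1)) ^ k := by
        rw [← Real.exp_nat_mul]; congr 1; ring
      rw [e, pow_mul, ← mul_pow]
      refine pow_le_pow_left₀ hx ?_ k
      have h3 : (1 : ℝ) / 3 ≤ Real.exp (-1) := by
        rw [Real.exp_neg, one_div]
        exact inv_anti₀ (Real.exp_pos _) (Real.exp_one_lt_d9.le.trans (by norm_num))
      have : 1 / 3 * a ^ 2 ≤ Real.exp (-1) * a ^ 2 := by gcongr
      linarith
    have hR : 0 ≤ k * (t * ρ) := by positivity
    have b1 := hexp ((6 * k * (t * ρ)) ^ 2) (by positivity) (by nlinarith)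
    have b2 := hexp (6 * k * (t * ρ) * (2 * m)) (by positivity) (by linarith)
    rw [mul_pow, mul_assoc _ (_ ^ k) ((2 * m) ^ k), ← mul_pow _ (2 * m), ← pow_mul,
      mul_comm k 2, pow_mul]
    have hN : (Fintype.card κ : ℝ) ≤ (Fintype.card κ : ℝ) ^ 2 := by
      exact_mod_cast Nat.le_self_pow two_ne_zero _
    have hE : 0 ≤ Real.exp (-(k : ℝ)) * a ^ (2 * k) := by positivity
    calc _ ≤ 8 * ((Fintype.card κ : ℝ) ^ 2 * (Real.exp (-(k : ℝ)) * a ^ (2 * k))) +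
          2 * ((Fintype.card κ : ℝ) ^ 2 * (Real.exp (-(k : ℝ)) * a ^ (2 * k))) := by gcongr
      _ = _ := by ring

theorem bernP_bernoulli_quadratic_form_deviation_le {p : ℝ} (h0 : 0 ≤ p) (h1 : p ≤ 1)
    {ρ m a : ℝ} (u : T → κ → ℝ)
    (hρ : ∀ i, u i ⬝ᵥ u i ≤ ρ) (hρ0 : 0 ≤ ρ) (hm0 : 0 ≤ m)
    (hm : ∀ f, ∑ i, (u i ⬝ᵥ f) ^ 2 ≤ m * (f ⬝ᵥ f)) (k : ℕ) (hk : 1 ≤ k)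
    (ha : 0 < a) (ha1 : 11 * k * ρ ≤ a) (ha2 : 72 * k * ρ * (p * (1 - p) * m) ≤ a ^ 2) :
    bernP p {z | ∃ f, a * (f ⬝ᵥ f) < |∑ i, bernCentered p (z i) * (u i ⬝ᵥ f) ^ 2|} ≤
      10 * (Fintype.card κ : ℝ) ^ 2 * Real.exp (-k) := by
  set c : Bool := decide (p ≤ 1 / 2) with hc
  set Y : T → (T → Bool) → ℝ := fun i z => if z i = c then 1 else 0 with hY
  have hEY : ∀ i, bernE p (Y i) = if p ≤ 1 / 2 then p else 1 - p := by
    intro i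
    rw [hY, bernE_coord p i (fun b => if b = c then (1 : ℝ) else 0)]
    by_cases h : p ≤ 1 / 2
    · rw [if_pos h, hc, decide_eq_true h]; simp
    · rw [if_neg h, hc, decide_eq_false h]; simp
  have hEY' : ∀ i, bernE p (Y i) ≤ 2 * (p * (1 - p)) := by
    intro i; rw [hEY]; split_ifs <;> nlinarith
  have hE0 : ∀ i, 0 ≤ bernE p (Y i) := by
    intro i; rw [hEY]; split_ifs <;> linarith
  have hcen : ∀ i z, Y i z - bernE p (Y i) =
      (if p ≤ 1 / 2 then 1 else -1) * bernCentered p (z i) := by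
    intro i z
    rw [hEY, hY, hc, bernCentered]
    by_cases h : p ≤ 1 / 2
    · simp only [if_pos h, decide_eq_true h]; cases z i <;> simp
    · simp only [if_neg h, decide_eq_false h]; cases z i <;> simp
  have hq : 0 ≤ p * (1 - p) := mul_nonneg h0 (by linarith)
  have key := bernP_quadratic_form_deviation_le h0 h1 id Y
    (fun i z z' h => by simp only [hY, h i rfl]) (t := 1) (ρ := ρ) (m := 2 * (p * (1 - p)) * m)
    (a := a) (fun i z => by simp only [hY]; split_ifs <;> norm_num)
    (fun i z => by simp only [hY]; split_ifs <;> norm_num) zero_le_one u hρ hρ0 (by positivity)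
    (fun f => by
      rw [mul_assoc]
      refine le_trans ?_ (mul_le_mul_of_nonneg_left (hm f) (by positivity))
      rw [Finset.mul_sum]
      exact Finset.sum_le_sum fun i _ => mul_le_mul_of_nonneg_right (hEY' i) (sq_nonneg _))
    k hk ha (by rw [one_mul]; exact ha1) (by rw [one_mul]; linarith)
  refine le_trans (bernP_mono h0 h1 ?_) key
  rintro z ⟨f, hf⟩
  refine ⟨f, ?_⟩
  simp only [hcen, mul_assoc]
  rw [← Finset.mul_sum, abs_mul]
  have : |(if p ≤ 1 / 2 then (1 : ℝ) else -1)| = 1 := by split_ifs <;> simp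
  rw [this, one_mul]
  exact hf

end MatrixConcentration

section CellCombinatorics

/-- The incidence number between a cell `t` and its codimension-one face `s`, both increasingly
oriented. -/
def lmInc (s t : Finset ℕ) : ℝ := if s ⊆ t then (-1) ^ LMidx t (t \ s) else 0

theorem lmInc_of_not_subset {s t : Finset ℕ} (h : ¬ s ⊆ t) : lmInc s t = 0 := if_neg h

theorem lmInc_sq (s t : Finset ℕ) : lmInc s t ^ 2 = if s ⊆ t then 1 else 0 := by
  unfold lmInc
  split_ifs
  · rw [← pow_mul, mul_comm, pow_mul]; norm_num
  · norm_num

theorem lmInc_insert {s : Finset ℕ} {u : ℕ} (hu : u ∉ s) :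
    lmInc s (insert u s) = (-1) ^ (s.filter (· < u)).card := by
  unfold lmInc LMidx
  rw [if_pos (Finset.subset_insert _ _)]
  congr 2
  ext x
  have : insert u s \ s = {u} := by
    ext y; simp only [Finset.mem_sdiff, Finset.mem_insert, Finset.mem_singleton]
    constructor
    · rintro ⟨h | h, h'⟩
      · exact h
      · exact absurd h h'
    · rintro rfl; exact ⟨Or.inl rfl, hu⟩
  rw [this]
  simp only [Finset.mem_filter, Finset.mem_insert, Finset.mem_singleton, exists_eq_left]
  constructor
  · rintro ⟨h | h, h'⟩
    · omega
    · exact ⟨h, h'⟩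
  · rintro ⟨h, h'⟩; exact ⟨Or.inr h, h'⟩

theorem lmInc_insert_insert {s : Finset ℕ} {x y : ℕ} (hx : x ∉ s) (hy : y ∉ s) (hxy : x ≠ y) :
    lmInc (insert x s) (insert y (insert x s)) =
      lmInc s (insert y s) * (if x < y then -1 else 1) := by
  have hy' : y ∉ insert x s := by simp [hy, Ne.symm hxy]
  rw [lmInc_insert hy', lmInc_insert hy, Finset.filter_insert]
  split_ifs with h
  · rw [Finset.card_insert_of_notMem (by simp [hx]), pow_succ]
  · rw [mul_one]

theorem lmInc_diamond {s : Finset ℕ} {x y : ℕ} (hx : x ∉ s) (hy : y ∉ s) (hxy : x ≠ y) :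
    lmInc (insert x s) (insert y (insert x s)) * lmInc s (insert x s) +
      lmInc (insert y s) (insert y (insert x s)) * lmInc s (insert y s) = 0 := by
  rw [lmInc_insert_insert hx hy hxy, Finset.insert_comm, lmInc_insert_insert hy hx (Ne.symm hxy)]
  rcases lt_or_gt_of_ne hxy with h | h
  · rw [if_pos h, if_neg (not_lt.2 h.le)]; ring
  · rw [if_pos h, if_neg (not_lt.2 h.le)]; ring

theorem lmInc_mul_add_mul {s : Finset ℕ} {x y : ℕ} (hx : x ∉ s) (hy : y ∉ s) (hxy : x ≠ y) :
    lmInc (insert x s) (insert y (insert x s)) * lmInc (insert y s) (insert y (insert x s)) +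
      lmInc s (insert x s) * lmInc s (insert y s) = 0 := by
  rw [lmInc_insert_insert hx hy hxy, Finset.insert_comm, lmInc_insert_insert hy hx (Ne.symm hxy)]
  rcases lt_or_gt_of_ne hxy with h | h
  · rw [if_pos h, if_neg (not_lt.2 h.le)]; ring
  · rw [if_pos h, if_neg (not_lt.2 h.le)]; ring

theorem LMCell.card_eq {n c : ℕ} (σ : LMCell n c) : σ.1.card = c :=
  (Finset.mem_powersetCard.1 σ.2).2

theorem LMCell.subset_range {n c : ℕ} (σ : LMCell n c) : σ.1 ⊆ Finset.range n :=
  (Finset.mem_powersetCard.1 σ.2).1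

theorem LMCell.card_fintype (n c : ℕ) : Fintype.card (LMCell n c) = n.choose c := by
  rw [Fintype.card_coe, Finset.card_powersetCard, Finset.card_range]

theorem LMCell.union_card_gt {n c : ℕ} {σ σ' : LMCell n c} (h : σ ≠ σ') :
    c + 1 ≤ (σ.1 ∪ σ'.1).card := by
  by_contra hc
  have h1 : σ.1 = σ.1 ∪ σ'.1 :=
    Finset.eq_of_subset_of_card_le Finset.subset_union_left (by rw [σ.card_eq]; omega)
  have h2 : σ'.1 = σ.1 ∪ σ'.1 :=
    Finset.eq_of_subset_of_card_le Finset.subset_union_right (by rw [σ'.card_eq]; omega)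
  exact h (Subtype.ext (h1.trans h2.symm))

theorem LMCell.eq_union {n c : ℕ} {σ σ' : LMCell n c} (h : σ ≠ σ') {t : Finset ℕ}
    (ht : t.card = c + 1) (h1 : σ.1 ⊆ t) (h2 : σ'.1 ⊆ t) : t = σ.1 ∪ σ'.1 :=
  (Finset.eq_of_subset_of_card_le (Finset.union_subset h1 h2)
    (by rw [ht]; exact LMCell.union_card_gt h)).symm

theorem LMCell.exists_insert {n e : ℕ} {σ σ' : LMCell n (e + 1)}
    (hc : (σ.1 ∪ σ'.1).card = e + 2) :
    ∃ x y, x ∉ σ.1 ∩ σ'.1 ∧ y ∉ σ.1 ∩ σ'.1 ∧ x ≠ y ∧ σ.1 = insert x (σ.1 ∩ σ'.1) ∧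
      σ'.1 = insert y (σ.1 ∩ σ'.1) ∧ σ.1 ∪ σ'.1 = insert y (insert x (σ.1 ∩ σ'.1)) := by
  have hi := Finset.card_union_add_card_inter σ.1 σ'.1
  rw [σ.card_eq, σ'.card_eq] at hi
  have a1 : (σ.1 \ σ'.1).card = 1 := by
    have := Finset.card_sdiff_add_card_inter σ.1 σ'.1
    rw [σ.card_eq] at this; omega
  have a2 : (σ'.1 \ σ.1).card = 1 := by
    have := Finset.card_sdiff_add_card_inter σ'.1 σ.1
    rw [σ'.card_eq, Finset.inter_comm] at this; omega
  obtain ⟨x, hx⟩ := Finset.card_eq_one.1 a1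
  obtain ⟨y, hy⟩ := Finset.card_eq_one.1 a2
  have hx' : x ∈ σ.1 \ σ'.1 := by rw [hx]; simp
  have hy' : y ∈ σ'.1 \ σ.1 := by rw [hy]; simp
  rw [Finset.mem_sdiff] at hx' hy'
  have b1 : σ.1 = insert x (σ.1 ∩ σ'.1) := by
    rw [Finset.insert_eq, ← hx, Finset.sdiff_union_inter]
  have b2 : σ'.1 = insert y (σ.1 ∩ σ'.1) := by
    rw [Finset.insert_eq, ← hy, Finset.inter_comm, Finset.sdiff_union_inter]
  refine ⟨x, y, fun h => hx'.2 (Finset.mem_inter.1 h).2, fun h => hy'.2 (Finset.mem_inter.1 h).1,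
    fun h => hx'.2 (h ▸ hy'.1), b1, b2, ?_⟩
  rw [← b1]
  ext z
  have hz : z ∈ σ'.1 \ σ.1 ↔ z = y := by rw [hy]; simp
  simp only [Finset.mem_union, Finset.mem_insert, Finset.mem_sdiff] at hz ⊢
  tauto

theorem sum_lmInc_up_of_ne {n c : ℕ} {σ σ' : LMCell n c} (h : σ ≠ σ') (g : Finset ℕ → ℝ) :
    ∑ τ : LMCell n (c + 1), g τ.1 * (lmInc σ.1 τ.1 * lmInc σ'.1 τ.1) =
      if (σ.1 ∪ σ'.1).card = c + 1 then
        g (σ.1 ∪ σ'.1) * (lmInc σ.1 (σ.1 ∪ σ'.1) * lmInc σ'.1 (σ.1 ∪ σ'.1)) else 0 := by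
  have hz : ∀ τ : LMCell n (c + 1), τ.1 ≠ σ.1 ∪ σ'.1 →
      g τ.1 * (lmInc σ.1 τ.1 * lmInc σ'.1 τ.1) = 0 := by
    intro τ hτ
    by_cases h1 : σ.1 ⊆ τ.1
    · by_cases h2 : σ'.1 ⊆ τ.1
      · exact absurd (LMCell.eq_union h τ.card_eq h1 h2) hτ
      · rw [lmInc_of_not_subset h2]; ring
    · rw [lmInc_of_not_subset h1]; ring
  split_ifs with hc
  · rw [Finset.sum_eq_single (⟨σ.1 ∪ σ'.1, Finset.mem_powersetCard.2
      ⟨Finset.union_subset σ.subset_range σ'.subset_range, hc⟩⟩ : LMCell n (c + 1))]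
    · intro τ _ hτ
      exact hz τ fun h => hτ (Subtype.ext h)
    · simp
  · refine Finset.sum_eq_zero fun τ _ => hz τ fun h => hc ?_
    rw [← h, τ.card_eq]

theorem sum_lmInc_down_of_ne {n e : ℕ} {σ σ' : LMCell n (e + 1)} (h : σ ≠ σ') :
    ∑ ρ : LMCell n e, lmInc ρ.1 σ.1 * lmInc ρ.1 σ'.1 =
      if (σ.1 ∪ σ'.1).card = e + 2 then
        lmInc (σ.1 ∩ σ'.1) σ.1 * lmInc (σ.1 ∩ σ'.1) σ'.1 else 0 := by
  have hi := Finset.card_union_add_card_inter σ.1 σ'.1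
  have hu := LMCell.union_card_gt h
  rw [σ.card_eq, σ'.card_eq] at hi
  have hz : ∀ ρ : LMCell n e, ρ.1 ≠ σ.1 ∩ σ'.1 → lmInc ρ.1 σ.1 * lmInc ρ.1 σ'.1 = 0 := by
    intro ρ hρ
    by_cases h1 : ρ.1 ⊆ σ.1
    · by_cases h2 : ρ.1 ⊆ σ'.1
      · exact absurd (Finset.eq_of_subset_of_card_le (Finset.subset_inter h1 h2)
          (by rw [ρ.card_eq]; omega)) hρ
      · rw [lmInc_of_not_subset h2]; ring
    · rw [lmInc_of_not_subset h1]; ring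
  split_ifs with hc
  · rw [Finset.sum_eq_single (⟨σ.1 ∩ σ'.1, Finset.mem_powersetCard.2
      ⟨Finset.inter_subset_left.trans σ.subset_range, by omega⟩⟩ : LMCell n e)]
    · intro τ _ hτ
      exact hz τ fun h => hτ (Subtype.ext h)
    · simp
  · refine Finset.sum_eq_zero fun ρ _ => hz ρ fun h => hc ?_
    have := ρ.card_eq
    rw [h] at this; omega

theorem card_cofaces {n c : ℕ} (σ : LMCell n c) :
    ∑ τ : LMCell n (c + 1), (if σ.1 ⊆ τ.1 then (1 : ℝ) else 0) = n - c := by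
  rw [Finset.sum_coe_sort (Finset.powersetCard (c + 1) (Finset.range n))
    (fun t => if σ.1 ⊆ t then (1 : ℝ) else 0), Finset.sum_boole]
  have : (Finset.powersetCard (c + 1) (Finset.range n)).filter (fun t => σ.1 ⊆ t) =
      (Finset.range n \ σ.1).image (fun x => insert x σ.1) := by
    ext t
    simp only [Finset.mem_filter, Finset.mem_powersetCard, Finset.mem_image, Finset.mem_sdiff]
    constructor
    · rintro ⟨⟨h1, h2⟩, h3⟩
      have : (t \ σ.1).card = 1 := by
        rw [Finset.card_sdiff_of_subset h3, h2, σ.card_eq]; omega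
      obtain ⟨x, hx⟩ := Finset.card_eq_one.1 this
      have hx' : x ∈ t \ σ.1 := by rw [hx]; simp
      rw [Finset.mem_sdiff] at hx'
      refine ⟨x, ⟨h1 hx'.1, hx'.2⟩, ?_⟩
      rw [Finset.insert_eq, ← hx, Finset.sdiff_union_of_subset h3]
    · rintro ⟨x, ⟨h1, h2⟩, rfl⟩
      exact ⟨⟨Finset.insert_subset h1 σ.subset_range,
        by rw [Finset.card_insert_of_notMem h2, σ.card_eq]⟩, Finset.subset_insert _ _⟩
  rw [this, Finset.card_image_of_injOn, Finset.card_sdiff_of_subset σ.subset_range, σ.card_eq,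
    Finset.card_range, Nat.cast_sub]
  · have := Finset.card_le_card σ.subset_range
    rwa [σ.card_eq, Finset.card_range] at this
  · intro x hx y hy hxy
    simp only [Finset.coe_sdiff, Set.mem_sdiff, Finset.mem_coe] at hx hy
    have hxy' : insert x σ.1 = insert y σ.1 := hxy
    have : x ∈ insert y σ.1 := hxy' ▸ Finset.mem_insert_self x σ.1
    rcases Finset.mem_insert.1 this with h | h
    · exact h
    · exact absurd h hx.2

theorem card_faces {n e : ℕ} (σ : LMCell n (e + 1)) :
    ∑ ρ : LMCell n e, (if ρ.1 ⊆ σ.1 then (1 : ℝ) else 0) = e + 1 := by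
  rw [Finset.sum_coe_sort (Finset.powersetCard e (Finset.range n))
    (fun t => if t ⊆ σ.1 then (1 : ℝ) else 0), Finset.sum_boole]
  have : (Finset.powersetCard e (Finset.range n)).filter (fun t => t ⊆ σ.1) =
      Finset.powersetCard e σ.1 := by
    ext t
    simp only [Finset.mem_filter, Finset.mem_powersetCard]
    exact ⟨fun h => ⟨h.2, h.1.2⟩, fun h => ⟨⟨h.1.trans σ.subset_range, h.2⟩, h.1⟩⟩
  rw [this, Finset.card_powersetCard, σ.card_eq, Nat.choose_succ_self_right]
  push_cast; rfl

/-- The up and down Laplacians of the complete complex add up to `n`. -/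
theorem sum_lmInc_up_add_down {n e : ℕ} (σ σ' : LMCell n (e + 1)) :
    ∑ τ : LMCell n (e + 2), lmInc σ.1 τ.1 * lmInc σ'.1 τ.1 +
      ∑ ρ : LMCell n e, lmInc ρ.1 σ.1 * lmInc ρ.1 σ'.1 = if σ = σ' then (n : ℝ) else 0 := by
  by_cases h : σ = σ'
  · subst h
    have h1 := card_cofaces σ
    have h2 := card_faces σ
    simp only [← sq, lmInc_sq, if_true]
    rw [h1, h2]; push_cast; ring
  · have h1 := sum_lmInc_up_of_ne h (fun _ => 1)
    simp only [one_mul] at h1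
    rw [h1, sum_lmInc_down_of_ne h, if_neg h]
    split_ifs with hc
    · obtain ⟨x, y, hx, hy, hxy, e1, e2, e3⟩ := LMCell.exists_insert hc
      have := lmInc_mul_add_mul hx hy hxy
      rwa [← e3, ← e1, ← e2] at this
    · norm_num

theorem sum_lmInc_mul_lmInc {n e : ℕ} (ρ : LMCell n e) (τ : LMCell n (e + 2)) :
    ∑ σ : LMCell n (e + 1), lmInc σ.1 τ.1 * lmInc ρ.1 σ.1 = 0 := by
  by_cases h : ρ.1 ⊆ τ.1
  · have : (τ.1 \ ρ.1).card = 2 := by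
      rw [Finset.card_sdiff_of_subset h, τ.card_eq, ρ.card_eq]; omega
    obtain ⟨x, y, hxy, hs⟩ := Finset.card_eq_two.1 this
    have hx : x ∈ τ.1 \ ρ.1 := by rw [hs]; simp
    have hy : y ∈ τ.1 \ ρ.1 := by rw [hs]; simp
    rw [Finset.mem_sdiff] at hx hy
    have hτ : τ.1 = insert y (insert x ρ.1) := by
      rw [← Finset.sdiff_union_of_subset h, hs]
      ext z; simp; tauto
    have mk : ∀ z, z ∈ τ.1 → z ∉ ρ.1 →
        insert z ρ.1 ∈ Finset.powersetCard (e + 1) (Finset.range n) := by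
      intro z h1 h2
      exact Finset.mem_powersetCard.2 ⟨Finset.insert_subset (τ.subset_range h1) ρ.subset_range,
        by rw [Finset.card_insert_of_notMem h2, ρ.card_eq]⟩
    have hd := lmInc_diamond hx.2 hy.2 hxy
    rw [← hτ] at hd
    rw [Finset.sum_eq_add (⟨_, mk x hx.1 hx.2⟩ : LMCell n (e + 1)) ⟨_, mk y hy.1 hy.2⟩]
    · exact hd
    · intro heq
      have h2 : insert x ρ.1 = insert y ρ.1 := congrArg Subtype.val heq
      have : x ∈ insert y ρ.1 := h2 ▸ Finset.mem_insert_self x ρ.1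
      rcases Finset.mem_insert.1 this with h | h
      · exact hxy h
      · exact hx.2 h
    · rintro σ - ⟨h1, h2⟩
      by_cases a1 : σ.1 ⊆ τ.1
      · by_cases a2 : ρ.1 ⊆ σ.1
        · exfalso
          have : (σ.1 \ ρ.1).card = 1 := by
            rw [Finset.card_sdiff_of_subset a2, LMCell.card_eq (c := e + 1) σ, ρ.card_eq]; omega
          obtain ⟨z, hz⟩ := Finset.card_eq_one.1 this
          have hσ : σ.1 = insert z ρ.1 := by
            rw [Finset.insert_eq, ← hz, Finset.sdiff_union_of_subset a2]
          have hz' : z ∈ σ.1 \ ρ.1 := by rw [hz]; simp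
          rw [Finset.mem_sdiff] at hz'
          have : z ∈ τ.1 \ ρ.1 := Finset.mem_sdiff.2 ⟨a1 hz'.1, hz'.2⟩
          rw [hs] at this
          simp only [Finset.mem_insert, Finset.mem_singleton] at this
          rcases this with rfl | rfl
          · exact h1 (Subtype.ext hσ)
          · exact h2 (Subtype.ext hσ)
        · rw [lmInc_of_not_subset a2, mul_zero]
      · rw [lmInc_of_not_subset a1, zero_mul]
    · simp
    · simp
  · refine Finset.sum_eq_zero fun σ _ => ?_
    by_cases a1 : σ.1 ⊆ τ.1
    · rw [lmInc_of_not_subset (s := ρ.1) fun a2 => h (a2.trans a1), mul_zero]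
    · rw [lmInc_of_not_subset a1, zero_mul]

open Classical in
theorem LMadj_apply_eq_sum (n d : ℕ) (X : Set (Finset ℕ)) (σ σ' : LMCell n d) :
    LMadj n d X σ σ' = ∑ τ : LMCell n (d + 1), (if τ.1 ∈ X then (1 : ℝ) else 0) *
      ((if σ = σ' then (if σ.1 ⊆ τ.1 then 1 else 0) else 0) - lmInc σ.1 τ.1 * lmInc σ'.1 τ.1) := by
  unfold LMadj
  by_cases h : σ = σ'
  · subst h
    rw [if_neg (by rw [Finset.union_self, σ.card_eq]; rintro ⟨h, -⟩; omega)]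
    refine (Finset.sum_eq_zero fun τ _ => ?_).symm
    rw [← sq, lmInc_sq, if_pos rfl, sub_self, mul_zero]
  · simp only [if_neg h, zero_sub, mul_neg, Finset.sum_neg_distrib]
    rw [sum_lmInc_up_of_ne h (fun t => if t ∈ X then (1 : ℝ) else 0)]
    by_cases hc : (σ.1 ∪ σ'.1).card = d + 1
    · by_cases hX : σ.1 ∪ σ'.1 ∈ X
      · rw [if_pos ⟨hc, hX⟩, if_pos hc, if_pos hX, one_mul]
        unfold lmInc
        rw [if_pos Finset.subset_union_left, if_pos Finset.subset_union_right,
          Finset.union_sdiff_left, Finset.union_sdiff_right, ← pow_add, pow_succ]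
        ring
      · rw [if_neg fun h => hX h.2, if_pos hc, if_neg hX]; ring
    · rw [if_neg fun h => hc h.1, if_neg hc]; ring

/-- The face of `τ` opposite to its `j`-th vertex. -/
def lmFace {n d : ℕ} (j : Fin (d + 1)) (τ : LMCell n (d + 1)) : LMCell n d :=
  ⟨τ.1.erase (τ.1.orderEmbOfFin τ.card_eq j), Finset.mem_powersetCard.2
    ⟨(Finset.erase_subset _ _).trans τ.subset_range, by
      rw [Finset.card_erase_of_mem (Finset.orderEmbOfFin_mem _ _ _), τ.card_eq]; omega⟩⟩

theorem sum_ite_lmFace_eq {n d : ℕ} (τ : LMCell n (d + 1)) (σ : LMCell n d) :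
    ∑ j, (if lmFace j τ = σ then (1 : ℝ) else 0) = if σ.1 ⊆ τ.1 then 1 else 0 := by
  split_ifs with h
  · have : (τ.1 \ σ.1).card = 1 := by
      rw [Finset.card_sdiff_of_subset h, τ.card_eq, σ.card_eq]; omega
    obtain ⟨x, hx⟩ := Finset.card_eq_one.1 this
    have hx' : x ∈ τ.1 \ σ.1 := by rw [hx]; simp
    have hxτ := (Finset.mem_sdiff.1 hx').1
    have hσ : σ.1 = τ.1.erase x := by
      rw [Finset.erase_eq, ← hx, Finset.sdiff_sdiff_eq_self h]
    have hr : x ∈ Set.range (τ.1.orderEmbOfFin τ.card_eq) := by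
      rw [Finset.range_orderEmbOfFin]; exact hxτ
    obtain ⟨j, hj⟩ := hr
    rw [Finset.sum_eq_single j, if_pos]
    · refine Subtype.ext ?_
      change τ.1.erase (τ.1.orderEmbOfFin τ.card_eq j) = σ.1
      rw [hσ, hj]
    · intro i _ hij
      rw [if_neg]
      intro hi
      have h1 : τ.1.erase (τ.1.orderEmbOfFin τ.card_eq i) = τ.1.erase x :=
        (congrArg Subtype.val hi).trans hσ
      have h2 := (Finset.erase_inj τ.1 (Finset.orderEmbOfFin_mem τ.1 τ.card_eq i)).1 h1
      exact hij ((τ.1.orderEmbOfFin τ.card_eq).injective (h2.trans hj.symm))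
    · simp
  · refine Finset.sum_eq_zero fun j _ => if_neg fun hj => h ?_
    rw [← hj]
    exact Finset.erase_subset _ _

end CellCombinatorics

section SortedEigenvalues

open Matrix

variable {κ : Type} [Fintype κ] [DecidableEq κ]

theorem exists_diagonalization_roots {A : Matrix κ κ ℝ} (hA : A.IsSymm) :
    ∃ (U : Matrix κ κ ℝ) (a : κ → ℝ), Uᵀ * U = 1 ∧ U * Uᵀ = 1 ∧ A = U * diagonal a * Uᵀ ∧
      A.charpoly.roots = Finset.univ.val.map a := by
  have hA' : A.IsHermitian := by
    rw [Matrix.IsHermitian, Matrix.conjTranspose_eq_transpose_of_trivial]; exact hA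
  have hs := hA'.spectral_theorem
  rw [Unitary.conjStarAlgAut_apply] at hs
  refine ⟨hA'.eigenvectorUnitary, hA'.eigenvalues, ?_, ?_, ?_, ?_⟩
  · have := Unitary.coe_star_mul_self hA'.eigenvectorUnitary
    rwa [Matrix.star_eq_conjTranspose, Matrix.conjTranspose_eq_transpose_of_trivial] at this
  · have := Unitary.coe_mul_star_self hA'.eigenvectorUnitary
    rwa [Unitary.coe_star, Matrix.star_eq_conjTranspose,
      Matrix.conjTranspose_eq_transpose_of_trivial] at this
  · rw [Matrix.star_eq_conjTranspose, Matrix.conjTranspose_eq_transpose_of_trivial] at hs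
    exact hs
  · simpa using hA'.roots_charpoly_eq_eigenvalues

theorem dotProduct_diagonalization {A U : Matrix κ κ ℝ} {a : κ → ℝ}
    (h : A = U * diagonal a * Uᵀ) (f : κ → ℝ) :
    f ⬝ᵥ A *ᵥ f = ∑ x, a x * (Uᵀ *ᵥ f) x ^ 2 := by
  rw [h, ← Matrix.mulVec_mulVec, ← Matrix.mulVec_mulVec, Matrix.dotProduct_mulVec,
    ← Matrix.mulVec_transpose, dotProduct]
  refine Finset.sum_congr rfl fun x _ => ?_
  rw [Matrix.mulVec_diagonal]; ring

theorem dotProduct_self_transpose_mulVec {U : Matrix κ κ ℝ} (h : U * Uᵀ = 1) (f : κ → ℝ) :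
    f ⬝ᵥ f = ∑ x, (Uᵀ *ᵥ f) x ^ 2 := by
  have := dotProduct_diagonalization (A := 1) (U := U) (a := fun _ => 1)
    (by rw [Matrix.diagonal_one, Matrix.mul_one, h]) f
  simpa using this

theorem getD_sort_lt_card_le (s : Multiset ℝ) {i : ℕ} (hi : i < s.card) {L : ℝ}
    (h : (s.sort (· ≤ ·)).getD i 0 < L) : i + 1 ≤ s.countP (· < L) := by
  set l := s.sort (· ≤ ·) with hl
  have hlen : l.length = s.card := Multiset.length_sort _
  have hil : i < l.length := by omega
  have hp : l.Pairwise (· ≤ ·) := Multiset.pairwise_sort s _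
  have hs : (l : Multiset ℝ) = s := Multiset.sort_eq s _
  rw [List.getD_eq_getElem _ _ hil] at h
  rw [← hs, Multiset.coe_countP]
  have h1 : (l.take (i + 1)).countP (· < L) = (l.take (i + 1)).length := by
    rw [List.countP_eq_length]
    intro x hx
    obtain ⟨k, hk, rfl⟩ := List.mem_iff_getElem.1 hx
    rw [List.length_take] at hk
    rw [List.getElem_take]
    have : l[k] ≤ l[i] := hp.sortedLE.getElem_le_getElem_of_le (by omega)
    simpa using this.trans_lt h
  have h2 := (List.take_sublist (i + 1) l).countP_le (p := fun x => decide (x < L))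
  rw [h1, List.length_take] at h2
  omega

theorem LMeig_le {A : Matrix κ κ ℝ} (hA : A.IsSymm) {B : ℝ}
    (h : ∀ f, f ⬝ᵥ A *ᵥ f ≤ B * (f ⬝ᵥ f)) {i : ℕ} (hi : i < Fintype.card κ) : LMeig A i ≤ B := by
  obtain ⟨U, a, u1, u2, hU, hr⟩ := exists_diagonalization_roots hA
  have hlen : (A.charpoly.roots.sort (· ≤ ·)).length = Fintype.card κ := by
    rw [Multiset.length_sort, hr]; simp
  have hmem : LMeig A i ∈ A.charpoly.roots := by
    rw [LMeig, List.getD_eq_getElem _ _ (by omega)]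
    exact (Multiset.mem_sort _).1 (List.getElem_mem _)
  rw [hr] at hmem
  obtain ⟨j, -, hj⟩ := Multiset.mem_map.1 hmem
  rw [← hj]
  have := h (U *ᵥ Pi.single j 1)
  rw [dotProduct_diagonalization hU, dotProduct_self_transpose_mulVec u2] at this
  rw [Matrix.mulVec_mulVec, u1, Matrix.one_mulVec] at this
  simpa [Pi.single_apply] using this

theorem le_LMeig {A : Matrix κ κ ℝ} (hA : A.IsSymm) {L : ℝ} (G : Submodule ℝ (κ → ℝ))
    (h : ∀ f ∈ G, L * (f ⬝ᵥ f) ≤ f ⬝ᵥ A *ᵥ f) {i : ℕ}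
    (hG : Fintype.card κ ≤ i + Module.finrank ℝ G) (hi : i < Fintype.card κ) :
    L ≤ LMeig A i := by
  obtain ⟨U, a, u1, u2, hU, hr⟩ := exists_diagonalization_roots hA
  by_contra hlt
  rw [not_le, LMeig] at hlt
  have h1 := getD_sort_lt_card_le _ (by rw [hr]; simpa using hi) hlt
  rw [hr, Multiset.countP_map] at h1
  change i + 1 ≤ (Finset.univ.filter fun x => a x < L).card at h1
  let φ : G →ₗ[ℝ] ({x // ¬ a x < L} → ℝ) :=
    (LinearMap.funLeft ℝ ℝ (Subtype.val : {x // ¬ a x < L} → κ)) ∘ₗ (Uᵀ).mulVecLin ∘ₗ G.subtype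
  have hinj : Function.Injective φ := by
    rw [← LinearMap.ker_eq_bot, LinearMap.ker_eq_bot']
    intro g hg
    have hz : ∀ x, ¬ a x < L → (Uᵀ *ᵥ g.1) x = 0 := fun x hx => congrFun hg ⟨x, hx⟩
    have hq := h g.1 g.2
    rw [dotProduct_diagonalization hU, dotProduct_self_transpose_mulVec u2, Finset.mul_sum] at hq
    have hle : ∀ x ∈ Finset.univ, a x * (Uᵀ *ᵥ g.1) x ^ 2 ≤ L * (Uᵀ *ᵥ g.1) x ^ 2 := by
      intro x _
      by_cases hx : a x < L
      · exact mul_le_mul_of_nonneg_right hx.le (sq_nonneg _)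
      · rw [hz x hx]; simp
    have heq := (Finset.sum_eq_sum_iff_of_le hle).1 (le_antisymm (Finset.sum_le_sum hle) hq)
    have hy : Uᵀ *ᵥ g.1 = 0 := by
      funext x
      by_cases hx : a x < L
      · have := heq x (Finset.mem_univ x)
        have h0 : (L - a x) * (Uᵀ *ᵥ g.1) x ^ 2 = 0 := by linarith
        rcases mul_eq_zero.1 h0 with h | h
        · linarith
        · simpa using h
      · exact hz x hx
    apply Subtype.ext
    have : U *ᵥ (Uᵀ *ᵥ g.1) = g.1 := by rw [Matrix.mulVec_mulVec, u2, Matrix.one_mulVec]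
    rw [← this, hy, Matrix.mulVec_zero]; rfl
  have h2 := LinearMap.finrank_le_finrank_of_injective hinj
  rw [Module.finrank_fintype_fun_eq_card, Fintype.card_subtype] at h2
  have h3 := Finset.card_filter_add_card_filter_not (s := (Finset.univ : Finset κ))
    (fun x => a x < L)
  rw [Finset.card_univ] at h3
  omega

end SortedEigenvalues

section CochainDecomposition

open Matrix

variable {n e : ℕ}

/-- The boundary of the cell `τ`, as a cochain one dimension lower. -/
def lmUp (τ : LMCell n (e + 2)) : LMCell n (e + 1) → ℝ := fun σ => lmInc σ.1 τ.1

/-- The coboundary of the cell `ρ`, as a cochain one dimension higher. -/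
def lmDown (ρ : LMCell n e) : LMCell n (e + 1) → ℝ := fun σ => lmInc ρ.1 σ.1

/-- The orthogonal projection of the basis vector of `σ` to the space of coboundaries. -/
def lmProj (σ : LMCell n (e + 1)) : LMCell n (e + 1) → ℝ :=
  fun υ => (n : ℝ)⁻¹ * ∑ ρ, lmDown ρ σ * lmDown ρ υ

/-- The coboundary part of a cochain. -/
def lmExact (f : LMCell n (e + 1) → ℝ) : LMCell n (e + 1) → ℝ := fun σ => lmProj σ ⬝ᵥ f

theorem lmUp_dotProduct_lmUp (τ : LMCell n (e + 2)) : lmUp τ ⬝ᵥ lmUp τ = e + 2 := by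
  have := card_faces τ
  simp only [dotProduct, lmUp, ← sq, lmInc_sq]
  rw [this]; push_cast; ring

theorem lmUp_dotProduct_lmDown (τ : LMCell n (e + 2)) (ρ : LMCell n e) :
    lmUp τ ⬝ᵥ lmDown ρ = 0 := sum_lmInc_mul_lmInc ρ τ

theorem lmExact_eq_sum (f : LMCell n (e + 1) → ℝ) (σ : LMCell n (e + 1)) :
    lmExact f σ = (n : ℝ)⁻¹ * ∑ ρ, lmDown ρ σ * (lmDown ρ ⬝ᵥ f) := by
  simp only [lmExact, lmProj, dotProduct, Finset.mul_sum, Finset.sum_mul]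
  rw [Finset.sum_comm]
  refine Finset.sum_congr rfl fun ρ _ => Finset.sum_congr rfl fun σ' _ => by ring

theorem lmUp_dotProduct_lmExact (f : LMCell n (e + 1) → ℝ) (τ : LMCell n (e + 2)) :
    lmUp τ ⬝ᵥ lmExact f = 0 := by
  have : lmExact f = (n : ℝ)⁻¹ • ∑ ρ, (lmDown ρ ⬝ᵥ f) • lmDown ρ := by
    funext σ
    rw [lmExact_eq_sum]
    simp [mul_comm]
  rw [this, dotProduct_smul, dotProduct_sum]
  simp [dotProduct_smul, lmUp_dotProduct_lmDown]

theorem sum_lmUp_add_sum_lmDown (f : LMCell n (e + 1) → ℝ) (σ : LMCell n (e + 1)) :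
    ∑ τ, lmUp τ σ * (lmUp τ ⬝ᵥ f) + ∑ ρ, lmDown ρ σ * (lmDown ρ ⬝ᵥ f) = n * f σ := by
  have h : ∀ σ' : LMCell n (e + 1), (∑ τ, lmUp τ σ * lmUp τ σ' + ∑ ρ, lmDown ρ σ * lmDown ρ σ') =
    if σ = σ' then (n : ℝ) else 0 := fun σ' => sum_lmInc_up_add_down σ σ'
  have h2 : ∑ σ', (∑ τ, lmUp τ σ * lmUp τ σ' + ∑ ρ, lmDown ρ σ * lmDown ρ σ') * f σ' =
      n * f σ := by
    simp_rw [h, ite_mul, zero_mul]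
    simp
  rw [← h2]
  simp only [add_mul, Finset.sum_add_distrib, Finset.sum_mul, dotProduct, Finset.mul_sum]
  congr 1
  · rw [Finset.sum_comm]
    refine Finset.sum_congr rfl fun ρ _ => Finset.sum_congr rfl fun σ' _ => by ring
  · rw [Finset.sum_comm]
    refine Finset.sum_congr rfl fun ρ _ => Finset.sum_congr rfl fun σ' _ => by ring

theorem sub_lmExact_eq_sum (hn : 0 < n) (f : LMCell n (e + 1) → ℝ) (σ : LMCell n (e + 1)) :
    f σ - lmExact f σ = (n : ℝ)⁻¹ * ∑ τ, lmUp τ σ * (lmUp τ ⬝ᵥ f) := by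
  have hn' : (n : ℝ) ≠ 0 := by positivity
  rw [lmExact_eq_sum]
  field_simp
  linarith [sum_lmUp_add_sum_lmDown f σ]

theorem sub_lmExact_eq_smul_sum (hn : 0 < n) (f : LMCell n (e + 1) → ℝ) :
    f - lmExact f = (n : ℝ)⁻¹ • ∑ τ, (lmUp τ ⬝ᵥ f) • lmUp τ := by
  funext σ
  rw [Pi.sub_apply, sub_lmExact_eq_sum hn]
  simp [mul_comm]

theorem lmExact_eq_self (hn : 0 < n) {g : LMCell n (e + 1) → ℝ} (h : ∀ τ, lmUp τ ⬝ᵥ g = 0) :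
    lmExact g = g := by
  funext σ
  have := sub_lmExact_eq_sum hn g σ
  simp only [h, mul_zero, Finset.sum_const_zero] at this
  linarith

theorem lmExact_dotProduct_sub (hn : 0 < n) (f : LMCell n (e + 1) → ℝ) :
    lmExact f ⬝ᵥ (f - lmExact f) = 0 := by
  rw [sub_lmExact_eq_smul_sum hn, dotProduct_smul, dotProduct_sum]
  simp [dotProduct_comm (lmExact f), lmUp_dotProduct_lmExact]

theorem dotProduct_self_eq_lmExact_add (hn : 0 < n) (f : LMCell n (e + 1) → ℝ) :
    f ⬝ᵥ f = lmExact f ⬝ᵥ lmExact f + (f - lmExact f) ⬝ᵥ (f - lmExact f) := by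
  have h := lmExact_dotProduct_sub hn f
  have h2 : f = lmExact f + (f - lmExact f) := by simp
  conv_lhs => rw [h2]
  rw [add_dotProduct, dotProduct_add, dotProduct_add, h,
    dotProduct_comm (f - lmExact f) (lmExact f), h]
  ring

theorem sum_lmProj_dotProduct_sq_le (hn : 0 < n) (f : LMCell n (e + 1) → ℝ) :
    ∑ σ, (lmProj σ ⬝ᵥ f) ^ 2 ≤ f ⬝ᵥ f := by
  rw [dotProduct_self_eq_lmExact_add hn f]
  have : ∑ σ, (lmProj σ ⬝ᵥ f) ^ 2 = lmExact f ⬝ᵥ lmExact f := by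
    simp [dotProduct, sq, lmExact]
  rw [this]
  have := dotProduct_self_nonneg_real (f - lmExact f)
  linarith

theorem sum_lmUp_dotProduct_sq_add (f : LMCell n (e + 1) → ℝ) :
    ∑ τ : LMCell n (e + 2), (lmUp τ ⬝ᵥ f) ^ 2 + ∑ ρ : LMCell n e, (lmDown ρ ⬝ᵥ f) ^ 2 =
      n * (f ⬝ᵥ f) := by
  have key : ∀ {α : Type} [Fintype α] (v : α → LMCell n (e + 1) → ℝ),
      ∑ a, (v a ⬝ᵥ f) ^ 2 = ∑ σ, f σ * ∑ a, v a σ * (v a ⬝ᵥ f) := by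
    intro α _ v
    simp only [Finset.mul_sum]
    rw [Finset.sum_comm]
    refine Finset.sum_congr rfl fun a _ => ?_
    rw [sq]
    conv_lhs => rw [dotProduct, Finset.sum_mul]
    exact Finset.sum_congr rfl fun σ _ => by simp only [dotProduct]; ring
  rw [key, key, ← Finset.sum_add_distrib, dotProduct, Finset.mul_sum]
  refine Finset.sum_congr rfl fun σ _ => ?_
  rw [← mul_add, sum_lmUp_add_sum_lmDown]; ring

theorem sum_lmUp_dotProduct_sq_le (f : LMCell n (e + 1) → ℝ) :
    ∑ τ : LMCell n (e + 2), (lmUp τ ⬝ᵥ f) ^ 2 ≤ n * (f ⬝ᵥ f) := by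
  have h := sum_lmUp_dotProduct_sq_add f
  have : 0 ≤ ∑ ρ : LMCell n e, (lmDown ρ ⬝ᵥ f) ^ 2 := Finset.sum_nonneg fun _ _ => sq_nonneg _
  linarith

theorem sum_lmUp_dotProduct_sub_lmExact_sq (hn : 0 < n) (f : LMCell n (e + 1) → ℝ) :
    ∑ τ : LMCell n (e + 2), (lmUp τ ⬝ᵥ (f - lmExact f)) ^ 2 =
      n * ((f - lmExact f) ⬝ᵥ (f - lmExact f)) := by
  rw [← sum_lmUp_dotProduct_sq_add, Finset.sum_eq_zero (s := Finset.univ (α := LMCell n e)),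
      add_zero]
  intro ρ _
  rw [sub_lmExact_eq_smul_sum hn, dotProduct_smul, dotProduct_sum]
  simp [dotProduct_comm (lmDown ρ), lmUp_dotProduct_lmDown]

theorem lmProj_self (σ : LMCell n (e + 1)) : lmProj σ σ = (e + 1) / n := by
  have := card_faces σ
  simp only [lmProj, lmDown, ← sq, lmInc_sq]
  rw [this]; ring

theorem lmProj_comm (σ σ' : LMCell n (e + 1)) : lmProj σ σ' = lmProj σ' σ := by
  simp only [lmProj, mul_comm]

theorem lmProj_eq_lmExact (σ : LMCell n (e + 1)) : lmProj σ = lmExact (Pi.single σ 1) := by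
  funext σ'
  rw [lmExact, dotProduct_single, mul_one, lmProj_comm]

theorem lmProj_dotProduct_lmProj (hn : 0 < n) (σ : LMCell n (e + 1)) :
    lmProj σ ⬝ᵥ lmProj σ = (e + 1) / n := by
  have : lmExact (lmProj σ) = lmProj σ :=
    lmExact_eq_self hn fun τ => by rw [lmProj_eq_lmExact, lmUp_dotProduct_lmExact]
  have h2 := congrFun this σ
  rw [lmProj_self] at h2
  exact h2

/-- The coboundary projection as a linear map. -/
def lmExactLinear (n e : ℕ) : (LMCell n (e + 1) → ℝ) →ₗ[ℝ] (LMCell n (e + 1) → ℝ) :=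
  Matrix.toLin' (Matrix.of fun σ σ' : LMCell n (e + 1) => lmProj σ σ')

theorem finrank_range_lmExactLinear (hn : 0 < n) :
    Module.finrank ℝ (LinearMap.range (lmExactLinear n e)) + (n - 1).choose (e + 1) =
      n.choose (e + 1) := by
  have hid : IsIdempotentElem (lmExactLinear n e) := by
    refine LinearMap.ext fun f => ?_
    change lmExact (lmExact _) = lmExact _
    exact lmExact_eq_self hn fun τ => lmUp_dotProduct_lmExact _ τ
  have ht := (LinearMap.IsIdempotentElem.isProj_range _ hid).trace
  rw [lmExactLinear, Matrix.trace_toLin'_eq] at ht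
  have h1 : Matrix.trace (Matrix.of fun σ σ' : LMCell n (e + 1) => lmProj σ σ') =
      n.choose (e + 1) * ((e + 1) / n) := by
    simp only [Matrix.trace, Matrix.diag, Matrix.of_apply, lmProj_self, Finset.sum_const,
      Finset.card_univ, LMCell.card_fintype, nsmul_eq_mul]
  obtain ⟨m, rfl⟩ : ∃ m, n = m + 1 := ⟨n - 1, by omega⟩
  have h2 : ((m + 1).choose (e + 1) * (e + 1) : ℝ) = (m + 1) * m.choose e := by
    exact_mod_cast (Nat.add_one_mul_choose_eq m e).symm
  have h3 : (m + 1).choose (e + 1) = m.choose e + m.choose (e + 1) := Nat.choose_succ_succ m e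
  rw [h1] at ht
  have h4 : (Module.finrank ℝ (LinearMap.range (lmExactLinear (m + 1) e)) : ℝ) = m.choose e := by
    unfold lmExactLinear
    rw [← ht]
    have : ((m + 1 : ℕ) : ℝ) ≠ 0 := by positivity
    field_simp
    rw [h2]; push_cast; ring
  have h5 : Module.finrank ℝ (LinearMap.range (lmExactLinear (m + 1) e)) = m.choose e := by
    exact_mod_cast h4
  rw [h5, h3]; simp

end CochainDecomposition

section AdjacencyForm

open Matrix

variable {n e : ℕ}

theorem LMadj_isSymm (n d : ℕ) (X : Set (Finset ℕ)) : (LMadj n d X).IsSymm := by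
  refine Matrix.IsSymm.ext fun σ υ => ?_
  rw [LMadj_apply_eq_sum, LMadj_apply_eq_sum]
  refine Finset.sum_congr rfl fun τ _ => ?_
  by_cases h : σ = υ
  · subst h; rfl
  · rw [if_neg h, if_neg (Ne.symm h), mul_comm (lmInc υ.1 τ.1)]

/-- The sum of `x` over the cells containing `σ`. -/
def lmDegree {d : ℕ} (x : LMCell n (d + 1) → ℝ) (σ : LMCell n d) : ℝ :=
  ∑ τ, x τ * if σ.1 ⊆ τ.1 then 1 else 0

theorem dotProduct_LMadj_mulVec {X : Set (Finset ℕ)} {p : ℝ} {x : LMCell n (e + 2) → ℝ}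
    (hx : ∀ τ, x τ = X.indicator (fun _ => 1) τ.1 - p) (f : LMCell n (e + 1) → ℝ) :
    f ⬝ᵥ LMadj n (e + 1) X *ᵥ f = p * ((n - (e + 1)) * (f ⬝ᵥ f)) -
      p * ∑ τ : LMCell n (e + 2), (lmUp τ ⬝ᵥ f) ^ 2 + ∑ σ, lmDegree x σ * f σ ^ 2 -
      ∑ τ, x τ * (lmUp τ ⬝ᵥ f) ^ 2 := by
  classical
  have h1 : f ⬝ᵥ LMadj n (e + 1) X *ᵥ f = ∑ τ : LMCell n (e + 2), (p + x τ) *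
      (∑ σ, (if σ.1 ⊆ τ.1 then 1 else 0) * f σ ^ 2 - (lmUp τ ⬝ᵥ f) ^ 2) := by
    have h2 : ∀ τ : LMCell n (e + 2), (p + x τ) *
        (∑ σ, (if σ.1 ⊆ τ.1 then 1 else 0) * f σ ^ 2 - (lmUp τ ⬝ᵥ f) ^ 2) =
        ∑ σ, ∑ σ', f σ * (((if τ.1 ∈ X then (1 : ℝ) else 0) *
          ((if σ = σ' then (if σ.1 ⊆ τ.1 then 1 else 0) else 0) -
            lmInc σ.1 τ.1 * lmInc σ'.1 τ.1)) * f σ') := by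
      intro τ
      have hxτ : p + x τ = if τ.1 ∈ X then (1 : ℝ) else 0 := by
        rw [hx, Set.indicator_apply]; ring
      rw [hxτ]
      have h3 : (lmUp τ ⬝ᵥ f) ^ 2 =
          ∑ σ, ∑ σ', f σ * (lmInc σ.1 τ.1 * lmInc σ'.1 τ.1) * f σ' := by
        rw [sq, dotProduct, Finset.sum_mul_sum]
        refine Finset.sum_congr rfl fun σ _ => Finset.sum_congr rfl fun σ' _ => ?_
        simp only [lmUp]; ring
      have h4 : ∑ σ : LMCell n (e + 1), (if σ.1 ⊆ τ.1 then (1 : ℝ) else 0) * f σ ^ 2 =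
          ∑ σ, ∑ σ', f σ * (if σ = σ' then (if σ.1 ⊆ τ.1 then 1 else 0) else 0) * f σ' := by
        refine Finset.sum_congr rfl fun σ _ => ?_
        simp only [mul_ite, ite_mul, mul_zero, zero_mul, Finset.sum_ite_eq, Finset.mem_univ,
          if_true]
        split_ifs <;> ring
      rw [h3, h4, ← Finset.sum_sub_distrib, Finset.mul_sum]
      refine Finset.sum_congr rfl fun σ _ => ?_
      rw [← Finset.sum_sub_distrib, Finset.mul_sum]
      exact Finset.sum_congr rfl fun σ' _ => by ring
    simp only [h2]
    rw [Finset.sum_comm, dotProduct]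
    refine Finset.sum_congr rfl fun σ _ => ?_
    rw [Finset.sum_comm, mulVec, dotProduct, Finset.mul_sum]
    refine Finset.sum_congr rfl fun σ' _ => ?_
    rw [LMadj_apply_eq_sum, ← Finset.mul_sum, Finset.sum_mul]
  have h5 : ∑ τ : LMCell n (e + 2),
      ∑ σ : LMCell n (e + 1), (if σ.1 ⊆ τ.1 then (1 : ℝ) else 0) * f σ ^ 2 =
      (n - (e + 1)) * (f ⬝ᵥ f) := by
    rw [Finset.sum_comm, dotProduct, Finset.mul_sum]
    refine Finset.sum_congr rfl fun σ _ => ?_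
    rw [← Finset.sum_mul, card_cofaces]
    push_cast; ring
  have h6 : ∑ σ, lmDegree x σ * f σ ^ 2 = ∑ τ, x τ *
      ∑ σ : LMCell n (e + 1), (if σ.1 ⊆ τ.1 then (1 : ℝ) else 0) * f σ ^ 2 := by
    simp only [lmDegree, Finset.mul_sum, Finset.sum_mul]
    rw [Finset.sum_comm]
    exact Finset.sum_congr rfl fun τ _ => Finset.sum_congr rfl fun σ _ => by ring
  rw [h1, h6, ← h5]
  simp only [add_mul, mul_sub, Finset.sum_add_distrib, Finset.sum_sub_distrib, Finset.mul_sum]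
  ring

theorem dotProduct_LMadj_mulVec_ge (hn : 0 < n) {X : Set (Finset ℕ)} {p : ℝ} (hp : p ≤ 1)
    {x : LMCell n (e + 2) → ℝ}
    (hx : ∀ τ, x τ = X.indicator (fun _ => 1) τ.1 - p)
    (hdiag : ∀ f, |∑ σ, lmDegree x σ * (lmProj σ ⬝ᵥ f) ^ 2| ≤ f ⬝ᵥ f)
    {g : LMCell n (e + 1) → ℝ} (hg : ∀ τ, lmUp τ ⬝ᵥ g = 0) :
    (n * p - (e + 2)) * (g ⬝ᵥ g) ≤ g ⬝ᵥ LMadj n (e + 1) X *ᵥ g := by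
  have h1 := hdiag g
  have h2 : ∀ σ, lmProj σ ⬝ᵥ g = g σ := fun σ => congrFun (lmExact_eq_self hn hg) σ
  simp only [h2] at h1
  rw [dotProduct_LMadj_mulVec hx]
  simp only [hg]
  have h3 := (abs_le.1 h1).1
  have h0 := dotProduct_self_nonneg_real g
  have h4 : p * ((e + 1) * (g ⬝ᵥ g)) ≤ 1 * ((e + 1) * (g ⬝ᵥ g)) :=
    mul_le_mul_of_nonneg_right hp (by positivity)
  simp only [ne_eq, OfNat.ofNat_ne_zero, not_false_eq_true, zero_pow, Finset.sum_const_zero,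
    mul_zero, sub_zero]
  linarith

theorem dotProduct_LMadj_mulVec_le (hn : 0 < n) {X : Set (Finset ℕ)} {p : ℝ} (hp : 0 < p)
    {x : LMCell n (e + 2) → ℝ}
    (hx : ∀ τ, x τ = X.indicator (fun _ => 1) τ.1 - p)
    (hdiag : ∀ f, |∑ σ, lmDegree x σ * (lmProj σ ⬝ᵥ f) ^ 2| ≤ f ⬝ᵥ f)
    (hup : ∀ f : LMCell n (e + 1) → ℝ, |∑ τ, x τ * (lmUp τ ⬝ᵥ f) ^ 2| ≤ (n * p / 16) * (f ⬝ᵥ f))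
    (hdeg : ∀ σ : LMCell n (e + 1), |lmDegree x σ| ≤ n * p / 16)
    (hsq : ∀ f, ∑ σ : LMCell n (e + 1), lmDegree x σ ^ 2 * (lmProj σ ⬝ᵥ f) ^ 2 ≤
      (5 * (e + 1) * (n * p)) * (f ⬝ᵥ f))
    (f : LMCell n (e + 1) → ℝ) :
    f ⬝ᵥ LMadj n (e + 1) X *ᵥ f ≤ (n * p + 7 * (e + 1)) * (f ⬝ᵥ f) := by
  set g := lmExact f with hg
  set h := f - lmExact f with hh
  have hng : 0 < (n : ℝ) * p := by positivity
  have hvf : ∀ τ : LMCell n (e + 2), lmUp τ ⬝ᵥ f = lmUp τ ⬝ᵥ h := by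
    intro τ
    rw [hh, dotProduct_sub, lmUp_dotProduct_lmExact, sub_zero]
  have hgg : ∀ σ, lmProj σ ⬝ᵥ f = g σ := fun σ => rfl
  have hgg' : ∀ σ, lmProj σ ⬝ᵥ g = g σ :=
    fun σ => congrFun (lmExact_eq_self hn fun τ => lmUp_dotProduct_lmExact _ τ) σ
  have e1 := dotProduct_LMadj_mulVec hx f
  simp only [hvf] at e1
  rw [sum_lmUp_dotProduct_sub_lmExact_sq hn] at e1
  have e2 := dotProduct_self_eq_lmExact_add hn f
  have b1 := (abs_le.1 (hdiag g)).2
  have b2 := (abs_le.1 (hup h)).1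
  have b3 := hsq g
  simp only [hgg'] at b1 b3
  have g0 := dotProduct_self_nonneg_real g
  have h0 := dotProduct_self_nonneg_real h
  rw [← hh, ← hg] at e2
  rw [← hh] at e1
  have hM : 0 < 7 / 8 * ((n : ℝ) * p) := by positivity
  have b4 : ∑ σ, lmDegree x σ * f σ ^ 2 ≤ ∑ σ, lmDegree x σ * g σ ^ 2 +
      (7 / 8 * (n * p))⁻¹ * ∑ σ, lmDegree x σ ^ 2 * g σ ^ 2 +
      (7 / 8 * (n * p) + n * p / 16) * (h ⬝ᵥ h) := by
    rw [dotProduct, Finset.mul_sum, Finset.mul_sum, ← Finset.sum_add_distrib,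
      ← Finset.sum_add_distrib]
    refine Finset.sum_le_sum fun σ _ => ?_
    have hf : f σ = g σ + h σ := by simp [hh, hg]
    have c1 : lmDegree x σ * h σ ^ 2 ≤ n * p / 16 * h σ ^ 2 :=
      mul_le_mul_of_nonneg_right ((le_abs_self _).trans (hdeg σ)) (sq_nonneg _)
    have c2 : 2 * (lmDegree x σ * g σ * h σ) ≤ (7 / 8 * (n * p))⁻¹ * (lmDegree x σ ^ 2 * g σ ^ 2) +
        7 / 8 * (n * p) * h σ ^ 2 := by
      set M := 7 / 8 * ((n : ℝ) * p)
      have : 0 ≤ M⁻¹ * (lmDegree x σ * g σ - M * h σ) ^ 2 := by positivity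
      have e3 : M⁻¹ * (lmDegree x σ * g σ - M * h σ) ^ 2 =
          M⁻¹ * (lmDegree x σ ^ 2 * g σ ^ 2) + M * h σ ^ 2 - 2 * (lmDegree x σ * g σ * h σ) := by
        field_simp
        ring
      linarith
    rw [hf]
    nlinarith
  have b5 : (7 / 8 * (n * p))⁻¹ * ∑ σ, lmDegree x σ ^ 2 * g σ ^ 2 ≤
      40 / 7 * (e + 1) * (g ⬝ᵥ g) := by
    refine (mul_le_mul_of_nonneg_left b3 (inv_nonneg.2 hM.le)).trans (le_of_eq ?_)
    field_simp
    ring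
  rw [e1]
  have he : (0 : ℝ) ≤ e := Nat.cast_nonneg _
  have c3 : 0 ≤ p * ((e + 1) * (f ⬝ᵥ f)) := by
    have := dotProduct_self_nonneg_real f
    positivity
  have c4 : 0 ≤ (e : ℝ) * (g ⬝ᵥ g) := by positivity
  have c5 : 0 ≤ (e : ℝ) * (h ⬝ᵥ h) := by positivity
  have e2' : p * n * (f ⬝ᵥ f) = p * n * (g ⬝ᵥ g) + p * n * (h ⬝ᵥ h) := by rw [e2]; ring
  rw [e2]
  rw [e2] at c3
  nlinarith

theorem LMeig_LMadj_mem_Icc (hn : 0 < n) {X : Set (Finset ℕ)} {p : ℝ} (hp : 0 < p)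
    (hp1 : p ≤ 1) {x : LMCell n (e + 2) → ℝ}
    (hx : ∀ τ, x τ = X.indicator (fun _ => 1) τ.1 - p)
    (hdiag : ∀ f, |∑ σ, lmDegree x σ * (lmProj σ ⬝ᵥ f) ^ 2| ≤ f ⬝ᵥ f)
    (hup : ∀ f : LMCell n (e + 1) → ℝ, |∑ τ, x τ * (lmUp τ ⬝ᵥ f) ^ 2| ≤ (n * p / 16) * (f ⬝ᵥ f))
    (hdeg : ∀ σ : LMCell n (e + 1), |lmDegree x σ| ≤ n * p / 16)
    (hsq : ∀ f, ∑ σ : LMCell n (e + 1), lmDegree x σ ^ 2 * (lmProj σ ⬝ᵥ f) ^ 2 ≤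
      (5 * (e + 1) * (n * p)) * (f ⬝ᵥ f))
    {i : ℕ} (hi : (n - 1).choose (e + 1) ≤ i) (hi' : i < n.choose (e + 1)) :
    LMeig (LMadj n (e + 1) X) i ∈
      Set.Icc ((n : ℝ) * p - 7 * (e + 1)) ((n : ℝ) * p + 7 * (e + 1)) := by
  have hcard := LMCell.card_fintype n (e + 1)
  refine ⟨?_, LMeig_le (LMadj_isSymm _ _ _)
    (dotProduct_LMadj_mulVec_le hn hp hx hdiag hup hdeg hsq) (by rwa [hcard])⟩
  refine le_LMeig (LMadj_isSymm _ _ _) (LinearMap.range (lmExactLinear n e)) ?_ ?_ (by rwa [hcard])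
  · rintro g ⟨f, rfl⟩
    refine le_trans ?_ (dotProduct_LMadj_mulVec_ge hn hp1 hx hdiag
      fun τ => lmUp_dotProduct_lmExact f τ)
    refine mul_le_mul_of_nonneg_right ?_ (dotProduct_self_nonneg_real _)
    have : (0 : ℝ) ≤ e := Nat.cast_nonneg _
    linarith
  · have := finrank_range_lmExactLinear (n := n) (e := e) hn
    rw [hcard]
    omega

end AdjacencyForm

section RandomComplex

open Matrix

variable {n e : ℕ}

/-- The sum of `x` over the cells whose face opposite to the `j`-th vertex is `σ`. -/
def lmFiberSum {d : ℕ} (j : Fin (d + 1)) (x : LMCell n (d + 1) → ℝ) (σ : LMCell n d) : ℝ :=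
  ∑ τ ∈ Finset.univ.filter (fun τ => lmFace j τ = σ), x τ

theorem lmDegree_eq_sum_lmFiberSum {d : ℕ} (x : LMCell n (d + 1) → ℝ) (σ : LMCell n d) :
    lmDegree x σ = ∑ j, lmFiberSum j x σ := by
  simp only [lmDegree, ← sum_ite_lmFace_eq, lmFiberSum, Finset.sum_filter, Finset.mul_sum]
  rw [Finset.sum_comm]
  simp

theorem sum_lmFiberSum_mul {d : ℕ} (j : Fin (d + 1)) (x : LMCell n (d + 1) → ℝ)
    (w : LMCell n d → ℝ) :
    ∑ σ, lmFiberSum j x σ * w σ = ∑ τ, x τ * w (lmFace j τ) := by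
  simp only [lmFiberSum, Finset.sum_mul, Finset.sum_filter]
  rw [Finset.sum_comm]
  simp

theorem sum_lmFiberSum_one {d : ℕ} (σ : LMCell n d) :
    ∑ j : Fin (d + 1), lmFiberSum j (fun _ => (1 : ℝ)) σ = n - d := by
  rw [← lmDegree_eq_sum_lmFiberSum, lmDegree, ← card_cofaces σ]
  simp

theorem lmFiberSum_one_nonneg {d : ℕ} (j : Fin (d + 1)) (σ : LMCell n d) :
    0 ≤ lmFiberSum j (fun _ => (1 : ℝ)) σ := by
  simp [lmFiberSum]

theorem lmFiberSum_one_le {d : ℕ} (j : Fin (d + 1)) (σ : LMCell n d) :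
    lmFiberSum j (fun _ => (1 : ℝ)) σ ≤ n := by
  have h1 := sum_lmFiberSum_one σ
  have h2 := Finset.single_le_sum (f := fun j => lmFiberSum j (fun _ => (1 : ℝ)) σ)
    (fun j _ => lmFiberSum_one_nonneg j σ) (Finset.mem_univ j)
  have : (0 : ℝ) ≤ d := Nat.cast_nonneg _
  linarith

theorem sum_lmProj_lmFace_sq_le (hn : 0 < n) (j : Fin (e + 1 + 1)) (f : LMCell n (e + 1) → ℝ) :
    ∑ τ, (lmProj (lmFace j τ) ⬝ᵥ f) ^ 2 ≤ n * (f ⬝ᵥ f) := by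
  have h := sum_lmFiberSum_mul j (fun _ => (1 : ℝ)) (fun σ => (lmProj σ ⬝ᵥ f) ^ 2)
  simp only [one_mul] at h
  rw [← h]
  refine le_trans ?_ (mul_le_mul_of_nonneg_left (sum_lmProj_dotProduct_sq_le hn f)
    (Nat.cast_nonneg n))
  rw [Finset.mul_sum]
  exact Finset.sum_le_sum fun σ _ =>
    mul_le_mul_of_nonneg_right (lmFiberSum_one_le j σ) (sq_nonneg _)

/-- The centred indicators of the cells of the random complex. -/
def lmNoise {d : ℕ} (p : ℝ) (z : LMCell n d → Bool) (τ : LMCell n d) : ℝ := bernCentered p (z τ)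

theorem bernE_lmFiberSum_sq {d : ℕ} (p : ℝ) (j : Fin (d + 1)) (σ : LMCell n d) :
    bernE p (fun z => lmFiberSum j (lmNoise p z) σ ^ 2) =
      p * (1 - p) * lmFiberSum j (fun _ => (1 : ℝ)) σ := by
  have := bernE_sum_centered_sq p
    (Finset.univ.filter (fun τ : LMCell n (d + 1) => lmFace j τ = σ))
  simp only [lmFiberSum, lmNoise, Finset.sum_const, nsmul_eq_mul, mul_one]
  exact this

/-- The properties of a random complex that force the confinement of its large eigenvalues. -/
structure LMRegular (p : ℝ) (x : LMCell n (e + 2) → ℝ) : Prop where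
  diag : ∀ f, |∑ σ, lmDegree x σ * (lmProj σ ⬝ᵥ f) ^ 2| ≤ f ⬝ᵥ f
  up : ∀ f : LMCell n (e + 1) → ℝ, |∑ τ, x τ * (lmUp τ ⬝ᵥ f) ^ 2| ≤ (n * p / 16) * (f ⬝ᵥ f)
  deg : ∀ σ : LMCell n (e + 1), |lmDegree x σ| ≤ n * p / 16
  sq : ∀ f, ∑ σ : LMCell n (e + 1), lmDegree x σ ^ 2 * (lmProj σ ⬝ᵥ f) ^ 2 ≤
      (5 * (e + 1) * (n * p)) * (f ⬝ᵥ f)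

theorem bernP_diag_le (hn : 0 < n) {p : ℝ} (h0 : 0 ≤ p) (h1 : p ≤ 1) {k : ℕ} (hk : 1 ≤ k)
    (hq : 72 * k * (e + 1) * (e + 2) ^ 2 * (p * (1 - p)) ≤ 1)
    (hN : 2592 * k ^ 2 * (e + 1) * (e + 2) ^ 2 ≤ (n : ℝ)) (j : Fin (e + 1 + 1)) :
    bernP p {z : LMCell n (e + 2) → Bool | ∃ f : LMCell n (e + 1) → ℝ, 1 / (e + 2) * (f ⬝ᵥ f) <
      |∑ τ, bernCentered p (z τ) * (lmProj (lmFace j τ) ⬝ᵥ f) ^ 2|} ≤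
      10 * (n.choose (e + 1)) ^ 2 * Real.exp (-k) := by
  have hn' : (0 : ℝ) < n := by positivity
  have hk' : (1 : ℝ) ≤ k := by exact_mod_cast hk
  have h := bernP_bernoulli_quadratic_form_deviation_le h0 h1 (ρ := (e + 1) / n) (m := n)
    (a := 1 / (e + 2)) (fun τ : LMCell n (e + 2) => lmProj (lmFace j τ))
    (fun τ => (lmProj_dotProduct_lmProj hn _).le) (by positivity) (by positivity)
    (sum_lmProj_lmFace_sq_le hn j) k hk (by positivity) ?_ ?_
  · rwa [LMCell.card_fintype] at h
  · rw [le_div_iff₀ (by positivity), mul_div_assoc', div_mul_eq_mul_div, div_le_one hn']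
    refine le_trans ?_ hN
    have : (0 : ℝ) ≤ e := Nat.cast_nonneg _
    have e1 : (11 : ℝ) * k * (e + 1) * (e + 2) ≤ 2592 * (k * k) * (e + 1) * ((e + 2) * (e + 2)) := by
      have a1 : (k : ℝ) ≤ k * k := by nlinarith
      have a2 : ((e : ℝ) + 2) ≤ (e + 2) * (e + 2) := by nlinarith
      gcongr
      norm_num
    linarith [e1]
  · have e1 : 72 * (k : ℝ) * ((e + 1) / n) * (p * (1 - p) * n) =
        72 * k * (e + 1) * (p * (1 - p)) := by field_simp
    rw [e1, div_pow, one_pow, le_div_iff₀ (by positivity)]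
    linarith

theorem bernP_up_le (hn : 0 < n) {p : ℝ} (h0 : 0 ≤ p) (h1 : p ≤ 1) {k : ℕ} (hk : 1 ≤ k)
    (hp : 72 * 256 * (e + 2) ^ 2 * k ≤ (n : ℝ) * p) :
    bernP p {z : LMCell n (e + 2) → Bool | ∃ f : LMCell n (e + 1) → ℝ, n * p / 16 * (f ⬝ᵥ f) <
      |∑ τ, bernCentered p (z τ) * (lmUp τ ⬝ᵥ f) ^ 2|} ≤
      10 * (n.choose (e + 1)) ^ 2 * Real.exp (-k) := by
  have hn' : (0 : ℝ) < n := by positivity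
  have hk' : (1 : ℝ) ≤ k := by exact_mod_cast hk
  have he : (0 : ℝ) ≤ e := Nat.cast_nonneg _
  have hp2 : 72 * 256 * ((e : ℝ) + 2) * k ≤ n * p := by
    refine le_trans ?_ hp
    have : (0 : ℝ) ≤ k * (e + 1) * (e + 2) := by positivity
    nlinarith
  have hnp : 0 < (n : ℝ) * p := lt_of_lt_of_le (by positivity) hp2
  have h := bernP_bernoulli_quadratic_form_deviation_le h0 h1 (ρ := e + 2) (m := n)
    (a := n * p / 16) (fun τ : LMCell n (e + 2) => lmUp τ)
    (fun τ => (lmUp_dotProduct_lmUp τ).le) (by positivity) (by positivity)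
    sum_lmUp_dotProduct_sq_le k hk (by positivity) ?_ ?_
  · rwa [LMCell.card_fintype] at h
  · have : 0 ≤ (k : ℝ) * (e + 2) := by positivity
    linarith
  · have e1 : p * (1 - p) * n ≤ n * p := by nlinarith
    calc 72 * (k : ℝ) * (e + 2) * (p * (1 - p) * n) ≤ 72 * (k : ℝ) * (e + 2) * (n * p) := by gcongr
      _ ≤ (n * p / 256) * (n * p) := by gcongr; linarith
      _ = _ := by ring

theorem bernP_lmFiberSum_le (hn : 0 < n) {p : ℝ} (h0 : 0 ≤ p) (h1 : p ≤ 1) {k : ℕ} (hk : 1 ≤ k)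
    (hq : 2 * k ≤ (n : ℝ) * (p * (1 - p))) {d : ℕ} (j : Fin (d + 1)) (σ : LMCell n d) :
    bernP p {z : LMCell n (d + 1) → Bool |
      72 * k * (p * (1 - p) * n) < lmFiberSum j (lmNoise p z) σ ^ 2} ≤ 10 * Real.exp (-k) := by
  have hn' : (0 : ℝ) < n := by positivity
  have hk' : (1 : ℝ) ≤ k := by exact_mod_cast hk
  have ht : 0 < 72 * k * (p * (1 - p) * n) := by
    have : 0 < p * (1 - p) * n := by linarith
    positivity
  have h := bernP_bernoulli_quadratic_form_deviation_le h0 h1 (ρ := 1) (m := n)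
    (a := √(72 * k * (p * (1 - p) * n)))
    (fun (τ : LMCell n (d + 1)) (_ : Unit) => if lmFace j τ = σ then (1 : ℝ) else 0)
    (fun τ => by simp only [dotProduct]; split_ifs <;> simp) (by positivity) (by positivity)
    ?_ k hk (Real.sqrt_pos.2 ht) ?_ ?_
  · simp only [Fintype.card_unit, Nat.cast_one, one_pow, mul_one] at h
    refine le_trans (bernP_mono h0 h1 ?_) h
    intro z hz
    refine ⟨fun _ => 1, ?_⟩
    have e1 : ∑ τ, bernCentered p (z τ) *
        ((fun _ : Unit => if lmFace j τ = σ then (1 : ℝ) else 0) ⬝ᵥ fun _ => 1) ^ 2 =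
        lmFiberSum j (lmNoise p z) σ := by
      simp only [dotProduct, lmFiberSum, Finset.sum_filter, lmNoise]
      refine Finset.sum_congr rfl fun τ _ => ?_
      split_ifs <;> simp
    rw [e1]
    have := Real.sqrt_lt_sqrt ht.le hz
    rw [Real.sqrt_sq_eq_abs] at this
    simpa [dotProduct] using this
  · intro f
    have h2 := lmFiberSum_one_le j σ
    simp only [lmFiberSum, Finset.sum_filter] at h2
    calc _ = ∑ τ : LMCell n (d + 1), (if lmFace j τ = σ then (1 : ℝ) else 0) * (f ⬝ᵥ f) := by
          refine Finset.sum_congr rfl fun τ _ => ?_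
          simp only [dotProduct]
          split_ifs <;> simp [sq]
      _ ≤ _ := by
          rw [← Finset.sum_mul]
          exact mul_le_mul_of_nonneg_right h2 (dotProduct_self_nonneg_real f)
  · refine Real.le_sqrt_of_sq_le ?_
    nlinarith
  · rw [Real.sq_sqrt ht.le]; linarith

theorem bernP_truncated_lmFiberSum_le (hn : 0 < n) {p : ℝ} (h0 : 0 ≤ p) (h1 : p ≤ 1) {k : ℕ}
    (hk : 1 ≤ k) (hq : 2 * k ≤ (n : ℝ) * (p * (1 - p)))
    (hN : 2592 * k ^ 2 * (e + 1) * (e + 2) ^ 2 ≤ (n : ℝ)) (j : Fin (e + 1 + 1)) :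
    bernP p {z : LMCell n (e + 2) → Bool | ∃ f : LMCell n (e + 1) → ℝ,
      p * (1 - p) * n / (e + 2) * (f ⬝ᵥ f) <
      |∑ σ, (min (lmFiberSum j (lmNoise p z) σ ^ 2) (72 * k * (p * (1 - p) * n)) -
        bernE p (fun z => min (lmFiberSum j (lmNoise p z) σ ^ 2) (72 * k * (p * (1 - p) * n)))) *
        (lmProj σ ⬝ᵥ f) ^ 2|} ≤
      10 * (n.choose (e + 1)) ^ 2 * Real.exp (-k) := by
  have hn' : (0 : ℝ) < n := by positivity
  have hk' : (1 : ℝ) ≤ k := by exact_mod_cast hk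
  have he : (0 : ℝ) ≤ e := Nat.cast_nonneg _
  have hqn : 0 < p * (1 - p) * n := by linarith
  have hq0 : 0 ≤ p * (1 - p) := mul_nonneg h0 (by linarith)
  have ht : 0 ≤ 72 * k * (p * (1 - p) * n) := by positivity
  have h := bernP_quadratic_form_deviation_le h0 h1 (lmFace j : LMCell n (e + 2) → LMCell n (e + 1))
    (fun σ z => min (lmFiberSum j (lmNoise p z) σ ^ 2) (72 * k * (p * (1 - p) * n)))
    ?_ (t := 72 * k * (p * (1 - p) * n)) (ρ := (e + 1) / n) (m := p * (1 - p) * n)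
    (a := p * (1 - p) * n / (e + 2)) (fun σ z => le_min (sq_nonneg _) ht)
    (fun σ z => min_le_right _ _) ht lmProj (fun σ => (lmProj_dotProduct_lmProj hn σ).le)
    (by positivity) hqn.le ?_ k hk (by positivity) ?_ ?_
  · rwa [LMCell.card_fintype] at h
  · intro σ z z' hz
    congr 2
    refine Finset.sum_congr rfl fun τ hτ => ?_
    rw [lmNoise, lmNoise, hz τ (Finset.mem_filter.1 hτ).2]
  · intro f
    refine le_trans ?_ (mul_le_mul_of_nonneg_left (sum_lmProj_dotProduct_sq_le hn f) hqn.le)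
    rw [Finset.mul_sum]
    refine Finset.sum_le_sum fun σ _ => mul_le_mul_of_nonneg_right ?_ (sq_nonneg _)
    refine (bernE_mono h0 h1 fun z => min_le_left _ _).trans ?_
    rw [bernE_lmFiberSum_sq]
    exact mul_le_mul_of_nonneg_left (lmFiberSum_one_le j σ) hq0
  · have e1 : 11 * (k : ℝ) * (72 * k * (p * (1 - p) * n) * ((e + 1) / n)) =
        (792 * k ^ 2 * (e + 1)) / n * (p * (1 - p) * n) := by field_simp; ring
    rw [e1, div_eq_inv_mul (p * (1 - p) * n)]
    refine mul_le_mul_of_nonneg_right ?_ hqn.le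
    rw [div_le_iff₀ hn', inv_mul_eq_div, le_div_iff₀ (by positivity)]
    refine le_trans ?_ hN
    have a2 : ((e : ℝ) + 2) ≤ (e + 2) ^ 2 := by nlinarith
    gcongr
    norm_num
  · have e1 : 36 * (k : ℝ) * (72 * k * (p * (1 - p) * n) * ((e + 1) / n)) * (p * (1 - p) * n) =
        (2592 * k ^ 2 * (e + 1)) / n * (p * (1 - p) * n) ^ 2 := by field_simp; ring
    rw [e1, div_pow, div_eq_inv_mul (_ ^ 2)]
    refine mul_le_mul_of_nonneg_right ?_ (sq_nonneg _)
    rw [div_le_iff₀ hn', inv_mul_eq_div, le_div_iff₀ (by positivity)]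
    exact hN

end RandomComplex

section RegularComplex

open Matrix

variable {n e : ℕ}

theorem lmDegree_sq_le {d : ℕ} (x : LMCell n (d + 1) → ℝ) (σ : LMCell n d) :
    lmDegree x σ ^ 2 ≤ (d + 1) * ∑ j, lmFiberSum j x σ ^ 2 := by
  rw [lmDegree_eq_sum_lmFiberSum]
  have := sq_sum_le_card_mul_sum_sq (s := Finset.univ) (f := fun j => lmFiberSum j x σ)
  simpa using this

theorem LMRegular.of_lmFiberSum {p : ℝ} (hn : 0 < n) (h0 : 0 ≤ p) (h1 : p ≤ 1) {k : ℕ}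
    (hp : 72 * 256 * (e + 2) ^ 2 * k ≤ (n : ℝ) * p)
    {z : LMCell n (e + 2) → Bool}
    (hdiag : ∀ (j : Fin (e + 1 + 1)) (f : LMCell n (e + 1) → ℝ),
      |∑ τ, bernCentered p (z τ) * (lmProj (lmFace j τ) ⬝ᵥ f) ^ 2| ≤ 1 / (e + 2) * (f ⬝ᵥ f))
    (hup : ∀ f : LMCell n (e + 1) → ℝ,
      |∑ τ, bernCentered p (z τ) * (lmUp τ ⬝ᵥ f) ^ 2| ≤ n * p / 16 * (f ⬝ᵥ f))
    (hfib : ∀ (j : Fin (e + 1 + 1)) (σ : LMCell n (e + 1)),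
      lmFiberSum j (lmNoise p z) σ ^ 2 ≤ 72 * k * (p * (1 - p) * n))
    (htr : ∀ (j : Fin (e + 1 + 1)) (f : LMCell n (e + 1) → ℝ),
      |∑ σ, (min (lmFiberSum j (lmNoise p z) σ ^ 2) (72 * k * (p * (1 - p) * n)) -
        bernE p (fun z => min (lmFiberSum j (lmNoise p z) σ ^ 2) (72 * k * (p * (1 - p) * n)))) *
        (lmProj σ ⬝ᵥ f) ^ 2| ≤ p * (1 - p) * n / (e + 2) * (f ⬝ᵥ f)) :
    LMRegular (e := e) p (lmNoise p z) := by
  have he : (0 : ℝ) ≤ e := Nat.cast_nonneg _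
  have hn' : (0 : ℝ) < n := by positivity
  have hq0 : 0 ≤ p * (1 - p) := mul_nonneg h0 (by linarith)
  have hqp : p * (1 - p) * n ≤ n * p := by
    rw [mul_comm (n : ℝ)]
    exact mul_le_mul_of_nonneg_right (by nlinarith) hn'.le
  have hqn0 : 0 ≤ p * (1 - p) * n := by positivity
  have hcard : ∀ c : ℝ, ∑ _j : Fin (e + 1 + 1), c = (e + 2) * c := by
    intro c
    rw [Finset.sum_const, Finset.card_univ, Fintype.card_fin, nsmul_eq_mul]
    push_cast; ring
  refine ⟨fun f => ?_, hup, fun σ => ?_, fun f => ?_⟩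
  · have e1 : ∑ σ, lmDegree (lmNoise p z) σ * (lmProj σ ⬝ᵥ f) ^ 2 =
        ∑ j : Fin (e + 1 + 1), ∑ τ, bernCentered p (z τ) * (lmProj (lmFace j τ) ⬝ᵥ f) ^ 2 := by
      simp only [lmDegree_eq_sum_lmFiberSum, Finset.sum_mul]
      rw [Finset.sum_comm]
      exact Finset.sum_congr rfl fun j _ =>
        sum_lmFiberSum_mul j (lmNoise p z) fun σ => (lmProj σ ⬝ᵥ f) ^ 2
    rw [e1]
    refine (Finset.abs_sum_le_sum_abs _ _).trans
      ((Finset.sum_le_sum fun j _ => hdiag j f).trans (le_of_eq ?_))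
    rw [hcard]
    field_simp
  · refine abs_le_of_sq_le_sq ?_ (by positivity)
    refine (lmDegree_sq_le _ σ).trans ?_
    have e1 : ∑ j : Fin (e + 1 + 1), lmFiberSum j (lmNoise p z) σ ^ 2 ≤
        (e + 2) * (72 * k * (n * p)) := by
      rw [← hcard]
      refine Finset.sum_le_sum fun j _ => (hfib j σ).trans ?_
      gcongr
    have hnp : 0 ≤ (n : ℝ) * p := by positivity
    calc _ ≤ (((e + 1 : ℕ) : ℝ) + 1) * ((e + 2) * (72 * k * (n * p))) := by gcongr
      _ = (72 * 256 * (e + 2) ^ 2 * k) * (n * p) / 256 := by push_cast; ring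
      _ ≤ (n * p) * (n * p) / 256 := by gcongr
      _ = _ := by ring
  · set t := 72 * k * (p * (1 - p) * n) with ht
    set F := f ⬝ᵥ f with hF
    have hF0 : 0 ≤ F := dotProduct_self_nonneg_real f
    have hj : ∀ j : Fin (e + 1 + 1),
        ∑ σ : LMCell n (e + 1), lmFiberSum j (lmNoise p z) σ ^ 2 * (lmProj σ ⬝ᵥ f) ^ 2 ≤
        p * (1 - p) * n / (e + 2) * F +
        ∑ σ, p * (1 - p) * lmFiberSum j (fun _ => (1 : ℝ)) σ * (lmProj σ ⬝ᵥ f) ^ 2 := by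
      intro j
      have a1 := (abs_le.1 (htr j f)).2
      simp only [sub_mul, Finset.sum_sub_distrib, min_eq_left (hfib j _)] at a1
      have a2 : ∑ σ : LMCell n (e + 1),
          bernE p (fun z => min (lmFiberSum j (lmNoise p z) σ ^ 2) t) * (lmProj σ ⬝ᵥ f) ^ 2 ≤
          ∑ σ, p * (1 - p) * lmFiberSum j (fun _ => (1 : ℝ)) σ * (lmProj σ ⬝ᵥ f) ^ 2 := by
        refine Finset.sum_le_sum fun σ _ => mul_le_mul_of_nonneg_right ?_ (sq_nonneg _)
        rw [← bernE_lmFiberSum_sq]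
        exact bernE_mono h0 h1 fun z => min_le_left _ _
      linarith
    have hall : ∑ j : Fin (e + 1 + 1),
        ∑ σ : LMCell n (e + 1), lmFiberSum j (lmNoise p z) σ ^ 2 * (lmProj σ ⬝ᵥ f) ^ 2 ≤
        2 * (p * (1 - p) * n) * F := by
      refine (Finset.sum_le_sum fun j _ => hj j).trans ?_
      rw [Finset.sum_add_distrib, hcard, Finset.sum_comm]
      have a3 : ∑ σ : LMCell n (e + 1), ∑ j : Fin (e + 1 + 1),
          p * (1 - p) * lmFiberSum j (fun _ => (1 : ℝ)) σ * (lmProj σ ⬝ᵥ f) ^ 2 ≤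
          p * (1 - p) * n * F := by
        refine le_trans ?_ (mul_le_mul_of_nonneg_left (sum_lmProj_dotProduct_sq_le hn f) hqn0)
        rw [Finset.mul_sum]
        refine Finset.sum_le_sum fun σ _ => ?_
        rw [← Finset.sum_mul, ← Finset.mul_sum, sum_lmFiberSum_one]
        refine mul_le_mul_of_nonneg_right (mul_le_mul_of_nonneg_left ?_ hq0) (sq_nonneg _)
        push_cast; linarith
      have a4 : ((e : ℝ) + 2) * (p * (1 - p) * n / (e + 2) * F) = p * (1 - p) * n * F := by
        field_simp
      linarith
    calc _ ≤ ∑ σ, ((((e + 1 : ℕ) : ℝ) + 1) * ∑ j, lmFiberSum j (lmNoise p z) σ ^ 2) *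
          (lmProj σ ⬝ᵥ f) ^ 2 := Finset.sum_le_sum fun σ _ =>
            mul_le_mul_of_nonneg_right (lmDegree_sq_le _ σ) (sq_nonneg _)
      _ = (e + 2) * ∑ j : Fin (e + 1 + 1), ∑ σ : LMCell n (e + 1),
          lmFiberSum j (lmNoise p z) σ ^ 2 * (lmProj σ ⬝ᵥ f) ^ 2 := by
        rw [Finset.sum_comm, Finset.mul_sum]
        refine Finset.sum_congr rfl fun σ _ => ?_
        rw [mul_assoc, Finset.sum_mul]; push_cast; ring
      _ ≤ (e + 2) * (2 * (p * (1 - p) * n) * F) := by gcongr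
      _ ≤ (e + 2) * (2 * (n * p) * F) := by gcongr
      _ ≤ _ := by
        have : 0 ≤ (n : ℝ) * p * F := by positivity
        have : 0 ≤ e * ((n : ℝ) * p * F) := by positivity
        nlinarith

theorem bernP_not_LMRegular_le (he : e + 2 ≤ n) {p : ℝ} (h0 : 0 ≤ p) (h1 : p ≤ 1) {k : ℕ}
    (hk : 1 ≤ k) (hqn : 2 * k ≤ (n : ℝ) * (p * (1 - p)))
    (hp : 72 * 256 * (e + 2) ^ 2 * k ≤ (n : ℝ) * p)
    (hq : 72 * k * (e + 1) * (e + 2) ^ 2 * (p * (1 - p)) ≤ 1)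
    (hN : 2592 * k ^ 2 * (e + 1) * (e + 2) ^ 2 ≤ (n : ℝ)) :
    bernP p {z : LMCell n (e + 2) → Bool | ¬ LMRegular (e := e) p (lmNoise p z)} ≤
      40 * (e + 2) * (n.choose (e + 1)) ^ 3 * Real.exp (-k) := by
  have hn : 0 < n := by omega
  set N : ℝ := (n.choose (e + 1) : ℝ) with hNdef
  have hN1 : 1 ≤ N := by
    have : 0 < n.choose (e + 1) := Nat.choose_pos (by omega)
    rw [hNdef]
    exact_mod_cast this
  have hcard : ∀ c : ℝ, ∑ _j : Fin (e + 1 + 1), c = (e + 2) * c := by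
    intro c
    rw [Finset.sum_const, Finset.card_univ, Fintype.card_fin, nsmul_eq_mul]
    push_cast; ring
  refine (bernP_mono h0 h1 (fun z hz => ?_)).trans
    ((bernP_union_le h0 h1 _ _).trans ((add_le_add ((bernP_union_le h0 h1 _ _).trans
    (add_le_add ((bernP_iUnion_le h0 h1 _).trans
      (Finset.sum_le_sum fun j _ => bernP_diag_le hn h0 h1 hk hq hN j))
      (bernP_up_le hn h0 h1 hk hp)))
    ((bernP_union_le h0 h1 _ _).trans (add_le_add
      ((bernP_iUnion_le h0 h1 _).trans (Finset.sum_le_sum fun j _ =>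
        (bernP_iUnion_le h0 h1 _).trans (Finset.sum_le_sum fun σ _ =>
          bernP_lmFiberSum_le hn h0 h1 hk hqn (d := e + 1) j σ)))
      ((bernP_iUnion_le h0 h1 _).trans (Finset.sum_le_sum fun j _ =>
        bernP_truncated_lmFiberSum_le hn h0 h1 hk hqn hN j))))).trans ?_))
  · by_contra hc
    simp only [Set.mem_union, Set.mem_iUnion, Set.mem_ofPred_eq, not_or, not_exists, not_lt] at hc
    exact hz (LMRegular.of_lmFiberSum hn h0 h1 hp hc.1.1 hc.1.2 hc.2.1 hc.2.2)
  · simp only [hcard, Finset.sum_const, Finset.card_univ, LMCell.card_fintype, nsmul_eq_mul,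
      ← hNdef]
    have hE := Real.exp_pos (-(k : ℝ))
    set E := Real.exp (-(k : ℝ))
    have he' : (0 : ℝ) ≤ e := Nat.cast_nonneg _
    have hN2 : N ^ 2 ≤ N ^ 3 := pow_le_pow_right₀ hN1 (by norm_num)
    have hN3 : N ≤ N ^ 3 := le_self_pow₀ hN1 (by norm_num)
    have a1 : N ^ 2 * E ≤ N ^ 3 * E := by gcongr
    have a2 : N * E ≤ N ^ 3 * E := by gcongr
    have a3 : e * (N ^ 2 * E) ≤ e * (N ^ 3 * E) := by gcongr
    have a4 : e * (N * E) ≤ e * (N ^ 3 * E) := by gcongr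
    have a5 : 0 ≤ N ^ 3 * E := by positivity
    have a6 : 0 ≤ e * (N ^ 3 * E) := by positivity
    linarith

end RegularComplex

section Confinement

open Matrix

theorem bernP_not_LMRegular_le_rpow {n e : ℕ} (he1 : 1 ≤ e) (he : e + 2 ≤ n) {p D : ℝ} (h0 : 0 ≤ p)
    (h1 : p ≤ 1) (hD : 0 < D)
    (hl : 165888 * ((e : ℝ) + 3) ^ 5 * (1 + D) ^ 4 * (Real.log n) ^ 4 ≤ n * (p * (1 - p)))
    (hu : p * (1 - p) * (Real.log n) ^ 6 ≤ 1 / (165888 * ((e : ℝ) + 3) ^ 5 * (1 + D) ^ 6)) :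
    bernP p {z : LMCell n (e + 2) → Bool | ¬ LMRegular (e := e) p (lmNoise p z)} ≤
      (n : ℝ) ^ (-D) := by
  have hn3 : (3 : ℝ) ≤ n := by exact_mod_cast (by omega : 3 ≤ n)
  have hn0 : (0 : ℝ) < n := by linarith
  have hlog : 1 ≤ Real.log n := by
    rw [Real.le_log_iff_exp_le hn0]
    exact Real.exp_one_lt_d9.le.trans (le_trans (by norm_num) hn3)
  have he0 : (0 : ℝ) ≤ e := Nat.cast_nonneg _
  set a : ℝ := (e : ℝ) + 3 with ha
  set K : ℝ := (1 + D) * Real.log n with hK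
  set q : ℝ := p * (1 - p) with hq
  have hq0 : 0 ≤ q := mul_nonneg h0 (by linarith)
  have hK1 : 1 ≤ K := by nlinarith
  have ha3 : 3 ≤ a := by linarith
  have hl' : 165888 * a ^ 5 * K ^ 4 ≤ n * q := by
    refine le_trans (le_of_eq ?_) hl
    rw [hK]; ring
  have hu' : q * K ^ 6 * (165888 * a ^ 5) ≤ 1 := by
    rw [le_div_iff₀ (by positivity)] at hu
    refine le_trans (le_of_eq ?_) hu
    rw [hK]; ring
  set k : ℕ := ⌈(D + (3 * e + 8)) * Real.log n⌉₊ with hk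
  have hkl : (D + (3 * e + 8)) * Real.log n ≤ k := Nat.le_ceil _
  have hk0 : 1 ≤ k := by
    have : (1 : ℝ) ≤ k := le_trans (by nlinarith) hkl
    exact_mod_cast this
  have hku : (k : ℝ) ≤ 3 * a * K := by
    have h := (Nat.ceil_lt_add_one (a := (D + (3 * e + 8)) * Real.log n) (by positivity)).le
    rw [← hk] at h
    have : 3 * a * K = (D + (3 * e + 9)) * Real.log n + (3 * e + 8) * D * Real.log n := by
      rw [ha, hK]; ring
    have h2 : 0 ≤ (3 * e + 8) * D * Real.log n := by positivity
    linarith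
  have hea1 : (e : ℝ) + 1 ≤ a := by linarith
  have hea2 : (e : ℝ) + 2 ≤ a := by linarith
  have hk0' : (0 : ℝ) ≤ k := Nat.cast_nonneg _
  have ha0 : (0 : ℝ) ≤ a := by linarith
  have hK0 : (0 : ℝ) ≤ K := by linarith
  have hpa : ∀ i : ℕ, i ≤ 5 → a ^ i ≤ a ^ 5 := fun i hi => pow_le_pow_right₀ (by linarith) hi
  have hpK : ∀ i j : ℕ, i ≤ j → K ^ i ≤ K ^ j := fun i j hi => pow_le_pow_right₀ hK1 hi
  have hqp : q ≤ p := by rw [hq]; nlinarith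
  have hq1 : q ≤ 1 := hqp.trans h1
  have c1 : 2 * k ≤ (n : ℝ) * q := by
    calc 2 * (k : ℝ) ≤ 2 * (3 * a * K) := by gcongr
      _ = 6 * a ^ 1 * K ^ 1 := by ring
      _ ≤ 165888 * a ^ 5 * K ^ 4 := by
        gcongr ?_ * ?_ * ?_
        · norm_num
        · exact hpa 1 (by norm_num)
        · exact hpK 1 4 (by norm_num)
      _ ≤ _ := hl'
  have c2 : 72 * 256 * ((e : ℝ) + 2) ^ 2 * k ≤ n * p := by
    calc 72 * 256 * ((e : ℝ) + 2) ^ 2 * k ≤ 72 * 256 * a ^ 2 * (3 * a * K) := by gcongr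
      _ = 55296 * a ^ 3 * K ^ 1 := by ring
      _ ≤ 165888 * a ^ 5 * K ^ 4 := by
        gcongr ?_ * ?_ * ?_
        · norm_num
        · exact hpa 3 (by norm_num)
        · exact hpK 1 4 (by norm_num)
      _ ≤ n * q := hl'
      _ ≤ _ := by gcongr
  have c3 : 72 * (k : ℝ) * (e + 1) * (e + 2) ^ 2 * q ≤ 1 := by
    calc 72 * (k : ℝ) * (e + 1) * (e + 2) ^ 2 * q ≤ 72 * (3 * a * K) * a * a ^ 2 * q := by gcongr
      _ = q * K ^ 1 * (216 * a ^ 4) := by ring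
      _ ≤ q * K ^ 6 * (165888 * a ^ 5) := by
        gcongr ?_ * ?_ * (?_ * ?_)
        · exact hpK 1 6 (by norm_num)
        · norm_num
        · exact hpa 4 (by norm_num)
      _ ≤ 1 := hu'
  have c4 : 2592 * (k : ℝ) ^ 2 * (e + 1) * (e + 2) ^ 2 ≤ n := by
    calc 2592 * (k : ℝ) ^ 2 * (e + 1) * (e + 2) ^ 2 ≤ 2592 * (3 * a * K) ^ 2 * a * a ^ 2 := by gcongr
      _ = 23328 * a ^ 5 * K ^ 2 := by ring
      _ ≤ 165888 * a ^ 5 * K ^ 4 := by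
        gcongr ?_ * ?_ * ?_
        · norm_num
        · exact hpK 2 4 (by norm_num)
      _ ≤ n * q := hl'
      _ ≤ n * 1 := by gcongr
      _ = n := mul_one _
  refine (bernP_not_LMRegular_le he h0 h1 hk0 c1 c2 c3 c4).trans ?_
  have hE : Real.exp (-(k : ℝ)) ≤ (n : ℝ) ^ (-(D + (3 * e + 8))) := by
    rw [Real.rpow_def_of_pos hn0, Real.exp_le_exp]
    linarith
  have hN : (n.choose (e + 1) : ℝ) ≤ (n : ℝ) ^ (e + 1) := by
    exact_mod_cast Nat.choose_le_pow n (e + 1)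
  have h40 : (40 : ℝ) ≤ n ^ 4 := by
    calc (40 : ℝ) ≤ 3 ^ 4 := by norm_num
      _ ≤ n ^ 4 := by gcongr
  have hen : (e : ℝ) + 2 ≤ n := by exact_mod_cast he
  calc 40 * ((e : ℝ) + 2) * (n.choose (e + 1)) ^ 3 * Real.exp (-k)
      ≤ n ^ 4 * n * (n ^ (e + 1)) ^ 3 * (n : ℝ) ^ (-(D + (3 * e + 8))) := by gcongr
    _ = (n : ℝ) ^ ((3 * e + 8 : ℕ) : ℝ) * (n : ℝ) ^ (-(D + (3 * e + 8))) := by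
      rw [Real.rpow_natCast]; ring
    _ = (n : ℝ) ^ (-D) := by
      rw [← Real.rpow_add hn0]
      congr 1
      push_cast; ring

theorem measure_iInter_indep {T Ω : Type} [Fintype T] [DecidableEq T] [MeasurableSpace Ω]
    {μ : Measure Ω} [IsProbabilityMeasure μ] {S : T → Set Ω} (hS : ∀ τ, MeasurableSet (S τ))
    (hind : iIndepSet S μ) {p : ℝ} (h0 : 0 ≤ p) (h1 : p ≤ 1)
    (hp : ∀ τ, μ (S τ) = ENNReal.ofReal p) (z : T → Bool) :
    μ {ω | ∀ τ, (ω ∈ S τ ↔ z τ = true)} = ENNReal.ofReal (bernWeight p z) := by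
  have e1 : {ω | ∀ τ, (ω ∈ S τ ↔ z τ = true)} = ⋂ τ, (if z τ = true then S τ else (S τ)ᶜ) := by
    ext ω
    simp only [Set.mem_ofPred_eq, Set.mem_iInter]
    refine forall_congr' fun τ => ?_
    split_ifs with h <;> simp [h]
  have hm : ∀ τ, MeasurableSet[MeasurableSpace.generateFrom {S τ}]
      (if z τ = true then S τ else (S τ)ᶜ) := by
    intro τ
    have : MeasurableSet[MeasurableSpace.generateFrom {S τ}] (S τ) :=
      MeasurableSpace.measurableSet_generateFrom rfl
    split_ifs
    · exact this
    · exact this.compl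
  rw [e1, iIndep.meas_iInter hind hm, bernWeight, ENNReal.ofReal_prod_of_nonneg]
  · refine Finset.prod_congr rfl fun τ _ => ?_
    split_ifs
    · exact hp τ
    · rw [prob_compl_eq_one_sub (hS τ), hp, ENNReal.ofReal_sub 1 h0, ENNReal.ofReal_one]
  · intro τ _
    split_ifs <;> linarith

open Classical in
theorem measure_preimage_eq_bernP {T Ω : Type} [Fintype T] [DecidableEq T] [MeasurableSpace Ω]
    {μ : Measure Ω} [IsProbabilityMeasure μ] {S : T → Set Ω} (hS : ∀ τ, MeasurableSet (S τ))
    (hind : iIndepSet S μ) {p : ℝ} (h0 : 0 ≤ p) (h1 : p ≤ 1)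
    (hp : ∀ τ, μ (S τ) = ENNReal.ofReal p) (A : Set (T → Bool)) :
    μ {ω | (fun τ => decide (ω ∈ S τ)) ∈ A} = ENNReal.ofReal (bernP p A) := by
  have e1 : {ω | (fun τ => decide (ω ∈ S τ)) ∈ A} =
      ⋃ z ∈ Finset.univ.filter (· ∈ A), {ω | ∀ τ, (ω ∈ S τ ↔ z τ = true)} := by
    ext ω
    simp only [Set.mem_ofPred_eq, Set.mem_iUnion, Finset.mem_filter, Finset.mem_univ, true_and,
      exists_prop]
    constructor
    · intro h
      exact ⟨_, h, fun τ => by simp⟩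
    · rintro ⟨z, hz, h⟩
      have : (fun τ => decide (ω ∈ S τ)) = z := by
        funext τ
        rw [Bool.eq_iff_iff, decide_eq_true_iff, h]
      rwa [this]
  rw [e1, measure_biUnion_finset]
  · rw [bernP, bernE]
    simp only [measure_iInter_indep hS hind h0 h1 hp]
    rw [← ENNReal.ofReal_sum_of_nonneg fun z _ => bernWeight_nonneg h0 h1 z, Finset.sum_filter]
    congr 1
    refine Finset.sum_congr rfl fun z _ => ?_
    by_cases h : z ∈ A <;> simp [h]
  · intro z _ z' _ hne
    refine Set.disjoint_left.2 fun ω hz hz' => hne ?_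
    funext τ
    rw [Bool.eq_iff_iff, ← hz τ, ← hz' τ]
  · intro z _
    have : {ω | ∀ τ, (ω ∈ S τ ↔ z τ = true)} = ⋂ τ, (if z τ = true then S τ else (S τ)ᶜ) := by
      ext ω
      simp only [Set.mem_ofPred_eq, Set.mem_iInter]
      refine forall_congr' fun τ => ?_
      split_ifs with h <;> simp [h]
    rw [this]
    refine MeasurableSet.iInter fun τ => ?_
    split_ifs
    · exact hS τ
    · exact (hS τ).compl

end Confinement

/-- **Eigenvalue confinement, part (2).**
For every `d ≥ 2` there is a constant `C > 0` (depending only on `d`) such that for all `D > 0`: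
if `nq ≥ C(1+D)⁴ log⁴ n` and `q log⁶ n ≤ 1/(C(1+D)⁶)`, then with probability at least `1 - n^{-D}`
the `binom(n-1,d-1)` largest eigenvalues of the adjacency operator of `X(d,n,p)` lie in
`np + [-7d, 7d]`. -/
theorem eigenvalue_confinement_large (d : ℕ) (hd : 2 ≤ d) :
    ∃ C : ℝ, 0 < C ∧
      ∀ (D : ℝ), 0 < D →
      ∀ (n : ℕ) (p : ℝ), d + 1 ≤ n → 0 ≤ p → p ≤ 1 →
      ∀ (Ω : Type) (_ : MeasurableSpace Ω) (μ : Measure Ω), IsProbabilityMeasure μ →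
      ∀ S : LMCell n (d + 1) → Set Ω,
        (∀ τ, MeasurableSet (S τ)) →
        iIndepSet S μ →
        (∀ τ, μ (S τ) = ENNReal.ofReal p) →
        C * (1 + D) ^ 4 * (Real.log n) ^ 4 ≤ (n : ℝ) * (p * (1 - p)) →
        (p * (1 - p)) * (Real.log n) ^ 6 ≤ 1 / (C * (1 + D) ^ 6) →
        1 - ENNReal.ofReal ((n : ℝ) ^ (-D)) ≤
          μ {ω | ∀ i, Nat.choose (n - 1) d ≤ i → i < Nat.choose n d →
              LMeig (LMadj n d
                  {τ | ∃ h : τ ∈ Finset.powersetCard (d + 1) (Finset.range n), ω ∈ S ⟨τ, h⟩}) i ∈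
                Set.Icc ((n : ℝ) * p - 7 * d) ((n : ℝ) * p + 7 * d)} := by
  classical
  obtain ⟨e, rfl⟩ : ∃ e, d = e + 1 := ⟨d - 1, by omega⟩
  refine ⟨165888 * ((e : ℝ) + 3) ^ 5, by positivity, ?_⟩
  intro D hD n p hn h0 h1 Ω _ μ _ S hS hind hp hl hu
  have hn0 : 0 < n := by omega
  have hbad := bernP_not_LMRegular_le_rpow (by omega) hn h0 h1 hD hl hu
  have hp0 : 0 < p := by
    rcases h0.eq_or_lt with h | h
    · rw [← h, zero_mul, mul_zero] at hl
      have hlog : 0 < Real.log n := Real.log_pos (by exact_mod_cast (by omega : 1 < n))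
      have : 0 < 165888 * ((e : ℝ) + 3) ^ 5 * (1 + D) ^ 4 * (Real.log n) ^ 4 := by positivity
      linarith
    · exact h
  have hgood := measure_preimage_eq_bernP hS hind h0 h1 hp
    {z : LMCell n (e + 2) → Bool | LMRegular (e := e) p (lmNoise p z)}
  rw [bernP_compl] at hgood
  have hc : {z : LMCell n (e + 2) → Bool | LMRegular (e := e) p (lmNoise p z)}ᶜ =
    {z : LMCell n (e + 2) → Bool | ¬ LMRegular (e := e) p (lmNoise p z)} := rfl
  rw [hc] at hgood
  calc 1 - ENNReal.ofReal ((n : ℝ) ^ (-D)) = ENNReal.ofReal (1 - (n : ℝ) ^ (-D)) := by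
        rw [ENNReal.ofReal_sub 1 (by positivity), ENNReal.ofReal_one]
    _ ≤ _ := ENNReal.ofReal_le_ofReal (sub_le_sub_left hbad 1)
    _ = _ := hgood.symm
    _ ≤ _ := by
      refine measure_mono fun ω hω i hi hi' => ?_
      have hreg : LMRegular (e := e) p (lmNoise p fun τ => decide (ω ∈ S τ)) := hω
      have := LMeig_LMadj_mem_Icc hn0 (X := {τ | ∃ h : τ ∈ Finset.powersetCard (e + 1 + 1)
        (Finset.range n), ω ∈ S ⟨τ, h⟩}) hp0 h1 (fun τ => ?_) hreg.diag hreg.up hreg.deg hreg.sq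
        hi hi'
      · rwa [Nat.cast_add_one]
      · have hiff : τ.1 ∈ {τ | ∃ h : τ ∈ Finset.powersetCard (e + 1 + 1) (Finset.range n),
            ω ∈ S ⟨τ, h⟩} ↔ ω ∈ S τ := ⟨fun ⟨_, h⟩ => h, fun h => ⟨τ.2, h⟩⟩
        rw [lmNoise, bernCentered, Set.indicator_apply]
        by_cases h : ω ∈ S τ
        · rw [if_pos (hiff.2 h), if_pos (decide_eq_true h)]
        · rw [if_neg fun h' => h (hiff.1 h'), if_neg (by simpa using h)]
end
end

section
/- For every k ≥ 0 and every s with d ≤ s ≤ ⌊k/2⌋ + d, the number of equivalence classes |W_s^k| of closed (n,d)-words of length k+1 with N_w(τ) ≠ 1 for every d-cell τ and |supp_0(w)| = s satisfies |W_s^k| ≤ k^{dk}. -/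
open Filter

noncomputable section

/-- `w` is an `(n,d)`-word: a nonempty sequence of letters ((d-1)-cells of the complete
complex `K(d,n)`) such that the union of any two consecutive letters is a d-cell. -/
def IsWord (n d : ℕ) (w : List (Finset ℕ)) : Prop :=
  w ≠ [] ∧ (∀ σ ∈ w, σ ⊆ Finset.range n ∧ σ.card = d) ∧
    List.Chain' (fun σ σ' => (σ ∪ σ').card = d + 1) w

/-- `supp₀(w)`: the set of 0-cells (vertices) appearing in `w`. -/
def supp0 (w : List (Finset ℕ)) : Finset ℕ := w.foldr (· ∪ ·) ∅

/-- The list of steps (crossings) of the word `w`. -/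
def steps (w : List (Finset ℕ)) : List (Finset ℕ × Finset ℕ) := w.zip w.tail

/-- `supp_d(w)`: the set of d-cells crossed by `w`. -/
def suppd (w : List (Finset ℕ)) : Finset (Finset ℕ) :=
  ((steps w).map (fun p => p.1 ∪ p.2)).toFinset

/-- `N_w(τ)`: the number of crossings of the d-cell `τ` along `w`. -/
def Ncell (w : List (Finset ℕ)) (τ : Finset ℕ) : ℕ :=
  ((steps w).filter (fun p => p.1 ∪ p.2 = τ)).length

/-- `N_w({a,b})`: the number of crossings of the (unordered) edge `{a,b}` of `G_w` along `w`. -/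
def Nedge (w : List (Finset ℕ)) (a b : Finset ℕ) : ℕ :=
  ((steps w).filter (fun p => (p.1 = a ∧ p.2 = b) ∨ (p.1 = b ∧ p.2 = a))).length

/-- `E_w`: the edge set of the graph `G_w` (an edge is recorded as the 1- or 2-element set of
its endpoints). -/
def edgeSet (w : List (Finset ℕ)) : Finset (Finset (Finset ℕ)) :=
  ((steps w).map (fun p => ({p.1, p.2} : Finset (Finset ℕ)))).toFinset

/-- `V_w`: vertex set of the graph `G_w`. -/
def vertSet (w : List (Finset ℕ)) : Finset (Finset ℕ) := w.toFinset

def IsClosedWord (w : List (Finset ℕ)) : Prop := w.head? = w.getLast?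

/-- Two words are equivalent if a permutation of the vertices maps one to the other. -/
def WordEquiv (w w' : List (Finset ℕ)) : Prop :=
  ∃ π : Equiv.Perm ℕ, w' = w.map (fun σ => σ.image π)

/-- The number of equivalence classes of words satisfying `P`. -/
noncomputable def numClasses (P : List (Finset ℕ) → Prop) : ℕ :=
  Set.ncard {c : Set (List (Finset ℕ)) | ∃ w, P w ∧ c = {w' | P w' ∧ WordEquiv w w'}}

/-- Membership in (the set of words represented by) `W_s^k`. -/
def InW (n d k s : ℕ) (w : List (Finset ℕ)) : Prop :=
  IsWord n d w ∧ IsClosedWord w ∧ w.length = k + 1 ∧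
    (∀ τ : Finset ℕ, Ncell w τ ≠ 1) ∧ (supp0 w).card = s

/-- `Σ_{e ∈ Ê_w(τ)} N_w(e)`: the number of crossings of `τ` between non-neighboring
(anti-oriented) `(d-1)`-cells, with respect to the increasing orientation. -/
def NedgeHat (w : List (Finset ℕ)) (τ : Finset ℕ) : ℕ :=
  ((steps w).filter (fun p => p.1 ∪ p.2 = τ ∧
    Even (LMidx τ (p.2 \ p.1) + LMidx τ (p.1 \ p.2)))).length

/-- The sign `sgn(w,τ)`. -/
def sgnW (w : List (Finset ℕ)) (τ : Finset ℕ) : ℤ := (-1) ^ NedgeHat w τ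

/-- The `i`-th letter of `w` (0-indexed). -/
def letterAt (w : List (Finset ℕ)) (i : ℕ) : Finset ℕ := w.getD i ∅

/-- The step `j` of `w` crosses the unordered edge `{a,b}`. -/
def stepIs (w : List (Finset ℕ)) (j : ℕ) (a b : Finset ℕ) : Prop :=
  (letterAt w j = a ∧ letterAt w (j + 1) = b) ∨ (letterAt w j = b ∧ letterAt w (j + 1) = a)

/-- The number of crossings of the edge `{a,b}` among the first `m` steps of `w`. -/
noncomputable def cntEdge (w : List (Finset ℕ)) (a b : Finset ℕ) (m : ℕ) : ℕ :=
  Set.ncard {j | j < m ∧ stepIs w j a b}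

/-- The edge `{a,b}` of `G_w` is new: at some crossing of it the second letter has not
appeared before. -/
def IsNewEdge (w : List (Finset ℕ)) (a b : Finset ℕ) : Prop :=
  ∃ j, j + 1 < w.length ∧ stepIs w j a b ∧ letterAt w (j + 1) ∉ w.take (j + 1)

/-- The FK parsing of `w` is split at step `i`. -/
def FKsplit (w : List (Finset ℕ)) (i : ℕ) : Prop :=
  ¬ IsNewEdge w (letterAt w i) (letterAt w (i + 1))
  ∨ 2 ≤ cntEdge w (letterAt w i) (letterAt w (i + 1)) i
  ∨ (cntEdge w (letterAt w i) (letterAt w (i + 1)) i = 1 ∧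
      ∃ a b, a ∪ b = letterAt w i ∪ letterAt w (i + 1) ∧ 2 ≤ cntEdge w a b i)

/-- The number `m_w` of words in the FK parsing `a_w` of `w`. -/
noncomputable def mFK (w : List (Finset ℕ)) : ℕ :=
  1 + Set.ncard {i | i + 1 < w.length ∧ FKsplit w i}

/-- The graph `G_w` of the word `w`, as a simple graph on the letters of `w`. -/
def wordGraph (w : List (Finset ℕ)) : SimpleGraph {σ // σ ∈ w.toFinset} :=
  SimpleGraph.fromRel (fun a b => ∃ j, j + 1 < w.length ∧ stepIs w j a.1 b.1)

/-- `w` is an FK word: its graph is a tree, no edge is crossed more than twice, and each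
d-cell carries at most one edge that is crossed twice. -/
def IsFKWord (n d : ℕ) (w : List (Finset ℕ)) : Prop :=
  IsWord n d w ∧ (wordGraph w).IsTree ∧
    (∀ a b : Finset ℕ, ({a, b} : Finset (Finset ℕ)) ∈ edgeSet w → Nedge w a b ≤ 2) ∧
    (∀ τ a b a' b' : Finset ℕ, ({a, b} : Finset (Finset ℕ)) ∈ edgeSet w →
      ({a', b'} : Finset (Finset ℕ)) ∈ edgeSet w → a ∪ b = τ → a' ∪ b' = τ →
      2 ≤ Nedge w a b → 2 ≤ Nedge w a' b' →
      ({a, b} : Finset (Finset ℕ)) = ({a', b'} : Finset (Finset ℕ)))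

/-- The letters contained in `range s` obtained from `a` by exchanging one element. -/
def exchanges (s : ℕ) (a : Finset ℕ) : Finset (Finset ℕ) :=
  (a ×ˢ (Finset.range s \ a)).image fun p => insert p.2 (a.erase p.1)

lemma card_exchanges_le {s : ℕ} {a : Finset ℕ} (ha : a ⊆ Finset.range s) :
    (exchanges s a).card ≤ a.card * (s - a.card) := by
  refine Finset.card_image_le.trans ?_
  rw [Finset.card_product, Finset.card_sdiff_of_subset ha, Finset.card_range]

lemma subset_range_of_mem_exchanges {s : ℕ} {a b : Finset ℕ} (ha : a ⊆ Finset.range s)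
    (hb : b ∈ exchanges s a) : b ⊆ Finset.range s := by
  simp only [exchanges, Finset.mem_image, Finset.mem_product, Finset.mem_sdiff] at hb
  obtain ⟨p, ⟨_, hp, _⟩, rfl⟩ := hb
  exact Finset.insert_subset hp ((Finset.erase_subset _ _).trans ha)

lemma card_of_mem_exchanges {s : ℕ} {a b : Finset ℕ} (hb : b ∈ exchanges s a) :
    b.card = a.card := by
  simp only [exchanges, Finset.mem_image, Finset.mem_product, Finset.mem_sdiff] at hb
  obtain ⟨p, ⟨hp, _, hq⟩, rfl⟩ := hb
  rw [Finset.card_insert_of_notMem (fun h => hq (Finset.mem_of_mem_erase h)),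
    Finset.card_erase_add_one hp]

lemma mem_exchanges {s : ℕ} {a b : Finset ℕ} (hb : b ⊆ Finset.range s)
    (hcard : b.card = a.card) (hab : (a ∪ b).card = a.card + 1) : b ∈ exchanges s a := by
  have h₁ : (a \ b).card = 1 := by
    have := Finset.card_sdiff_add_card a b
    omega
  have h₂ : (b \ a).card = 1 := by
    have := Finset.card_sdiff_add_card b a
    rw [Finset.union_comm] at this
    omega
  obtain ⟨x, hx⟩ := Finset.card_eq_one.mp h₁
  obtain ⟨y, hy⟩ := Finset.card_eq_one.mp h₂
  simp only [Finset.ext_iff, Finset.mem_sdiff, Finset.mem_singleton] at hx hy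
  simp only [exchanges, Finset.mem_image, Finset.mem_product, Finset.mem_sdiff]
  refine ⟨(x, y), ⟨((hx x).2 rfl).1, hb ((hy y).2 rfl).1, ((hy y).2 rfl).2⟩, ?_⟩
  ext z
  simp only [Finset.mem_insert, Finset.mem_erase]
  have := hx z
  have := hy z
  tauto

/-- The words with `k` steps starting at `a`, each step being an exchange inside `range s`. -/
def exchangeWords (s : ℕ) : ℕ → Finset ℕ → Finset (List (Finset ℕ))
  | 0, a => {[a]}
  | k + 1, a => (exchanges s a).biUnion fun b => (exchangeWords s k b).image (a :: ·)

lemma card_exchangeWords_le (s d : ℕ) : ∀ (k : ℕ) (a : Finset ℕ), a ⊆ Finset.range s →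
    a.card = d → (exchangeWords s k a).card ≤ (d * (s - d)) ^ k
  | 0, a, _, _ => by simp [exchangeWords]
  | k + 1, a, ha, hd => by
    rw [exchangeWords, pow_succ']
    refine (Finset.card_biUnion_le_card_mul _ _ ((d * (s - d)) ^ k) fun b hb => ?_).trans ?_
    · exact Finset.card_image_le.trans (card_exchangeWords_le s d k b
        (subset_range_of_mem_exchanges ha hb) ((card_of_mem_exchanges hb).trans hd))
    · exact Nat.mul_le_mul_right _ (hd ▸ card_exchanges_le ha)

lemma mem_exchangeWords (s d : ℕ) : ∀ (t : List (Finset ℕ)) (a : Finset ℕ),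
    (∀ σ ∈ a :: t, σ ⊆ Finset.range s ∧ σ.card = d) →
    List.IsChain (fun σ σ' => (σ ∪ σ').card = d + 1) (a :: t) →
    a :: t ∈ exchangeWords s t.length a
  | [], a, _, _ => by simp [exchangeWords]
  | b :: t, a, h, hc => by
    rw [List.isChain_cons_cons] at hc
    have ha := h a (by simp)
    have hb := h b (by simp)
    simp only [List.length_cons, exchangeWords, Finset.mem_biUnion, Finset.mem_image]
    exact ⟨b, mem_exchanges hb.1 (hb.2.trans ha.2.symm) (by rw [hc.1, ha.2]), b :: t,
      mem_exchangeWords s d t b (fun σ hσ => h σ (List.mem_cons_of_mem _ hσ)) hc.2, rfl⟩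

lemma exists_perm_map_eq_range {l : List ℕ} (hl : l.Nodup) :
    ∃ π : Equiv.Perm ℕ, l.map π = List.range l.length := by
  have := Equiv.Perm.isMultiplyPretransitive ℕ l.length
  obtain ⟨π, hπ⟩ := MulAction.exists_smul_eq (Equiv.Perm ℕ)
    (⟨l.get, hl.injective_get⟩ : Fin l.length ↪ ℕ) Fin.valEmbedding
  refine ⟨π, List.ext_getElem (by simp) fun i h _ => ?_⟩
  have := DFunLike.congr_fun hπ ⟨i, by simpa using h⟩
  simpa using this

lemma exists_perm_image_eq_range {a S : Finset ℕ} (h : a ⊆ S) :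
    ∃ π : Equiv.Perm ℕ, a.image π = Finset.range a.card ∧ S.image π = Finset.range S.card := by
  have hl : (a.toList ++ (S \ a).toList).Nodup := by
    rw [List.nodup_append']
    refine ⟨a.nodup_toList, (S \ a).nodup_toList, fun x hx hy => ?_⟩
    simp only [Finset.mem_toList, Finset.mem_sdiff] at hx hy
    exact hy.2 hx
  obtain ⟨π, hπ⟩ := exists_perm_map_eq_range hl
  have key : ∀ T : Finset ℕ, ∀ l : List ℕ, l.toFinset = T → l.map π = List.range T.card →
      T.image π = Finset.range T.card := by
    intro T l hT hm
    ext x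
    have := congrArg (x ∈ ·) hm
    simpa [← hT] using this
  have hlen : (a.toList ++ (S \ a).toList).length = S.card := by
    rw [List.length_append, Finset.length_toList, Finset.length_toList, add_comm,
      Finset.card_sdiff_add_card_eq_card h]
  refine ⟨π, key a a.toList (by simp) ?_, key S _ ?_ (hlen ▸ hπ)⟩
  · have := congrArg (List.take a.card) hπ
    rw [hlen, List.map_append, List.take_left' (by simp), List.take_range,
      min_eq_left (Finset.card_le_card h)] at this
    exact this
  · rw [List.toFinset_append, Finset.toList_toFinset, Finset.toList_toFinset,
      Finset.union_sdiff_of_subset h]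

lemma subset_supp0 {w : List (Finset ℕ)} {σ : Finset ℕ} (h : σ ∈ w) : σ ⊆ supp0 w := by
  induction w with
  | nil => simp at h
  | cons a t ih =>
    rw [supp0, List.foldr_cons]
    rcases List.mem_cons.1 h with rfl | h
    · exact Finset.subset_union_left
    · exact (ih h).trans Finset.subset_union_right

lemma WordEquiv.symm {v w : List (Finset ℕ)} (h : WordEquiv v w) : WordEquiv w v := by
  obtain ⟨π, rfl⟩ := h
  exact ⟨π⁻¹, by simp [Finset.image_image, Function.comp_def]⟩

lemma WordEquiv.trans {u v w : List (Finset ℕ)} (h : WordEquiv u v) (h' : WordEquiv v w) :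
    WordEquiv u w := by
  obtain ⟨π, rfl⟩ := h
  obtain ⟨ρ, rfl⟩ := h'
  exact ⟨ρ * π, by simp [Finset.image_image, Function.comp_def]⟩

lemma exists_wordEquiv_mem_exchangeWords {n d k s : ℕ} {w : List (Finset ℕ)}
    (hw : InW n d k s w) : ∃ v ∈ exchangeWords s k (Finset.range d), WordEquiv w v := by
  obtain ⟨⟨hne, hl, hc⟩, -, hlen, -, hs⟩ := hw
  obtain ⟨a, t, rfl⟩ := List.exists_cons_of_ne_nil hne
  have ha : a ⊆ supp0 (a :: t) := subset_supp0 (by simp)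
  obtain ⟨π, h₁, h₂⟩ := exists_perm_image_eq_range ha
  rw [(hl a (by simp)).2] at h₁
  refine ⟨(a :: t).map (Finset.image π), ?_, π, rfl⟩
  have ht : (t.map (Finset.image π)).length = k := by simpa using hlen
  rw [List.map_cons, h₁, ← ht]
  apply mem_exchangeWords s d
  · rw [← h₁, ← List.map_cons]
    intro σ hσ
    obtain ⟨τ, hτ, rfl⟩ := List.mem_map.1 hσ
    refine ⟨?_, (Finset.card_image_of_injective _ π.injective).trans (hl τ hτ).2⟩
    rw [← hs, ← h₂]
    exact Finset.image_subset_image (subset_supp0 hτ)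
  · rw [← h₁, ← List.map_cons, List.isChain_map]
    refine List.IsChain.imp (fun σ σ' h => ?_) hc
    rw [← Finset.image_union, Finset.card_image_of_injective _ π.injective, h]

lemma numClasses_le_card {P : List (Finset ℕ) → Prop} {T : Finset (List (Finset ℕ))}
    (h : ∀ w, P w → ∃ v ∈ T, WordEquiv w v) : numClasses P ≤ T.card := by
  have hsub : {c : Set (List (Finset ℕ)) | ∃ w, P w ∧ c = {w' | P w' ∧ WordEquiv w w'}} ⊆
      (fun v => {w' | P w' ∧ WordEquiv v w'}) '' (T : Set (List (Finset ℕ))) := by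
    rintro c ⟨w, hw, rfl⟩
    obtain ⟨v, hv, hwv⟩ := h w hw
    refine ⟨v, hv, Set.ext fun w' => and_congr_right fun _ => ?_⟩
    exact ⟨hwv.trans, hwv.symm.trans⟩
  refine (Set.ncard_le_ncard hsub (T.finite_toSet.image _)).trans ?_
  exact (Set.ncard_image_le T.finite_toSet).trans_eq (Set.ncard_coe_finset T)

lemma mul_half_le_pow {d : ℕ} (hd : d ≠ 0) (k : ℕ) : d * (k / 2) ≤ k ^ d := by
  rcases lt_or_ge k 2 with hk | hk
  · simp [Nat.div_eq_of_lt hk]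
  · obtain ⟨e, rfl⟩ := Nat.exists_eq_succ_of_ne_zero hd
    rw [Nat.succ_eq_add_one, pow_succ]
    exact Nat.mul_le_mul (e.lt_pow_self hk) (Nat.div_le_self _ _)

/-- **Claim 3.8.** For every `k ≥ 0` and `d ≤ s ≤ ⌊k/2⌋ + d`, the number of equivalence
classes of closed words of length `k+1` with `N_w(τ) ≠ 1` for every `d`-cell `τ` and
`|supp₀(w)| = s` is at most `k^{dk}`. -/
theorem card_W_le (n d k s : ℕ) (hd : 2 ≤ d) (hn : d + 1 ≤ n)
    (hs₁ : d ≤ s) (hs₂ : s ≤ k / 2 + d) :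
    numClasses (InW n d k s) ≤ k ^ (d * k) := by
  calc numClasses (InW n d k s)
      ≤ (exchangeWords s k (Finset.range d)).card :=
        numClasses_le_card fun _ => exists_wordEquiv_mem_exchangeWords
    _ ≤ (d * (s - d)) ^ k :=
        card_exchangeWords_le s d k _ (Finset.range_subset_range.2 hs₁) (Finset.card_range d)
    _ ≤ (k ^ d) ^ k := by
        refine Nat.pow_le_pow_left ?_ k
        exact (Nat.mul_le_mul_left d (by omega)).trans (mul_half_le_pow (by omega) k)
    _ = k ^ (d * k) := (pow_mul k d k).symm
end
end

section
/- Let k be even and let w ∈ W_{k/2+d}^k, i.e., w is a closed (n,d)-word of length k+1 with N_w(τ) ≠ 1 for every d-cell τ and |supp_0(w)| = k/2 + d. Then: (1) N_w(τ) ∈ {0,2} for every d-cell τ; (2) |E_w| = k/2 and N_w(e) = 2 for every edge e ∈ E_w, and consequently sgn(w,τ) = 1 for every d-cell τ. -/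
open Filter

noncomputable section

lemma mem_supp0_iff (w : List (Finset ℕ)) (u : ℕ) : u ∈ supp0 w ↔ ∃ σ ∈ w, u ∈ σ := by
  unfold supp0
  induction w with
  | nil => simp
  | cons x w ih => simp [ih]

lemma supp0_append (A B : List (Finset ℕ)) : supp0 (A ++ B) = supp0 A ∪ supp0 B := by
  ext u
  simp only [mem_supp0_iff, Finset.mem_union, List.mem_append, or_and_right, exists_or]

lemma supp0_cons (x : Finset ℕ) (B : List (Finset ℕ)) : supp0 (x :: B) = x ∪ supp0 B := rfl

lemma supp0_singleton (x : Finset ℕ) : supp0 [x] = x := by simp [supp0]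

lemma steps_cons_cons (x y : Finset ℕ) (B : List (Finset ℕ)) :
    steps (x :: y :: B) = (x, y) :: steps (y :: B) := rfl

lemma steps_append_cons (A B : List (Finset ℕ)) (x : Finset ℕ) :
    steps (A ++ x :: B) = steps (A ++ [x]) ++ steps (x :: B) := by
  induction A with
  | nil => simp [steps]
  | cons a A ih =>
    cases A with
    | nil => simp [steps]
    | cons b A => simpa [steps_cons_cons] using ih

lemma mem_of_mem_steps {w : List (Finset ℕ)} {p : Finset ℕ × Finset ℕ} (h : p ∈ steps w) :
    p.1 ∈ w ∧ p.2 ∈ w := by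
  obtain ⟨a, b⟩ := p
  exact ⟨(List.of_mem_zip h).1, List.mem_of_mem_tail (List.of_mem_zip h).2⟩

lemma union_subset_supp0 {w : List (Finset ℕ)} {p : Finset ℕ × Finset ℕ} (h : p ∈ steps w) :
    p.1 ∪ p.2 ⊆ supp0 w :=
  Finset.union_subset (subset_supp0 (mem_of_mem_steps h).1) (subset_supp0 (mem_of_mem_steps h).2)

lemma length_steps (w : List (Finset ℕ)) : (steps w).length = w.length - 1 := by
  simp [steps]

lemma card_union_of_isChain {d : ℕ} {w : List (Finset ℕ)}
    (h : List.IsChain (fun σ σ' : Finset ℕ => (σ ∪ σ').card = d + 1) w) :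
    ∀ p ∈ steps w, (p.1 ∪ p.2).card = d + 1 := by
  induction w with
  | nil => simp [steps]
  | cons x w ih =>
    cases w with
    | nil => simp [steps]
    | cons y w =>
      rw [List.isChain_cons_cons] at h
      intro p hp
      rw [steps_cons_cons, List.mem_cons] at hp
      rcases hp with rfl | hp
      · exact h.1
      · exact ih h.2 p hp

lemma mem_suppd_iff (w : List (Finset ℕ)) (τ : Finset ℕ) :
    τ ∈ suppd w ↔ ∃ p ∈ steps w, p.1 ∪ p.2 = τ := by
  simp only [suppd, List.mem_toFinset, List.mem_map]

/-- Each newly crossed cell contributes at most one new vertex. -/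
lemma card_supp0_le {d : ℕ} {w : List (Finset ℕ)} (hne : w ≠ []) (hcard : ∀ σ ∈ w, σ.card = d)
    (hstep : ∀ p ∈ steps w, (p.1 ∪ p.2).card = d + 1) :
    (supp0 w).card ≤ d + (suppd w).card := by
  induction w with
  | nil => exact absurd rfl hne
  | cons x w ih =>
    cases w with
    | nil => simp [supp0_singleton, hcard x]
    | cons y w =>
      have ih' := ih (by simp) (fun σ h => hcard σ (List.mem_cons_of_mem _ h))
        (fun p h => hstep p (by rw [steps_cons_cons]; exact List.mem_cons_of_mem _ h))
      have hd : suppd (x :: y :: w) = insert (x ∪ y) (suppd (y :: w)) := by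
        simp [suppd, steps_cons_cons]
      rw [supp0_cons, hd]
      by_cases hτ : x ∪ y ∈ suppd (y :: w)
      · rw [Finset.insert_eq_of_mem hτ]
        obtain ⟨p, hp, hpτ⟩ := (mem_suppd_iff _ _).1 hτ
        have hx : x ⊆ supp0 (y :: w) :=
          (Finset.subset_union_left.trans hpτ.symm.subset).trans (union_subset_supp0 hp)
        rwa [Finset.union_eq_right.2 hx]
      · rw [Finset.card_insert_of_notMem hτ]
        have hy : y ⊆ supp0 (y :: w) := subset_supp0 (by simp)
        have hxy : (x ∪ y).card = d + 1 := hstep (x, y) (by simp [steps_cons_cons])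
        have hyd : y.card = d := hcard y (by simp)
        have h1 : x ∪ supp0 (y :: w) = (x \ y) ∪ supp0 (y :: w) := by
          ext u
          have := @hy u
          simp only [Finset.mem_union, Finset.mem_sdiff]
          tauto
        have h2 : (x \ y).card + y.card = (x ∪ y).card := Finset.card_sdiff_add_card x y
        have h3 := Finset.card_union_le (x \ y) (supp0 (y :: w))
        rw [h1]
        omega

lemma sum_Ncell (w : List (Finset ℕ)) : ∑ τ ∈ suppd w, Ncell w τ = (steps w).length := by
  have h := List.sum_toFinset_count_eq_length ((steps w).map (fun p => p.1 ∪ p.2))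
  rw [List.length_map] at h
  rw [← h]
  refine Finset.sum_congr rfl fun τ _ => ?_
  rw [Ncell, List.count_eq_countP, List.countP_map, List.countP_eq_length_filter]
  congr 1

lemma Ncell_pos_of_mem_suppd {w : List (Finset ℕ)} {τ : Finset ℕ} (h : τ ∈ suppd w) :
    0 < Ncell w τ := by
  obtain ⟨p, hp, hpτ⟩ := (mem_suppd_iff _ _).1 h
  exact List.length_pos_of_mem (List.mem_filter.2 ⟨hp, by simpa using hpτ⟩)

/-- If no cell is crossed exactly once, then twice the number of crossed cells plus the excess
of any single one over two crossings is at most the number of steps. -/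
lemma two_mul_card_suppd_add_le {w : List (Finset ℕ)} (hN : ∀ τ, Ncell w τ ≠ 1) {τ : Finset ℕ}
    (hτ : τ ∈ suppd w) : 2 * (suppd w).card + (Ncell w τ - 2) ≤ (steps w).length := by
  have h2 : ∀ ρ ∈ suppd w, 2 ≤ Ncell w ρ := fun ρ hρ => by
    have := Ncell_pos_of_mem_suppd hρ
    have := hN ρ
    omega
  rw [← sum_Ncell, ← Finset.add_sum_erase _ _ hτ, ← Finset.card_erase_add_one hτ]
  have h3 := Finset.card_nsmul_le_sum ((suppd w).erase τ) (fun ρ => Ncell w ρ) 2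
    (fun ρ hρ => h2 ρ (Finset.mem_of_mem_erase hρ))
  have := h2 τ hτ
  rw [smul_eq_mul] at h3
  omega

/-- The last step at which a word visits a vertex for the first time. -/
lemma exists_last_new_vertex {d : ℕ} {w : List (Finset ℕ)} (hcard : ∀ σ ∈ w, σ.card = d)
    (hlt : d < (supp0 w).card) :
    ∃ A σ σ' B, w = A ++ σ :: σ' :: B ∧ ¬ σ' ⊆ supp0 (A ++ [σ]) ∧
      supp0 w = supp0 (A ++ [σ, σ']) := by
  induction w using List.reverseRecOn with
  | nil => simp [supp0] at hlt
  | append_singleton w z ih =>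
    by_cases hz : z ⊆ supp0 w
    · have hs : supp0 (w ++ [z]) = supp0 w := by
        rw [supp0_append, supp0_singleton, Finset.union_eq_left.2 hz]
      obtain ⟨A, σ, σ', B, rfl, h1, h2⟩ :=
        ih (fun σ h => hcard σ (List.mem_append_left _ h)) (hs ▸ hlt)
      exact ⟨A, σ, σ', B ++ [z], by simp, h1, hs.trans h2⟩
    · rcases List.eq_nil_or_concat w with rfl | ⟨A, σ, rfl⟩
      · simp [supp0_singleton, hcard z] at hlt
      · exact ⟨A, σ, z, [], by simp, by simpa using hz, by simp⟩

lemma eq_erase_of_union_eq {d u : ℕ} {σ σ' τ : Finset ℕ} (h : σ ∪ σ' = τ) (hτ : τ.card = d + 1)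
    (hσ : σ.card = d) (huτ : u ∈ τ) (hu : u ∉ σ) : σ = τ.erase u := by
  refine Finset.eq_of_subset_of_card_le (fun v hv => ?_) ?_
  · refine Finset.mem_erase.2 ⟨fun e => hu (e ▸ hv), h ▸ Finset.mem_union_left _ hv⟩
  · rw [Finset.card_erase_of_mem huτ]
    omega

/-- A closed word with the maximal number of vertices backtracks right after the last step that
visits a new vertex. -/
lemma exists_backtrack {d : ℕ} {w : List (Finset ℕ)} (hcard : ∀ σ ∈ w, σ.card = d)
    (hstep : ∀ p ∈ steps w, (p.1 ∪ p.2).card = d + 1) (hcl : IsClosedWord w)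
    (hN : ∀ τ, Ncell w τ ≠ 1) (hpos : 0 < (steps w).length)
    (hs : (steps w).length + 2 * d ≤ 2 * (supp0 w).card) :
    ∃ A σ σ' B u, w = A ++ σ :: σ' :: σ :: B ∧ Ncell w (σ ∪ σ') = 2 ∧ σ ∪ σ' = insert u σ := by
  obtain ⟨A, σ, σ', B, rfl, hnew, hsupp⟩ := exists_last_new_vertex hcard (by omega)
  obtain ⟨u, huσ', huA⟩ := Finset.not_subset.1 hnew
  set w := A ++ σ :: σ' :: B with hw
  set τ := σ ∪ σ' with hτ
  have hsteps : steps w = steps (A ++ [σ]) ++ (σ, σ') :: steps (σ' :: B) := by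
    rw [hw, steps_append_cons, steps_cons_cons]
  have hpre : steps (A ++ [σ, σ']) = steps (A ++ [σ]) ++ [(σ, σ')] := by
    rw [steps_append_cons]
    simp [steps]
  have hsub : ∀ p ∈ steps (A ++ [σ, σ']), p ∈ steps w := by
    intro p hp
    rw [hpre] at hp
    rw [hsteps]
    simp only [List.mem_append, List.mem_cons, List.not_mem_nil, or_false] at hp ⊢
    tauto
  have hτmem : τ ∈ suppd w := (mem_suppd_iff _ _).2 ⟨(σ, σ'), by simp [hsteps], rfl⟩
  have huσ : u ∉ σ := fun h => huA (subset_supp0 (by simp) h)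
  have huτ : u ∈ τ := Finset.mem_union_right _ huσ'
  have hτc : τ.card = d + 1 := hstep (σ, σ') (by simp [hsteps])
  have hbound := two_mul_card_suppd_add_le hN hτmem
  have hcardpre : (supp0 w).card ≤ d + (suppd (A ++ [σ, σ'])).card := by
    rw [hsupp]
    refine card_supp0_le (by simp) (fun ρ hρ => hcard ρ ?_) (fun p hp => hstep p (hsub p hp))
    simp only [hw, List.mem_append, List.mem_cons, List.not_mem_nil, or_false] at hρ ⊢
    tauto
  have hsuppd : suppd (A ++ [σ, σ']) = suppd w := by
    refine Finset.eq_of_subset_of_card_le (fun ρ hρ => ?_) (by omega)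
    obtain ⟨p, hp, hpρ⟩ := (mem_suppd_iff _ _).1 hρ
    exact (mem_suppd_iff _ _).2 ⟨p, hsub p hp, hpρ⟩
  have hsub' := Finset.card_le_card hsuppd.subset
  have hN2 : Ncell w τ = 2 := by
    have := Ncell_pos_of_mem_suppd hτmem
    have := hN τ
    omega
  have huniq : ∀ p ∈ steps w, u ∈ p.1 ∪ p.2 → p.1 ∪ p.2 = τ := by
    intro p hp hup
    obtain ⟨q, hq, hqp⟩ := (mem_suppd_iff _ _).1
      (hsuppd.symm ▸ (mem_suppd_iff w _).2 ⟨p, hp, rfl⟩)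
    rw [hpre, List.mem_append, List.mem_singleton] at hq
    rcases hq with hq | rfl
    · exact absurd (union_subset_supp0 hq (hqp ▸ hup)) huA
    · exact hqp.symm
  have hlast : ∀ z, w.getLast? = some z → u ∉ z := by
    intro z hz huz
    have hhead : w.head? = (A ++ [σ]).head? := by
      rw [hw]
      cases A <;> simp
    have hz' : (A ++ [σ]).head? = some z := by rw [← hhead, ← hz]; exact hcl
    exact huA (subset_supp0 (List.mem_of_mem_head? hz') huz)
  cases B with
  | nil => exact absurd huσ' (hlast σ' (by simp [hw]))
  | cons ρ B =>
    have hρstep : (σ', ρ) ∈ steps w := by simp [hsteps, steps_cons_cons]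
    have hρτ : σ' ∪ ρ = τ := huniq _ hρstep (Finset.mem_union_left _ huσ')
    have huρ : u ∉ ρ := by
      intro huρ
      cases B with
      | nil => exact hlast ρ (by simp [hw]) huρ
      | cons π B =>
        have hπτ : ρ ∪ π = τ :=
          huniq (ρ, π) (by simp [hsteps, steps_cons_cons]) (Finset.mem_union_left _ huρ)
        have : 3 ≤ Ncell w τ := by
          rw [Ncell, hsteps, steps_cons_cons, steps_cons_cons]
          simp only [List.filter_append, List.filter_cons, hρτ, hπτ, ← hτ, decide_true,
            if_true, List.length_append, List.length_cons]
          omega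
        omega
    have h1 : σ = τ.erase u := eq_erase_of_union_eq rfl hτc (hcard σ (by simp [hw])) huτ huσ
    have h2 : ρ = τ.erase u := eq_erase_of_union_eq (by rw [Finset.union_comm]; exact hρτ) hτc
      (hcard ρ (by simp [hw])) huτ huρ
    obtain rfl : ρ = σ := h2.trans h1.symm
    exact ⟨A, ρ, σ', B, u, rfl, hN2, by
      conv_rhs => rw [h1, Finset.insert_erase huτ]⟩

lemma steps_backtrack (A B : List (Finset ℕ)) (σ σ' : Finset ℕ) :
    (steps (A ++ σ :: σ' :: σ :: B)).Perm ((σ, σ') :: (σ', σ) :: steps (A ++ σ :: B)) := by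
  rw [steps_append_cons, steps_cons_cons, steps_cons_cons, steps_append_cons A B]
  exact List.perm_middle.trans (List.Perm.cons _ List.perm_middle)

lemma length_filter_backtrack (A B : List (Finset ℕ)) (σ σ' : Finset ℕ)
    (P : Finset ℕ × Finset ℕ → Bool) (hP : P (σ', σ) = P (σ, σ')) :
    ((steps (A ++ σ :: σ' :: σ :: B)).filter P).length =
      ((steps (A ++ σ :: B)).filter P).length + if P (σ, σ') then 2 else 0 := by
  rw [((steps_backtrack A B σ σ').filter P).length_eq]
  by_cases h : P (σ, σ') = true <;> simp [hP, h]

lemma Nedge_le_Ncell (w : List (Finset ℕ)) (a b : Finset ℕ) : Nedge w a b ≤ Ncell w (a ∪ b) := by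
  refine (List.monotone_filter_right _ fun p hp => ?_).length_le
  simp only [decide_eq_true_eq] at hp ⊢
  rcases hp with ⟨rfl, rfl⟩ | ⟨rfl, rfl⟩
  · rfl
  · exact Finset.union_comm _ _

lemma crossings_of_maximal_support {d : ℕ} (w : List (Finset ℕ))
    (hcard : ∀ σ ∈ w, σ.card = d)
    (hstep : ∀ p ∈ steps w, (p.1 ∪ p.2).card = d + 1) (hcl : IsClosedWord w)
    (hN : ∀ τ, Ncell w τ ≠ 1) (hs : (steps w).length + 2 * d ≤ 2 * (supp0 w).card) :
    (∀ τ, Ncell w τ = 0 ∨ Ncell w τ = 2) ∧ (∀ a b, Nedge w a b = 0 ∨ Nedge w a b = 2) ∧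
      ∀ τ, Even (NedgeHat w τ) := by
  induction hlen : (steps w).length using Nat.strong_induction_on generalizing w with
  | _ m ih =>
  rcases Nat.eq_zero_or_pos (steps w).length with h0 | hpos
  · have h0' : steps w = [] := List.length_eq_zero_iff.1 h0
    simp [Ncell, Nedge, NedgeHat, h0']
  obtain ⟨A, σ, σ', B, u, rfl, hN2, hu⟩ := exists_backtrack hcard hstep hcl hN hpos hs
  have hlen' := (steps_backtrack A B σ σ').length_eq
  simp only [List.length_cons] at hlen'
  have hcell : ∀ τ, Ncell (A ++ σ :: σ' :: σ :: B) τ =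
      Ncell (A ++ σ :: B) τ + if σ ∪ σ' = τ then 2 else 0 := fun τ => by
    simpa [Ncell] using length_filter_backtrack A B σ σ' (fun p => decide (p.1 ∪ p.2 = τ))
      (by simp [Finset.union_comm])
  have hedge : ∀ a b, Nedge (A ++ σ :: σ' :: σ :: B) a b =
      Nedge (A ++ σ :: B) a b + if (σ = a ∧ σ' = b) ∨ (σ = b ∧ σ' = a) then 2 else 0 :=
    fun a b => by
    simpa [Nedge] using length_filter_backtrack A B σ σ'
      (fun p => decide ((p.1 = a ∧ p.2 = b) ∨ (p.1 = b ∧ p.2 = a)))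
      (by simp only [decide_eq_decide]; tauto)
  have hhat : ∀ τ, NedgeHat (A ++ σ :: σ' :: σ :: B) τ = NedgeHat (A ++ σ :: B) τ +
      if σ ∪ σ' = τ ∧ Even (LMidx τ (σ' \ σ) + LMidx τ (σ \ σ')) then 2 else 0 := fun τ => by
    simpa [NedgeHat] using length_filter_backtrack A B σ σ'
      (fun p => decide (p.1 ∪ p.2 = τ ∧ Even (LMidx τ (p.2 \ p.1) + LMidx τ (p.1 \ p.2))))
      (by simp only [Finset.union_comm σ' σ, add_comm])
  have hzero : Ncell (A ++ σ :: B) (σ ∪ σ') = 0 := by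
    have := hcell (σ ∪ σ')
    rw [if_pos rfl] at this
    omega
  have hsupp : supp0 (A ++ σ :: σ' :: σ :: B) ⊆ insert u (supp0 (A ++ σ :: B)) := by
    intro v hv
    have hσ' : σ' ⊆ insert u σ := hu ▸ Finset.subset_union_right
    have := @hσ' v
    simp only [supp0_append, supp0_cons, Finset.mem_union, Finset.mem_insert] at hv this ⊢
    tauto
  have hsc := (Finset.card_le_card hsupp).trans (Finset.card_insert_le _ _)
  obtain ⟨h1, h2, h3⟩ := ih (steps (A ++ σ :: B)).length (by omega) (A ++ σ :: B)
    (fun ρ hρ => hcard ρ (by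
      simp only [List.mem_append, List.mem_cons] at hρ ⊢
      tauto))
    (fun p hp => hstep p ((steps_backtrack A B σ σ').mem_iff.2 (by simp [hp])))
    (by
      have : (A ++ σ :: B).head? = (A ++ σ :: σ' :: σ :: B).head? := by cases A <;> simp
      unfold IsClosedWord at hcl ⊢
      rw [this, hcl]
      simp [List.getLast?_cons_cons, List.getLast?_append])
    (fun τ => by
      have := hN τ
      rw [hcell] at this
      by_cases hτ : σ ∪ σ' = τ
      · rw [← hτ, hzero]
        omega
      · simpa [hτ] using this)
    (by omega) rfl
  refine ⟨fun τ => ?_, fun a b => ?_, fun τ => ?_⟩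
  · rw [hcell]
    split_ifs with hτ
    · rw [← hτ, hzero]
      omega
    · exact h1 τ
  · rw [hedge]
    split_ifs with hab
    · have hle := Nedge_le_Ncell (A ++ σ :: B) a b
      have hun : a ∪ b = σ ∪ σ' := by
        rcases hab with ⟨rfl, rfl⟩ | ⟨rfl, rfl⟩
        · rfl
        · exact Finset.union_comm _ _
      rw [hun, hzero] at hle
      omega
    · exact h2 a b
  · rw [hhat]
    split_ifs
    · exact (h3 τ).add even_two
    · exact h3 τ

lemma pair_eq_pair_iff {α : Type*} [DecidableEq α] (x y a b : α) :
    ({x, y} : Finset α) = {a, b} ↔ (x = a ∧ y = b) ∨ (x = b ∧ y = a) := by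
  rw [← Finset.coe_inj]
  push_cast
  exact Set.pair_eq_pair_iff

lemma count_pair_eq_Nedge (w : List (Finset ℕ)) (a b : Finset ℕ) :
    ((steps w).map (fun p => ({p.1, p.2} : Finset (Finset ℕ)))).count {a, b} = Nedge w a b := by
  rw [Nedge, List.count_eq_countP, List.countP_map, List.countP_eq_length_filter]
  congr 1
  refine List.filter_congr fun p _ => ?_
  simp [beq_eq_decide, pair_eq_pair_iff]

/-- **Lemma 3.9, parts (1) and (2).** Let `k` be even and let `w` be a closed word of
length `k+1` with `N_w(τ) ≠ 1` for every `d`-cell `τ` and `|supp₀(w)| = k/2 + d`. Then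
(1) `N_w(τ) ∈ {0,2}` for every `d`-cell `τ`; (2) `|E_w| = k/2` and `N_w(e) = 2` for every
edge `e ∈ E_w`, and in particular `sgn(w,τ) = 1` for every `d`-cell `τ`. -/
theorem wigner_word_structure (n d k : ℕ) (hd : 2 ≤ d) (hn : d + 1 ≤ n) (hk : Even k)
    (w : List (Finset ℕ)) (hw : InW n d k (k / 2 + d) w) :
    (∀ τ : Finset ℕ, Ncell w τ = 0 ∨ Ncell w τ = 2) ∧
    (edgeSet w).card = k / 2 ∧
    (∀ a b : Finset ℕ, ({a, b} : Finset (Finset ℕ)) ∈ edgeSet w → Nedge w a b = 2) ∧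
    (∀ τ : Finset ℕ, sgnW w τ = 1) := by
  obtain ⟨⟨hne, hletters, hchain⟩, hcl, hlen, hN, hsupp⟩ := hw
  have hl : (steps w).length = k := by rw [length_steps, hlen]; rfl
  obtain ⟨h1, h2, h3⟩ := crossings_of_maximal_support w (fun σ hσ => (hletters σ hσ).2)
    (card_union_of_isChain hchain) hcl hN (by rw [hl, hsupp]; have := hk.two_dvd; omega)
  have h4 : ∀ a b : Finset ℕ, ({a, b} : Finset (Finset ℕ)) ∈ edgeSet w → Nedge w a b = 2 := by
    intro a b hab
    have hpos := List.count_pos_iff.2 (List.mem_toFinset.1 hab)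
    rw [count_pair_eq_Nedge] at hpos
    have := h2 a b
    omega
  refine ⟨h1, ?_, h4, fun τ => (h3 τ).neg_one_pow⟩
  have hsum := List.sum_toFinset_count_eq_length
    ((steps w).map (fun p => ({p.1, p.2} : Finset (Finset ℕ))))
  rw [List.length_map, hl, Finset.sum_const_nat (m := 2)] at hsum
  · rw [edgeSet]
    omega
  · intro e he
    obtain ⟨p, -, rfl⟩ := List.mem_map.1 (List.mem_toFinset.1 he)
    rw [count_pair_eq_Nedge]
    exact h4 _ _ he
end
end

section
/- Let 𝔸 be the adjacency operator of the complete d-complex K(d,n) on n vertices. Then the eigenvalues of 𝔸 are n−d with multiplicity binom(n−1,d−1) and −d with multiplicity binom(n−1,d). -/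
open MeasureTheory ProbabilityTheory Filter Polynomial

noncomputable section

/-- The incidence sign of the vertex `v` in the simplex `σ`. -/
def vertexSign (σ : Finset ℕ) (v : ℕ) : ℝ := (-1) ^ LMidx σ {v}

/-- The simplicial coboundary of a function on simplices. -/
def simplexCoboundary (f : Finset ℕ → ℝ) (σ : Finset ℕ) : ℝ :=
  ∑ v ∈ σ, vertexSign σ v * f (σ.erase v)

/-- The simplicial boundary, over the vertex set `{0, …, n-1}`, of a function on simplices. -/
def simplexBoundary (n : ℕ) (f : Finset ℕ → ℝ) (σ : Finset ℕ) : ℝ :=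
  ∑ w ∈ Finset.range n \ σ, vertexSign σ w * f (insert w σ)

lemma vertexSign_mul_self (σ : Finset ℕ) (v : ℕ) : vertexSign σ v * vertexSign σ v = 1 := by
  unfold vertexSign
  rw [← mul_pow]
  simp

lemma vertexSign_insert {σ : Finset ℕ} {w : ℕ} (hw : w ∉ σ) (v : ℕ) :
    vertexSign (insert w σ) v = if w < v then -vertexSign σ v else vertexSign σ v := by
  unfold vertexSign LMidx
  rw [Finset.filter_insert]
  by_cases h : w < v
  · have hw' : w ∉ σ.filter (fun x => ∃ y ∈ ({v} : Finset ℕ), x < y) := by simp [hw]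
    simp only [Finset.mem_singleton, exists_eq_left, h, if_true] at hw' ⊢
    rw [Finset.card_insert_of_notMem hw', pow_succ]
    ring
  · simp [h]

lemma vertexSign_insert_self {σ : Finset ℕ} {w : ℕ} (hw : w ∉ σ) :
    vertexSign (insert w σ) w = vertexSign σ w := by
  simp [vertexSign_insert hw]

lemma vertexSign_insert_insert {ρ : Finset ℕ} {v w : ℕ} (hv : v ∉ ρ) (hw : w ∉ ρ) (h : v ≠ w) :
    vertexSign (insert v ρ) w * vertexSign (insert w (insert v ρ)) v =
      -(vertexSign (insert v ρ) v * vertexSign ρ w) := by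
  have hw' : w ∉ insert v ρ := by simp [hw, h.symm]
  rw [vertexSign_insert hw', vertexSign_insert_self hv, vertexSign_insert hv]
  rcases lt_or_gt_of_ne h with h | h
  · simp [h, h.not_gt]
    ring
  · simp [h, h.not_gt]
    ring

lemma vertexSign_mul_insert {σ : Finset ℕ} {v w : ℕ} (hv : v ∈ σ) (hw : w ∉ σ) :
    vertexSign σ w * vertexSign (insert w σ) v =
      -(vertexSign σ v * vertexSign (σ.erase v) w) := by
  have h : v ≠ w := by
    rintro rfl
    exact hw hv
  have := vertexSign_insert_insert (Finset.notMem_erase v σ)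
    (fun h' => hw (Finset.mem_of_mem_erase h')) h
  rwa [Finset.insert_erase hv] at this

lemma vertexSign_mul_erase {σ : Finset ℕ} {v w : ℕ} (hv : v ∈ σ) (hw : w ∈ σ) (h : v ≠ w) :
    vertexSign σ v * vertexSign (σ.erase v) w = -(vertexSign σ w * vertexSign (σ.erase w) v) := by
  have hv' : v ∈ σ.erase w := by simp [hv, h]
  have h1 := vertexSign_mul_insert hv' (Finset.notMem_erase w σ)
  have h2 := vertexSign_insert_self (Finset.notMem_erase w σ)
  have h3 := vertexSign_insert_self (Finset.notMem_erase w (σ.erase v))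
  rw [Finset.insert_erase hw] at h1 h2
  rw [Finset.insert_erase (by simp [hw, h.symm])] at h3
  rw [Finset.erase_right_comm] at h1
  rw [h2, h3]
  linear_combination
    vertexSign (σ.erase w) w * vertexSign ((σ.erase v).erase w) w * h1 -
      vertexSign σ v * vertexSign ((σ.erase v).erase w) w *
        vertexSign_mul_self (σ.erase w) w -
      vertexSign (σ.erase w) w * vertexSign (σ.erase w) v *
        vertexSign_mul_self ((σ.erase v).erase w) w

lemma simplexCoboundary_comp_self (f : Finset ℕ → ℝ) (σ : Finset ℕ) :
    simplexCoboundary (simplexCoboundary f) σ = 0 := by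
  have key : simplexCoboundary (simplexCoboundary f) σ = ∑ v ∈ σ, ∑ w ∈ σ,
      if v = w then 0
      else vertexSign σ v * vertexSign (σ.erase v) w * f ((σ.erase v).erase w) := by
    unfold simplexCoboundary
    refine Finset.sum_congr rfl fun v hv => ?_
    rw [← Finset.add_sum_erase σ _ hv, if_pos rfl, zero_add, Finset.mul_sum]
    refine Finset.sum_congr rfl fun w hw => ?_
    rw [if_neg (Finset.ne_of_mem_erase hw).symm, mul_assoc]
  have anti : simplexCoboundary (simplexCoboundary f) σ =
      -simplexCoboundary (simplexCoboundary f) σ := by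
    nth_rw 1 [key]
    rw [Finset.sum_comm, key, ← Finset.sum_neg_distrib]
    refine Finset.sum_congr rfl fun w hw => ?_
    rw [← Finset.sum_neg_distrib]
    refine Finset.sum_congr rfl fun v hv => ?_
    by_cases h : v = w
    · simp [h]
    · rw [if_neg h, if_neg (Ne.symm h), vertexSign_mul_erase hv hw h, Finset.erase_right_comm]
      ring
  linarith

lemma simplexCoboundary_simplexBoundary {n : ℕ} {σ : Finset ℕ} (hσ : σ ⊆ Finset.range n)
    (f : Finset ℕ → ℝ) :
    simplexCoboundary (simplexBoundary n f) σ = σ.card * f σ +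
      ∑ v ∈ σ, ∑ w ∈ Finset.range n \ σ,
        vertexSign σ v * vertexSign (σ.erase v) w * f (insert w (σ.erase v)) := by
  unfold simplexCoboundary simplexBoundary
  rw [← nsmul_eq_mul, ← Finset.sum_const, ← Finset.sum_add_distrib]
  refine Finset.sum_congr rfl fun v hv => ?_
  have hset : Finset.range n \ σ.erase v = insert v (Finset.range n \ σ) := by
    ext x
    have := @hσ v hv
    simp only [Finset.mem_sdiff, Finset.mem_insert, Finset.mem_erase]
    by_cases hx : x = v
    · subst hx
      simp [this]
    · simp [hx]
  rw [hset, Finset.sum_insert (by simp [hv]), mul_add, Finset.mul_sum, Finset.insert_erase hv]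
  have h := vertexSign_insert_self (Finset.notMem_erase v σ)
  rw [Finset.insert_erase hv] at h
  rw [← h, ← mul_assoc, vertexSign_mul_self, one_mul]
  simp only [mul_assoc]

lemma simplexBoundary_simplexCoboundary (n : ℕ) (σ : Finset ℕ) (f : Finset ℕ → ℝ) :
    simplexBoundary n (simplexCoboundary f) σ = (Finset.range n \ σ).card * f σ -
      ∑ v ∈ σ, ∑ w ∈ Finset.range n \ σ,
        vertexSign σ v * vertexSign (σ.erase v) w * f (insert w (σ.erase v)) := by
  rw [Finset.sum_comm]
  unfold simplexCoboundary simplexBoundary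
  rw [← nsmul_eq_mul, ← Finset.sum_const, ← Finset.sum_sub_distrib]
  refine Finset.sum_congr rfl fun w hw => ?_
  have hw' := (Finset.mem_sdiff.mp hw).2
  beta_reduce
  rw [Finset.sum_insert hw', mul_add, Finset.erase_insert hw', vertexSign_insert_self hw',
    ← mul_assoc, vertexSign_mul_self, one_mul, sub_eq_add_neg, Finset.mul_sum,
    ← Finset.sum_neg_distrib]
  congr 1
  refine Finset.sum_congr rfl fun v hv => ?_
  have h : v ≠ w := by
    rintro rfl
    exact hw' hv
  rw [← mul_assoc, vertexSign_mul_insert hv hw', Finset.erase_insert_of_ne h.symm]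
  ring

lemma simplexBoundary_simplexCoboundary_add {n : ℕ} {σ : Finset ℕ} (hσ : σ ⊆ Finset.range n)
    (f : Finset ℕ → ℝ) :
    simplexBoundary n (simplexCoboundary f) σ + simplexCoboundary (simplexBoundary n f) σ =
      n * f σ := by
  rw [simplexBoundary_simplexCoboundary, simplexCoboundary_simplexBoundary hσ,
    Finset.cast_card_sdiff hσ, Finset.card_range]
  ring

/-- Extension by zero of a function on the cells of size `d` to all finite sets. -/
def cellExtend {n d : ℕ} (x : LMCell n d → ℝ) (σ : Finset ℕ) : ℝ :=
  if h : σ ∈ Finset.powersetCard d (Finset.range n) then x ⟨σ, h⟩ else 0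

lemma cellExtend_coe {n d : ℕ} (x : LMCell n d → ℝ) (σ : LMCell n d) :
    cellExtend x σ.1 = x σ := by
  simp only [cellExtend, σ.2, dif_pos]

lemma LMadj_univ_apply_insert_erase {n d : ℕ} (σ σ' : LMCell n d) {v w : ℕ} (hv : v ∈ σ.1)
    (hw : w ∉ σ.1) (h : σ'.1 = insert w (σ.1.erase v)) :
    LMadj n d Set.univ σ σ' = vertexSign σ.1 v * vertexSign (σ.1.erase v) w := by
  have hvw : v ≠ w := by
    rintro rfl
    exact hw hv
  have hσ := (Finset.mem_powersetCard.mp σ.2).2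
  have hu : σ.1 ∪ σ'.1 = insert w σ.1 := by
    rw [h]
    ext x
    simp only [Finset.mem_union, Finset.mem_insert, Finset.mem_erase]
    tauto
  have h1 : σ'.1 \ σ.1 = {w} := by
    rw [h]
    ext x
    simp only [Finset.mem_sdiff, Finset.mem_insert, Finset.mem_erase, Finset.mem_singleton]
    constructor
    · tauto
    · rintro rfl
      tauto
  have h2 : σ.1 \ σ'.1 = {v} := by
    rw [h]
    ext x
    simp only [Finset.mem_sdiff, Finset.mem_insert, Finset.mem_erase, Finset.mem_singleton]
    constructor
    · tauto
    · rintro rfl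
      tauto
  unfold LMadj
  rw [hu, h1, h2, if_pos ⟨by rw [Finset.card_insert_of_notMem hw, hσ], Set.mem_univ _⟩,
    pow_succ, pow_add]
  have h3 := vertexSign_mul_insert hv hw
  rw [← vertexSign_insert_self hw] at h3
  unfold vertexSign at h3 ⊢
  rw [h3]
  ring

lemma LMadj_univ_mulVec {n d : ℕ} (x : LMCell n d → ℝ) (σ : LMCell n d) :
    (LMadj n d Set.univ).mulVec x σ = ∑ v ∈ σ.1, ∑ w ∈ Finset.range n \ σ.1,
      vertexSign σ.1 v * vertexSign (σ.1.erase v) w *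
        cellExtend x (insert w (σ.1.erase v)) := by
  obtain ⟨hσ, hσd⟩ := Finset.mem_powersetCard.mp σ.2
  have hmem : ∀ p ∈ σ.1 ×ˢ (Finset.range n \ σ.1),
      insert p.2 (σ.1.erase p.1) ∈ Finset.powersetCard d (Finset.range n) := by
    rintro ⟨v, w⟩ hp
    simp only [Finset.mem_product, Finset.mem_sdiff] at hp
    rw [Finset.mem_powersetCard]
    refine ⟨Finset.insert_subset hp.2.1 ((Finset.erase_subset _ _).trans hσ), ?_⟩
    rw [Finset.card_insert_of_notMem (by simp [hp.2.2]), Finset.card_erase_add_one hp.1, hσd]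
  rw [← Finset.sum_product', Matrix.mulVec, dotProduct]
  symm
  refine Finset.sum_bij_ne_zero (fun p hp _ => ⟨_, hmem p hp⟩) (fun _ _ _ => Finset.mem_univ _)
    ?_ ?_ ?_
  · rintro ⟨v, w⟩ hp - ⟨v', w'⟩ hp' - heq
    simp only [Finset.mem_product, Finset.mem_sdiff, Subtype.mk.injEq] at hp hp' heq
    have hw : w = w' := by
      have : w ∈ insert w' (σ.1.erase v') := heq ▸ Finset.mem_insert_self _ _
      simpa [hp.2.2] using this
    have hv : v = v' := by
      by_contra hne
      have : v ∈ insert w (σ.1.erase v) := by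
        rw [heq]
        simp [hne, hp.1]
      simp only [Finset.mem_insert, Finset.mem_erase, ne_eq, not_true, false_and, or_false] at this
      exact hp.2.2 (this ▸ hp.1)
    rw [hv, hw]
  · intro σ' _ hne
    obtain ⟨hσ', hσd'⟩ := Finset.mem_powersetCard.mp σ'.2
    have hu : (σ.1 ∪ σ'.1).card = d + 1 := by
      by_contra hu
      exact hne (by simp [LMadj, hu])
    have c1 := Finset.card_sdiff_add_card σ.1 σ'.1
    have c2 := Finset.card_sdiff_add_card σ'.1 σ.1
    rw [Finset.union_comm] at c2
    obtain ⟨v, hv⟩ := Finset.card_eq_one.mp (show (σ.1 \ σ'.1).card = 1 by omega)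
    obtain ⟨w, hw⟩ := Finset.card_eq_one.mp (show (σ'.1 \ σ.1).card = 1 by omega)
    simp only [Finset.ext_iff, Finset.mem_sdiff, Finset.mem_singleton] at hv hw
    have hv0 := (hv v).2 rfl
    have hw0 := (hw w).2 rfl
    have heq : σ'.1 = insert w (σ.1.erase v) := by
      ext y
      have := hv y
      have := hw y
      simp only [Finset.mem_insert, Finset.mem_erase]
      tauto
    have hp : (v, w) ∈ σ.1 ×ˢ (Finset.range n \ σ.1) := by
      simp only [Finset.mem_product, Finset.mem_sdiff]
      exact ⟨hv0.1, hσ' hw0.1, hw0.2⟩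
    refine ⟨(v, w), hp, ?_, Subtype.ext heq.symm⟩
    rw [← heq, cellExtend_coe, ← LMadj_univ_apply_insert_erase σ σ' hv0.1 hw0.2 heq]
    exact hne
  · rintro ⟨v, w⟩ hp -
    have hp' := hp
    simp only [Finset.mem_product, Finset.mem_sdiff] at hp'
    rw [LMadj_univ_apply_insert_erase σ ⟨_, hmem _ hp⟩ hp'.1 hp'.2.2 rfl,
      ← cellExtend_coe x ⟨_, hmem _ hp⟩]

lemma simplexCoboundary_simplexBoundary_cellExtend {n d : ℕ} {x : LMCell n d → ℝ} {μ : ℝ}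
    (hx : (LMadj n d Set.univ).mulVec x = μ • x) {σ : Finset ℕ} (hσ : σ ⊆ Finset.range n) :
    simplexCoboundary (simplexBoundary n (cellExtend x)) σ = (μ + d) * cellExtend x σ := by
  rw [simplexCoboundary_simplexBoundary hσ]
  by_cases hd : σ.card = d
  · have h := congrFun hx ⟨σ, Finset.mem_powersetCard.mpr ⟨hσ, hd⟩⟩
    rw [LMadj_univ_mulVec, Pi.smul_apply, smul_eq_mul, ← cellExtend_coe x] at h
    have hd' : (σ.card : ℝ) = d := by rw [hd]
    linear_combination h + cellExtend x σ * hd'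
  · have h0 : ∀ τ : Finset ℕ, τ.card = σ.card → cellExtend x τ = 0 := by
      intro τ hτ
      have : τ ∉ Finset.powersetCard d (Finset.range n) := by
        rw [Finset.mem_powersetCard, hτ]
        tauto
      exact dif_neg this
    rw [h0 σ rfl, mul_zero, mul_zero, zero_add]
    refine Finset.sum_eq_zero fun v hv => Finset.sum_eq_zero fun w hw => ?_
    have hw' := (Finset.mem_sdiff.mp hw).2
    rw [h0, mul_zero]
    rw [Finset.card_insert_of_notMem (by simp [hw']), Finset.card_erase_add_one hv]

lemma eigenvalue_LMadj_univ {n d : ℕ} {x : LMCell n d → ℝ} {μ : ℝ} (hx0 : x ≠ 0)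
    (hx : (LMadj n d Set.univ).mulVec x = μ • x) : μ = n - d ∨ μ = -d := by
  by_cases hμ : μ + d = 0
  · right
    linarith
  left
  obtain ⟨σ, hσ⟩ := Function.ne_iff.mp hx0
  have hsub := (Finset.mem_powersetCard.mp σ.2).1
  have hcocycle : ∀ τ ⊆ Finset.range n, simplexCoboundary (cellExtend x) τ = 0 := by
    intro τ hτ
    have h := simplexCoboundary_comp_self (simplexBoundary n (cellExtend x)) τ
    have h' : simplexCoboundary (simplexCoboundary (simplexBoundary n (cellExtend x))) τ =
        (μ + d) * simplexCoboundary (cellExtend x) τ := by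
      rw [simplexCoboundary, simplexCoboundary, Finset.mul_sum]
      refine Finset.sum_congr rfl fun v _ => ?_
      rw [simplexCoboundary_simplexBoundary_cellExtend hx ((Finset.erase_subset _ _).trans hτ)]
      ring
    rw [h'] at h
    exact (mul_eq_zero.mp h).resolve_left hμ
  have h := simplexBoundary_simplexCoboundary_add hsub (cellExtend x)
  have h0 : simplexBoundary n (simplexCoboundary (cellExtend x)) σ.1 = 0 := by
    refine Finset.sum_eq_zero fun w hw => ?_
    rw [hcocycle _ (Finset.insert_subset (Finset.mem_sdiff.mp hw).1 hsub), mul_zero]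
  rw [h0, zero_add, simplexCoboundary_simplexBoundary_cellExtend hx hsub, cellExtend_coe] at h
  have := mul_right_cancel₀ hσ h
  linarith

lemma LMadj_isHermitian (n d : ℕ) (X : Set (Finset ℕ)) : (LMadj n d X).IsHermitian := by
  ext σ σ'
  rw [Matrix.conjTranspose_apply, star_trivial]
  unfold LMadj
  rw [Finset.union_comm σ'.1 σ.1, add_comm (LMidx (σ.1 ∪ σ'.1) (σ.1 \ σ'.1))]

lemma LMadj_trace (n d : ℕ) (X : Set (Finset ℕ)) : (LMadj n d X).trace = 0 := by
  refine Finset.sum_eq_zero fun σ _ => ?_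
  simp [LMadj, (Finset.mem_powersetCard.mp σ.2).2]

/-- A Hermitian real matrix whose eigenvalues lie in `{a, b}` has characteristic polynomial
`(X - a) ^ k * (X - b) ^ l`, where the exponents are determined by the size and the trace. -/
lemma exists_charpoly_eq_of_eigenvalues {ι : Type*} [Fintype ι] [DecidableEq ι]
    {M : Matrix ι ι ℝ} (hM : M.IsHermitian) {a b : ℝ}
    (h : ∀ i, hM.eigenvalues i = a ∨ hM.eigenvalues i = b) :
    ∃ k l : ℕ, k + l = Fintype.card ι ∧ k * a + l * b = M.trace ∧
      M.charpoly = (X - C a) ^ k * (X - C b) ^ l := by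
  classical
  have hb : ∀ i ∈ Finset.univ.filter (fun i => ¬ hM.eigenvalues i = a),
      hM.eigenvalues i = b := fun i hi => (h i).resolve_left (Finset.mem_filter.mp hi).2
  have ha : ∀ i ∈ Finset.univ.filter (fun i => hM.eigenvalues i = a),
      hM.eigenvalues i = a := fun i hi => (Finset.mem_filter.mp hi).2
  refine ⟨(Finset.univ.filter (fun i => hM.eigenvalues i = a)).card,
    (Finset.univ.filter (fun i => ¬ hM.eigenvalues i = a)).card,
    Finset.card_filter_add_card_filter_not _, ?_, ?_⟩
  · rw [hM.trace_eq_sum_eigenvalues,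
      ← Finset.sum_filter_add_sum_filter_not _ (fun i => hM.eigenvalues i = a)]
    congr 1
    · rw [Finset.sum_congr rfl fun i hi => congrArg _ (ha i hi), Finset.sum_const, nsmul_eq_mul]
      rfl
    · rw [Finset.sum_congr rfl fun i hi => congrArg _ (hb i hi), Finset.sum_const, nsmul_eq_mul]
      rfl
  · rw [hM.charpoly_eq,
      ← Finset.prod_filter_mul_prod_filter_not _ (fun i => hM.eigenvalues i = a)]
    congr 1
    · refine Finset.prod_eq_pow_card fun i hi => ?_
      simp [ha i hi]
    · refine Finset.prod_eq_pow_card fun i hi => ?_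
      simp [hb i hi]

/-- **Lemma 4.1 (Gundert–Wagner).** The eigenvalues of the adjacency operator `𝔸` of the
complete `d`-complex on `n` vertices are `n - d` with multiplicity `binom(n-1,d-1)` and `-d`
with multiplicity `binom(n-1,d)`; equivalently, its characteristic polynomial is
`(X - (n-d))^{binom(n-1,d-1)} (X + d)^{binom(n-1,d)}`. -/
theorem eigenvalues_complete_complex (n d : ℕ) (hd : 1 ≤ d) (hn : d + 1 ≤ n) :
    (LMadj n d Set.univ).charpoly =
      (Polynomial.X - Polynomial.C ((n : ℝ) - (d : ℝ))) ^ (Nat.choose (n - 1) (d - 1)) *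
        (Polynomial.X + Polynomial.C ((d : ℝ))) ^ (Nat.choose (n - 1) d) := by
  have hM := LMadj_isHermitian n d Set.univ
  have heig : ∀ i, hM.eigenvalues i = (n : ℝ) - d ∨ hM.eigenvalues i = -(d : ℝ) := by
    intro i
    refine eigenvalue_LMadj_univ ?_ (hM.mulVec_eigenvectorBasis i)
    intro h0
    exact hM.eigenvectorBasis.orthonormal.ne_zero i (PiLp.ext fun j => congrFun h0 j)
  obtain ⟨k, l, hcard, htrace, hchar⟩ := exists_charpoly_eq_of_eigenvalues hM heig
  rw [LMadj_trace] at htrace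
  rw [Fintype.card_coe, Finset.card_powersetCard, Finset.card_range] at hcard
  obtain ⟨m, rfl⟩ : ∃ m, n = m + 1 := ⟨n - 1, by omega⟩
  obtain ⟨e, rfl⟩ : ∃ e, d = e + 1 := ⟨d - 1, by omega⟩
  have hkl : (m + 1) * k = (m + 1).choose (e + 1) * (e + 1) := by
    rw [← hcard]
    have : ((m + 1 : ℕ) : ℝ) * k = (k + l) * ((e + 1 : ℕ) : ℝ) := by linarith
    exact_mod_cast this
  rw [← Nat.add_one_mul_choose_eq] at hkl
  have hk : k = m.choose e := Nat.eq_of_mul_eq_mul_left m.succ_pos hkl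
  have hl : l = m.choose (e + 1) := by
    rw [Nat.choose_succ_succ'] at hcard
    omega
  rw [hchar, hk, hl]
  simp only [Nat.add_sub_cancel, map_neg, sub_neg_eq_add]
end
end
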